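/- arXiv:math/0402094 — 4 statements merged into one kernel-verified Lean document; each statement's English description precedes it below -/
import Mathlib

section
/- Let A be a unital separable C*-algebra and let α be an automorphism of A such that α^r is approximately inner for some integer r ≥ 1. Let m ∈ ℕ, let m_0 ≥ m be the smallest integer divisible by r, and set l = m + (r−1)(m_0+1). Suppose that for i = 0, …, l and n ∈ ℕ there are projections e_i^{(n)} ∈ A and reals δ_n with δ_n → 0 such that: ‖α(e_i^{(n)}) − e_{i+1}^{(n)}‖ < δ_n for 0 ≤ i ≤ l−1; e_i^{(n)} e_j^{(n)} = 0 whenever i ≠ j; e_i^{(n)} is Murray–von Neumann equivalent to e_j^{(n)} in A for all i, j; and for each fixed i the sequence (e_i^{(n)})_n is central. For 0 ≤ i ≤ m set p_i^{(n)} = Σ_{j=0}^{r−1} e_{i+j(m_0+1)}^{(n)}. Then for each i = 0, …, m−1 there is a central sequence (w_i^{(n)})_n in A with (w_i^{(n)})* w_i^{(n)} = p_i^{(n)} and w_i^{(n)} (w_i^{(n)})* = p_{i+1}^{(n)}; moreover, for each i = 0, …, m−1, ‖α(p_i^{(n)}) − p_{i+1}^{(n)}‖ → 0 as n → ∞. 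-/
open Filter Topology

/-- A projection in a C*-algebra: a self-adjoint idempotent. -/
def IsProjection {A : Type*} [Mul A] [Star A] (p : A) : Prop :=
  IsSelfAdjoint p ∧ IsIdempotentElem p

/-- A positive element of a C*-algebra (one of the standard equivalent definitions). -/
def IsPos {A : Type*} [Mul A] [Star A] (a : A) : Prop :=
  ∃ b : A, a = star b * b

/-- A central sequence: asymptotically commutes with every element. -/
def IsCentralSeq {A : Type*} [CStarAlgebra A] (x : ℕ → A) : Prop :=
  ∀ a : A, Tendsto (fun n => ‖x n * a - a * x n‖) atTop (nhds 0)

/-- An approximately inner map: on every finite set it is approximated by `a ↦ v* a v`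
for unitaries `v`. -/
def ApproxInner {A : Type*} [CStarAlgebra A] (f : A → A) : Prop :=
  ∀ (F : Finset A) (ε : ℝ), 0 < ε →
    ∃ v : A, v ∈ unitary A ∧ ∀ a ∈ F, ‖f a - star v * a * v‖ < ε

/-- Murray–von Neumann equivalence of projections. -/
def MvNEquiv {A : Type*} [CStarAlgebra A] (p q : A) : Prop :=
  ∃ w : A, star w * w = p ∧ w * star w = q

/-- `[a] ≤ [b]`: there is `x` with `a = x*x` and `xx*` in the closure of `bAb`. -/
def CuntzLE {A : Type*} [CStarAlgebra A] (a b : A) : Prop :=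
  ∃ x : A, a = star x * x ∧ x * star x ∈ closure (Set.range fun c => b * c * b)

/-- A simple C*-algebra: the only closed two-sided ideals are trivial. -/
def IsSimpleCStar (A : Type*) [CStarAlgebra A] : Prop :=
  ∀ I : TwoSidedIdeal A, IsClosed (I : Set A) →
    (I : Set A) = {0} ∨ (I : Set A) = Set.univ

/-- A tracial state on a unital C*-algebra. -/
def IsTracialState {A : Type*} [CStarAlgebra A] (τ : A →ₗ[ℂ] ℂ) : Prop :=
  (∀ a : A, ∃ r : ℝ, 0 ≤ r ∧ τ (star a * a) = (r : ℂ)) ∧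
  τ 1 = 1 ∧ ∀ a b : A, τ (a * b) = τ (b * a)

/-- The SP-property: every hereditary subalgebra `\overline{aAa}` (`a` positive nonzero)
contains a nonzero projection. -/
def SPProperty (A : Type*) [CStarAlgebra A] : Prop :=
  ∀ a : A, IsPos a → a ≠ 0 →
    ∃ p : A, IsProjection p ∧ p ≠ 0 ∧ p ∈ closure (Set.range fun c => a * c * a)

/-- Stable rank one: invertibles are dense. -/
def StableRankOne (A : Type*) [CStarAlgebra A] : Prop :=
  Dense {x : A | IsUnit x}

/-- The Fundamental Comparison Property. -/
def FundamentalComparison (A : Type*) [CStarAlgebra A] : Prop :=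
  ∀ p q : A, IsProjection p → IsProjection q →
    (∀ τ : A →ₗ[ℂ] ℂ, IsTracialState τ → (τ p).re < (τ q).re) →
    ∃ q' : A, IsProjection q' ∧ q' * q = q' ∧ q * q' = q' ∧ MvNEquiv p q'

/-- Tracial (topological) rank zero for a simple unital C*-algebra. -/
def TracialRankZero (A : Type*) [CStarAlgebra A] : Prop :=
  ∀ (F : Finset A) (ε : ℝ), 0 < ε → ∀ a : A, IsPos a → a ≠ 0 →
    ∃ (B : NonUnitalStarSubalgebra ℂ A) (p : A),
      FiniteDimensional ℂ B ∧ IsProjection p ∧ p ∈ B ∧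
      (∀ b ∈ B, p * b = b ∧ b * p = b) ∧
      (∀ x ∈ F, ‖x * p - p * x‖ < ε) ∧
      (∀ x ∈ F, ∃ b ∈ B, ‖p * x * p - b‖ < ε) ∧
      CuntzLE (1 - p) a

/-- The tracial Rokhlin property for an automorphism. -/
def TracialRokhlin {A : Type*} [CStarAlgebra A] (α : A ≃⋆ₐ[ℂ] A) : Prop :=
  ∀ (F : Finset A) (ε : ℝ), 0 < ε → ∀ n : ℕ, ∀ x : A, IsPos x → x ≠ 0 →
    ∃ e : Fin (n + 1) → A,
      (∀ j, IsProjection (e j)) ∧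
      (∀ i j, i ≠ j → e i * e j = 0) ∧
      (∀ j : Fin (n + 1), (j : ℕ) < n → ‖α (e j) - e (j + 1)‖ < ε) ∧
      (∀ j, ∀ a ∈ F, ‖e j * a - a * e j‖ < ε) ∧
      CuntzLE (1 - ∑ j, e j) x

/-- The tracial cyclic Rokhlin property for an automorphism: as the tracial
Rokhlin property, but with the cyclic condition `‖α(e n) - e 0‖ < ε` included
(in `Fin (n+1)`, `j + 1` wraps around, so `e (n + 1) = e 0`). -/
def TracialCyclicRokhlin {A : Type*} [CStarAlgebra A] (α : A ≃⋆ₐ[ℂ] A) : Prop :=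
  ∀ (F : Finset A) (ε : ℝ), 0 < ε → ∀ n : ℕ, ∀ x : A, IsPos x → x ≠ 0 →
    ∃ e : Fin (n + 1) → A,
      (∀ j, IsProjection (e j)) ∧
      (∀ i j, i ≠ j → e i * e j = 0) ∧
      (∀ j : Fin (n + 1), ‖α (e j) - e (j + 1)‖ < ε) ∧
      (∀ j, ∀ a ∈ F, ‖e j * a - a * e j‖ < ε) ∧
      CuntzLE (1 - ∑ j, e j) x

/-- Integer powers of an automorphism, as a function. -/
def autZPow {A : Type*} [CStarAlgebra A] (α : A ≃⋆ₐ[ℂ] A) (m : ℤ) : A → A :=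
  if 0 ≤ m then (⇑α)^[m.toNat] else (⇑α.symm)^[(-m).toNat]

/-- A uniformly outer map. -/
def UniformlyOuter {A : Type*} [CStarAlgebra A] (f : A → A) : Prop :=
  ∀ (a p : A), IsProjection p → ∀ ε : ℝ, 0 < ε →
    ∃ (n : ℕ) (q : Fin n → A),
      (∀ i, IsProjection (q i)) ∧ (∑ i, q i) = p ∧
      ∀ i, ‖q i * a * f (q i)‖ < ε

namespace Stmt1Aux

/-- An inverse square root of an element close to `1`. -/
lemma exists_invsqrt {A : Type*} [CStarAlgebra A] (b : A) (hb : IsSelfAdjoint b)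
    (h : ‖b - 1‖ ≤ 1 / 2) :
    ∃ c : A, IsSelfAdjoint c ∧ c * b * c = 1 ∧ c * (c * b) = 1 ∧ ‖c - 1‖ ≤ 2 * ‖b - 1‖ ∧
      ∀ x, Commute b x → Commute c x := by
  have hspec : ∀ x ∈ spectrum ℝ b, |x - 1| ≤ ‖b - 1‖ := by
    intro x hx
    have h1 := norm_apply_le_norm_cfc (fun x : ℝ => x - 1) b hx (by fun_prop) hb
    rw [cfc_sub (fun x : ℝ => x) (fun _ => 1) b (by fun_prop) (by fun_prop), cfc_id' ℝ b hb,
      cfc_const_one ℝ b] at h1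
    simpa using h1
  have hlow : ∀ x ∈ spectrum ℝ b, 1 / 2 ≤ x := by
    intro x hx
    have := abs_le.1 ((hspec x hx).trans h)
    linarith
  have hcont : ContinuousOn (fun x : ℝ => (√x)⁻¹) (spectrum ℝ b) := by
    apply ContinuousOn.inv₀ (by fun_prop)
    intro x hx
    have := hlow x hx
    exact (Real.sqrt_pos.2 (by linarith)).ne'
  have key : cfc (fun x : ℝ => (√x)⁻¹) b * (cfc (fun x : ℝ => (√x)⁻¹) b * b) = 1 := by
    nth_rw 3 [← cfc_id' ℝ b hb]
    rw [← cfc_mul (fun x : ℝ => (√x)⁻¹) (fun x => x) b hcont (by fun_prop),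
      ← cfc_mul (fun x : ℝ => (√x)⁻¹) (fun x : ℝ => (√x)⁻¹ * x) b hcont
        (hcont.mul (by fun_prop)), ← cfc_const_one ℝ b hb]
    apply cfc_congr
    intro x hx
    have h0 := hlow x hx
    have h1 : 0 < √x := Real.sqrt_pos.2 (by linarith)
    have h2 : √x * √x = x := Real.mul_self_sqrt (by linarith)
    simp only
    nth_rw 3 [← h2]
    field_simp
  have hcomm : Commute (cfc (fun x : ℝ => (√x)⁻¹) b) b := (Commute.refl b).cfc_real _
  refine ⟨cfc (fun x : ℝ => (√x)⁻¹) b, cfc_predicate _ b, ?_, key, ?_, ?_⟩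
  · rw [mul_assoc, ← hcomm.eq]; exact key
  · have : cfc (fun x : ℝ => (√x)⁻¹) b - 1 = cfc (fun x : ℝ => (√x)⁻¹ - 1) b := by
      rw [cfc_sub (fun x : ℝ => (√x)⁻¹) (fun _ => 1) b hcont (by fun_prop), cfc_const_one ℝ b]
    rw [this]
    apply norm_cfc_le (by positivity)
    intro x hx
    have h0 := hlow x hx
    have h3 := hspec x hx
    have h1 : 1 / 2 ≤ √x := Real.le_sqrt_of_sq_le (by linarith)
    have h2 : √x * √x = x := Real.mul_self_sqrt (by linarith)
    have h4 : (√x)⁻¹ - 1 = (1 - x) * ((√x * (1 + √x))⁻¹) := by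
      nth_rw 2 [← h2]
      field_simp
      ring
    have h5 : (√x * (1 + √x))⁻¹ ≤ 2 := by
      rw [inv_le_comm₀ (by positivity) (by norm_num)]
      nlinarith
    have h6 : 0 ≤ (√x * (1 + √x))⁻¹ := by positivity
    rw [h4, Real.norm_eq_abs, abs_mul, abs_of_nonneg h6, abs_sub_comm]
    nlinarith [abs_nonneg (x - 1), norm_nonneg (b - 1)]
  · intro x hx
    exact hx.cfc_real _

lemma proj_norm {A : Type*} [CStarAlgebra A] {p : A} (hp : IsProjection p) : ‖p‖ ≤ 1 :=
  IsStarProjection.norm_le p ⟨hp.2, hp.1⟩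

/-- Close projections are conjugate by a unitary close to `1`. -/
lemma close_proj {A : Type*} [CStarAlgebra A] (p q : A) (hp : IsProjection p)
    (hq : IsProjection q) (h : ‖p - q‖ ≤ 1 / 16) :
    ∃ u ∈ unitary A, u * p * star u = q ∧ ‖u - 1‖ ≤ 16 * ‖p - q‖ := by
  have hpp : p * p = p := hp.2
  have hqq : q * q = q := hq.2
  have hps : star p = p := hp.1
  have hqs : star q = q := hq.1
  set ε := ‖p - q‖ with hε
  have hε0 : 0 ≤ ε := norm_nonneg _
  obtain ⟨s, hs⟩ : ∃ s, s = q * p + (1 - q) * (1 - p) := ⟨_, rfl⟩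
  have hsp : s * p = q * s := by
    rw [hs]
    simp only [mul_add, add_mul, mul_sub, sub_mul, mul_one, one_mul, mul_assoc, hpp]
    simp only [← mul_assoc, hqq]
    abel
  have hsp' : p * star s = star s * q := by
    have := congrArg star hsp
    simpa [hps, hqs] using this
  have hs1 : ‖s - 1‖ ≤ 2 * ε := by
    have h1 : s - 1 = q * (p - q) - (p - q) * p := by
      rw [hs]
      simp only [mul_sub, sub_mul, mul_one, one_mul, hpp, hqq]
      abel
    rw [h1]
    have h2 := norm_sub_le (q * (p - q)) ((p - q) * p)
    have h3 := norm_mul_le q (p - q)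
    have h4 := norm_mul_le (p - q) p
    have h5 := proj_norm hp
    have h6 := proj_norm hq
    nlinarith
  have hs1' : ‖star s - 1‖ ≤ 2 * ε := by
    have : star s - 1 = star (s - 1) := by simp
    rw [this, norm_star]; exact hs1
  have hb1 : ‖star s * s - 1‖ ≤ 6 * ε := by
    have h1 : star s * s - 1 = (star s - 1) * (s - 1) + (star s - 1) + (s - 1) := by
      noncomm_ring
    rw [h1]
    have h2 := norm_add₃_le (a := (star s - 1) * (s - 1)) (b := star s - 1) (c := s - 1)
    have h3 := norm_mul_le (star s - 1) (s - 1)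
    nlinarith [norm_nonneg (s - 1), norm_nonneg (star s - 1)]
  obtain ⟨c, hc, hcbc, hccb, hc1, hccomm⟩ := exists_invsqrt (star s * s)
    (IsSelfAdjoint.star_mul_self s) (by linarith)
  have hcs : star c = c := hc
  have hcp : Commute c p := by
    apply hccomm
    show star s * s * p = p * (star s * s)
    rw [mul_assoc, hsp, ← mul_assoc, ← mul_assoc, hsp']
  have hu1 : star (s * c) * (s * c) = 1 := by
    rw [star_mul, hcs, ← hcbc]; simp only [mul_assoc]
  have hunit : IsUnit s := by
    have := isUnit_one_sub_of_norm_lt_one (x := 1 - s) (by rw [norm_sub_rev]; linarith)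
    simpa using this
  have hu2 : (s * c) * star (s * c) = 1 := by
    rw [star_mul, hcs]
    obtain ⟨t, ht⟩ := hunit
    have h1 : s * (t⁻¹ : Aˣ) = 1 := by rw [← ht]; simp
    have h2 : c * c * star s = (t⁻¹ : Aˣ) := by
      calc c * c * star s = c * (c * (star s * s)) * (t⁻¹ : Aˣ) := by
            simp only [mul_assoc, h1, mul_one]
        _ = _ := by rw [hccb, one_mul]
    rw [← h1, ← h2]; simp only [mul_assoc]
  refine ⟨s * c, Unitary.mem_iff.2 ⟨hu1, hu2⟩, ?_, ?_⟩
  · rw [mul_assoc s c p, hcp.eq, ← mul_assoc, hsp, mul_assoc, mul_assoc]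
    rw [← mul_assoc s c, hu2, mul_one]
  · have h1 : s * c - 1 = (s - 1) * (c - 1) + (s - 1) + (c - 1) := by noncomm_ring
    rw [h1]
    have h2 := norm_add₃_le (a := (s - 1) * (c - 1)) (b := s - 1) (c := c - 1)
    have h3 := norm_mul_le (s - 1) (c - 1)
    nlinarith [norm_nonneg (s - 1), norm_nonneg (c - 1)]

lemma proj_one {A : Type*} [CStarAlgebra A] : IsProjection (1 : A) :=
  ⟨IsSelfAdjoint.one A, IsIdempotentElem.one⟩

lemma norm_le_of_proj {A : Type*} [CStarAlgebra A] {w : A} (h : IsProjection (star w * w)) :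
    ‖w‖ ≤ 1 := by
  have h1 := proj_norm h
  rw [CStarRing.norm_star_mul_self] at h1
  nlinarith [norm_nonneg w]

lemma norm_le_of_unitary {A : Type*} [CStarAlgebra A] {w : A} (h : w ∈ unitary A) :
    ‖w‖ ≤ 1 := by
  apply norm_le_of_proj
  rw [(Unitary.mem_iff.1 h).1]; exact proj_one

lemma comm_mul_le {A : Type*} [CStarAlgebra A] {x y d : A} (hx : ‖x‖ ≤ 1) (hy : ‖y‖ ≤ 1) :
    ‖x * y * d - d * (x * y)‖ ≤ ‖x * d - d * x‖ + ‖y * d - d * y‖ := by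
  have h : x * y * d - d * (x * y) = x * (y * d - d * y) + (x * d - d * x) * y := by
    noncomm_ring
  rw [h]
  have h1 := norm_add_le (x * (y * d - d * y)) ((x * d - d * x) * y)
  have h2 := norm_mul_le x (y * d - d * y)
  have h3 := norm_mul_le (x * d - d * x) y
  nlinarith [norm_nonneg (y * d - d * y), norm_nonneg (x * d - d * x)]

lemma conj_norm {A : Type*} [CStarAlgebra A] {v : A} (hv : v ∈ unitary A) (x : A) :
    ‖v * x * star v‖ = ‖x‖ := by
  rw [CStarRing.norm_mul_mem_unitary _ (Unitary.star_mem hv), CStarRing.norm_mem_unitary_mul _ hv]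

/-- The one-step construction of an almost commuting partial isometry. -/
lemma finite_step {A : Type*} [CStarAlgebra A] (β : A → A) (hβ : ApproxInner β)
    (p q : A) (hp : IsProjection p) (hq : IsProjection q) (F : Finset A) (M ε : ℝ)
    (hM : ∀ d ∈ F, ‖d‖ ≤ M) (hε0 : 0 < ε) (hε : 3 * ε ≤ 1 / 16)
    (v : A) (hv : v ∈ unitary A) (hvF : ∀ d ∈ F, ‖β d - star v * d * v‖ < ε)
    (hvq : ‖q * v - v * q‖ < ε) (hpq : ‖β p - q‖ < ε)
    (hpF : ∀ d ∈ F, ‖p * d - d * p‖ < ε) :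
    ∃ w : A, star w * w = p ∧ w * star w = q ∧
      ∀ d ∈ F, ‖w * d - d * w‖ ≤ (96 * M + 3) * ε := by
  classical
  obtain ⟨v', hv', hv'F⟩ := hβ (insert p F) ε hε0
  have hvv : v * star v = 1 := (Unitary.mem_iff.1 hv).2
  have hvv' : v' * star v' = 1 := (Unitary.mem_iff.1 hv').2
  have hpp : p * p = p := hp.2
  have hps : star p = p := hp.1
  obtain ⟨y, hy⟩ : ∃ y, y = v * star v' := ⟨_, rfl⟩
  have hyu : y ∈ unitary A := hy ▸ mul_mem hv (Unitary.star_mem hv')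
  have hys : star y = v' * star v := by rw [hy]; simp
  have hy1 : star y * y = 1 := (Unitary.mem_iff.1 hyu).1
  have hyd : ∀ d ∈ F, ‖y * d - d * y‖ ≤ 2 * ε := by
    intro d hd
    have h1 : y * d * star y - d =
        v * (β d - star v * d * v) * star v - v * (β d - star v' * d * v') * star v := by
      have : v * (star v * d * v) * star v = d := by
        calc v * (star v * d * v) * star v = (v * star v) * d * (v * star v) := by
              simp only [mul_assoc]
          _ = d := by simp [hvv]
      rw [mul_sub, sub_mul, this, mul_sub, sub_mul, hys, hy]
      simp only [mul_assoc]
      abel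
    have h2 : y * d - d * y = (y * d * star y - d) * y := by
      rw [sub_mul, mul_assoc _ (star y), hy1, mul_one]
    rw [h2, CStarRing.norm_mul_mem_unitary _ hyu, h1]
    have h3 := norm_sub_le (v * (β d - star v * d * v) * star v)
      (v * (β d - star v' * d * v') * star v)
    rw [conj_norm hv, conj_norm hv] at h3
    have h4 := hvF d hd
    have h5 := hv'F d (Finset.mem_insert_of_mem hd)
    linarith
  have hclose : ‖y * p * star y - q‖ ≤ 3 * ε := by
    have h1 : y * p * star y - q = -(v * (β p - star v' * p * v') * star v) +
        v * (β p - q) * star v + (-((q * v - v * q) * star v)) := by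
      have : q * v * star v = q := by rw [mul_assoc, hvv, mul_one]
      rw [hys, hy]
      simp only [mul_sub, sub_mul, this]
      simp only [mul_assoc]
      abel
    rw [h1]
    have h3 := norm_add₃_le (a := -(v * (β p - star v' * p * v') * star v))
      (b := v * (β p - q) * star v) (c := -((q * v - v * q) * star v))
    rw [norm_neg, norm_neg, conj_norm hv, conj_norm hv,
      CStarRing.norm_mul_mem_unitary _ (Unitary.star_mem hv)] at h3
    have h5 := hv'F p (Finset.mem_insert_self _ _)
    linarith
  have hproj : IsProjection (y * p * star y) := by
    constructor
    · show star _ = _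
      simp [hps, mul_assoc]
    · show (y * p * star y) * (y * p * star y) = _
      calc (y * p * star y) * (y * p * star y) = y * p * (star y * y) * p * star y := by
            simp only [mul_assoc]
        _ = y * (p * p) * star y := by rw [hy1]; simp only [mul_one, mul_assoc]
        _ = _ := by rw [hpp]
  obtain ⟨u, hu, huq, hu1⟩ := close_proj _ q hproj hq (hclose.trans hε)
  have huu : star u * u = 1 := (Unitary.mem_iff.1 hu).1
  refine ⟨u * y * p, ?_, ?_, ?_⟩
  · calc star (u * y * p) * (u * y * p) = p * (star y * (star u * u) * y) * p := by
          simp [hps, mul_assoc]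
      _ = p := by rw [huu, mul_one, hy1, mul_one, hpp]
  · calc u * y * p * star (u * y * p) = u * (y * (p * p) * star y) * star u := by
          simp [hps, mul_assoc]
      _ = q := by rw [hpp, huq]
  · intro d hd
    have h1 := comm_mul_le (x := u * y) (y := p) (d := d)
      (norm_le_of_unitary (mul_mem hu hyu)) (proj_norm hp)
    have h2 := comm_mul_le (x := u) (y := y) (d := d)
      (norm_le_of_unitary hu) (norm_le_of_unitary hyu)
    have h3 : ‖u * d - d * u‖ ≤ 96 * M * ε := by
      have h4 : u * d - d * u = (u - 1) * d - d * (u - 1) := by noncomm_ring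
      rw [h4]
      have h5 := norm_sub_le ((u - 1) * d) (d * (u - 1))
      have h6 := norm_mul_le (u - 1) d
      have h7 := norm_mul_le d (u - 1)
      have h8 := hM d hd
      have h9 : ‖u - 1‖ ≤ 48 * ε := by linarith
      have h10 : ‖u - 1‖ * ‖d‖ ≤ 48 * ε * M :=
        mul_le_mul h9 h8 (norm_nonneg _) (by positivity)
      rw [mul_comm ‖d‖] at h7
      linarith
    have h4 := hyd d hd
    have h5 := hpF d hd
    linarith

/-- Central Murray–von Neumann equivalence of sequences. -/
def CR {A : Type*} [CStarAlgebra A] (p q : ℕ → A) : Prop :=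
  ∃ w : ℕ → A, IsCentralSeq w ∧ ∀ n, star (w n) * w n = p n ∧ w n * star (w n) = q n

lemma step {A : Type*} [CStarAlgebra A] [TopologicalSpace.SeparableSpace A]
    (β : A → A) (hβ : ApproxInner β) (p q : ℕ → A)
    (hp : ∀ n, IsProjection (p n)) (hq : ∀ n, IsProjection (q n))
    (hpc : IsCentralSeq p) (hqc : IsCentralSeq q)
    (hβpq : Tendsto (fun n => ‖β (p n) - q n‖) atTop (nhds 0))
    (heq : ∀ n, MvNEquiv (p n) (q n)) : CR p q := by
  classical
  set d := TopologicalSpace.denseSeq A with hd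
  let P : ℕ → ℕ → A → Prop := fun n k w => star w * w = p n ∧ w * star w = q n ∧
    ∀ i < k, ‖w * d i - d i * w‖ ≤ 1 / ((k : ℝ) + 1)
  have hev : ∀ k, ∀ᶠ n in atTop, ∃ w, P n k w := by
    intro k
    obtain ⟨M, hM0, hM⟩ : ∃ M : ℝ, 0 ≤ M ∧ ∀ x ∈ (Finset.range k).image d, ‖x‖ ≤ M := by
      refine ⟨∑ i ∈ Finset.range k, ‖d i‖, by positivity, ?_⟩
      intro x hx
      obtain ⟨i, hi, rfl⟩ := Finset.mem_image.1 hx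
      exact Finset.single_le_sum (f := fun i => ‖d i‖) (fun _ _ => norm_nonneg _) hi
    obtain ⟨ε, hε0, hε1, hε2⟩ : ∃ ε : ℝ, 0 < ε ∧ 3 * ε ≤ 1 / 16 ∧
        (96 * M + 3) * ε ≤ 1 / ((k : ℝ) + 1) := by
      refine ⟨min (1 / 48) (1 / ((k : ℝ) + 1) / (96 * M + 3)), by positivity, ?_, ?_⟩
      · have := min_le_left (1 / 48 : ℝ) (1 / ((k : ℝ) + 1) / (96 * M + 3))
        linarith
      · have := min_le_right (1 / 48 : ℝ) (1 / ((k : ℝ) + 1) / (96 * M + 3))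
        rw [le_div_iff₀ (by positivity)] at this
        linarith
    obtain ⟨v, hv, hvF⟩ := hβ ((Finset.range k).image d) ε hε0
    have h1 := (hqc v).eventually (gt_mem_nhds hε0)
    have h2 := hβpq.eventually (gt_mem_nhds hε0)
    have h3 : ∀ᶠ n in atTop, ∀ x ∈ (Finset.range k).image d, ‖p n * x - x * p n‖ < ε := by
      rw [Filter.eventually_all_finset]
      intro x _
      exact (hpc x).eventually (gt_mem_nhds hε0)
    filter_upwards [h1, h2, h3] with n hn1 hn2 hn3
    obtain ⟨w, hw1, hw2, hw3⟩ := finite_step β hβ (p n) (q n) (hp n) (hq n) _ M ε hM hε0 hε1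
      v hv hvF hn1 hn2 hn3
    refine ⟨w, hw1, hw2, fun i hi => (hw3 (d i) ?_).trans hε2⟩
    exact Finset.mem_image_of_mem _ (Finset.mem_range.2 hi)
  have hzero : ∀ n, ∃ w, P n 0 w := by
    intro n
    obtain ⟨w, h1, h2⟩ := heq n
    exact ⟨w, h1, h2, by simp⟩
  have hsel : ∀ n, ∃ w, P n (Nat.findGreatest (fun k => ∃ w, P n k w) n) w := fun n =>
    Nat.findGreatest_spec (P := fun k => ∃ w, P n k w) (Nat.zero_le n) (hzero n)
  choose w hw using hsel
  have hwn : ∀ n, ‖w n‖ ≤ 1 := fun n => norm_le_of_proj (by rw [(hw n).1]; exact hp n)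
  refine ⟨w, ?_, fun n => ⟨(hw n).1, (hw n).2.1⟩⟩
  intro a
  rw [Metric.tendsto_nhds]
  intro ε hε
  obtain ⟨i, hi⟩ : ∃ i, dist a (d i) < ε / 4 :=
    (TopologicalSpace.denseRange_denseSeq A).exists_dist_lt a (by positivity)
  obtain ⟨K, hK⟩ := exists_nat_one_div_lt (show 0 < ε / 4 by positivity)
  filter_upwards [hev (max K (i + 1)), eventually_ge_atTop (max K (i + 1))] with n hn hnK
  have hle := Nat.le_findGreatest (P := fun k => ∃ w, P n k w) hnK hn
  have h1 := (hw n).2.2 i (by omega)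
  have h2 : 1 / ((Nat.findGreatest (fun k => ∃ w, P n k w) n : ℕ) + 1 : ℝ) ≤ 1 / ((K : ℝ) + 1) := by
    apply one_div_le_one_div_of_le (by positivity)
    have : K ≤ Nat.findGreatest (fun k => ∃ w, P n k w) n := le_trans (le_max_left _ _) hle
    have : (K : ℝ) ≤ (Nat.findGreatest (fun k => ∃ w, P n k w) n : ℕ) := by exact_mod_cast this
    linarith
  rw [dist_eq_norm] at hi
  have h3 : w n * a - a * w n =
      w n * (a - d i) + (w n * d i - d i * w n) + (-((a - d i) * w n)) := by noncomm_ring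
  have h4 := norm_add₃_le (a := w n * (a - d i)) (b := w n * d i - d i * w n)
    (c := -((a - d i) * w n))
  rw [norm_neg, ← h3] at h4
  have h5 := norm_mul_le (w n) (a - d i)
  have h6 := norm_mul_le (a - d i) (w n)
  have h7 := hwn n
  rw [dist_zero_right, norm_norm]
  nlinarith [norm_nonneg (a - d i)]

lemma CR.symm {A : Type*} [CStarAlgebra A] {p q : ℕ → A} (h : CR p q) : CR q p := by
  obtain ⟨w, hw, hpq⟩ := h
  refine ⟨fun n => star (w n), fun a => ?_, fun n => ⟨by simpa using (hpq n).2,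
    by simpa using (hpq n).1⟩⟩
  refine (hw (star a)).congr fun n => ?_
  rw [← norm_star, ← norm_neg]
  simp

lemma pi_eq {A : Type*} [CStarAlgebra A] {w p : A} (hp : IsProjection p)
    (h : star w * w = p) : w * p = w := by
  have hpp : p * p = p := hp.2
  have hps : star p = p := hp.1
  have : star (w * p - w) * (w * p - w) = 0 := by
    have h2 : star (w * p - w) * (w * p - w) = p * (star w * w) * p - p * (star w * w)
        - (star w * w) * p + star w * w := by
      simp only [star_sub, star_mul, hps]
      noncomm_ring
    rw [h2, h]; simp [hpp]
  rw [CStarRing.star_mul_self_eq_zero_iff] at this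
  exact sub_eq_zero.1 this

lemma CR.trans {A : Type*} [CStarAlgebra A] {p q s : ℕ → A} (hp : ∀ n, IsProjection (p n))
    (hq : ∀ n, IsProjection (q n)) (h : CR p q) (h' : CR q s) : CR p s := by
  obtain ⟨w, hw, hpq⟩ := h
  obtain ⟨x, hx, hqs⟩ := h'
  refine ⟨fun n => x n * w n, fun a => ?_, fun n => ⟨?_, ?_⟩⟩
  · have := (hx a).add (hw a)
    rw [add_zero] at this
    refine squeeze_zero (fun n => norm_nonneg _) (fun n => ?_) this
    exact comm_mul_le (norm_le_of_proj (by rw [(hqs n).1]; exact hq n))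
      (norm_le_of_proj (by rw [(hpq n).1]; exact hp n))
  · have h1 := pi_eq (hp n) (hpq n).1
    calc star (x n * w n) * (x n * w n) = star (w n) * (star (x n) * x n) * w n := by
          simp [mul_assoc]
      _ = (star (w n) * w n) * (star (w n) * w n) := by
          rw [(hqs n).1, ← (hpq n).2]; simp only [mul_assoc]
      _ = p n := by rw [(hpq n).1]; exact (hp n).2
  · have h1 := pi_eq (hq n) (hqs n).1
    calc x n * w n * star (x n * w n) = x n * (w n * star (w n)) * star (x n) := by
          simp [mul_assoc]
      _ = s n := by rw [(hpq n).2, h1, (hqs n).2]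

lemma CR.refl {A : Type*} [CStarAlgebra A] {p : ℕ → A} (hp : ∀ n, IsProjection (p n))
    (hc : IsCentralSeq p) : CR p p := by
  refine ⟨p, hc, fun n => ?_⟩
  have h1 : star (p n) = p n := (hp n).1
  have h2 : p n * p n = p n := (hp n).2
  simp [h1, h2]

lemma CR.sum {A : Type*} [CStarAlgebra A] {r : ℕ} {f g : ℕ → ℕ → A}
    (hf : ∀ j < r, ∀ n, IsProjection (f j n)) (hg : ∀ j < r, ∀ n, IsProjection (g j n))
    (hfo : ∀ n, ∀ j < r, ∀ k < r, j ≠ k → f j n * f k n = 0)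
    (hgo : ∀ n, ∀ j < r, ∀ k < r, j ≠ k → g j n * g k n = 0)
    (h : ∀ j < r, CR (f j) (g j)) :
    CR (fun n => ∑ j ∈ Finset.range r, f j n) (fun n => ∑ j ∈ Finset.range r, g j n) := by
  classical
  have h' : ∀ j, ∃ w : ℕ → A, j < r → (IsCentralSeq w ∧
      ∀ n, star (w n) * w n = f j n ∧ w n * star (w n) = g j n) := by
    intro j
    by_cases hj : j < r
    · obtain ⟨w, hw⟩ := h j hj
      exact ⟨w, fun _ => hw⟩
    · exact ⟨0, fun hj' => absurd hj' hj⟩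
  choose w hw using h'
  have hwf : ∀ j < r, ∀ n, w j n * f j n = w j n := fun j hj n =>
    pi_eq (hf j hj n) ((hw j hj).2 n).1
  have hwg : ∀ j < r, ∀ n, star (w j n) * g j n = star (w j n) := fun j hj n =>
    pi_eq (hg j hj n) (by simpa using ((hw j hj).2 n).2)
  have hwf' : ∀ j < r, ∀ n, f j n * star (w j n) = star (w j n) := fun j hj n => by
    have := congrArg star (hwf j hj n)
    have h1 : star (f j n) = f j n := (hf j hj n).1
    simpa [h1] using this
  have hwg' : ∀ j < r, ∀ n, g j n * w j n = w j n := fun j hj n => by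
    have := congrArg star (hwg j hj n)
    have h1 : star (g j n) = g j n := (hg j hj n).1
    simpa [h1] using this
  refine ⟨fun n => ∑ j ∈ Finset.range r, w j n, fun a => ?_, fun n => ⟨?_, ?_⟩⟩
  · have : Tendsto (fun n => ∑ j ∈ Finset.range r, ‖w j n * a - a * w j n‖) atTop (nhds 0) := by
      rw [show (0 : ℝ) = ∑ j ∈ Finset.range r, 0 by simp]
      exact tendsto_finsetSum _ fun j hj => (hw j (Finset.mem_range.1 hj)).1 a
    refine squeeze_zero (fun n => norm_nonneg _) (fun n => ?_) this
    rw [Finset.sum_mul, Finset.mul_sum, ← Finset.sum_sub_distrib]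
    exact norm_sum_le _ _
  · rw [star_sum, Finset.sum_mul_sum]
    refine Finset.sum_congr rfl fun j hj => ?_
    rw [Finset.mem_range] at hj
    rw [Finset.sum_eq_single j, ((hw j hj).2 n).1]
    · intro k hk hkj
      rw [Finset.mem_range] at hk
      rw [← hwg j hj n, ← hwg' k hk n, mul_assoc, ← mul_assoc (g j n), hgo n j hj k hk hkj.symm]
      simp
    · intro hj'; exact absurd (Finset.mem_range.2 hj) hj'
  · rw [star_sum, Finset.sum_mul_sum]
    refine Finset.sum_congr rfl fun j hj => ?_
    rw [Finset.mem_range] at hj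
    rw [Finset.sum_eq_single j, ((hw j hj).2 n).2]
    · intro k hk hkj
      rw [Finset.mem_range] at hk
      rw [← hwf j hj n, ← hwf' k hk n, mul_assoc, ← mul_assoc (f j n), hfo n j hj k hk hkj.symm]
      simp
    · intro hj'; exact absurd (Finset.mem_range.2 hj) hj'

end Stmt1Aux

/-- (Lemma 3.2 of the paper.) -/
theorem stmt1 {A : Type*} [CStarAlgebra A] [TopologicalSpace.SeparableSpace A]
    (α : A ≃⋆ₐ[ℂ] A) (r : ℕ) (hr : 1 ≤ r) (hai : ApproxInner ((⇑α)^[r]))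
    (m m₀ : ℕ) (hm₀m : m ≤ m₀) (hm₀r : r ∣ m₀)
    (hm₀min : ∀ k : ℕ, m ≤ k → r ∣ k → m₀ ≤ k)
    (l : ℕ) (hl : l = m + (r - 1) * (m₀ + 1))
    (e : ℕ → ℕ → A) (δ : ℕ → ℝ)
    (hδ : Filter.Tendsto δ Filter.atTop (nhds 0))
    (hproj : ∀ i ≤ l, ∀ n, IsProjection (e i n))
    (hclose : ∀ n : ℕ, ∀ i < l, ‖α (e i n) - e (i + 1) n‖ < δ n)
    (horth : ∀ n : ℕ, ∀ i ≤ l, ∀ j ≤ l, i ≠ j → e i n * e j n = 0)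
    (hequiv : ∀ n : ℕ, ∀ i ≤ l, ∀ j ≤ l, MvNEquiv (e i n) (e j n))
    (hcentral : ∀ i ≤ l, IsCentralSeq (fun n => e i n)) :
    (∀ i < m, ∃ w : ℕ → A, IsCentralSeq w ∧
      ∀ n : ℕ,
        star (w n) * w n = (∑ j ∈ Finset.range r, e (i + j * (m₀ + 1)) n) ∧
        w n * star (w n) = (∑ j ∈ Finset.range r, e ((i + 1) + j * (m₀ + 1)) n)) ∧
    (∀ i < m, Filter.Tendsto
      (fun n => ‖α (∑ j ∈ Finset.range r, e (i + j * (m₀ + 1)) n) -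
        (∑ j ∈ Finset.range r, e ((i + 1) + j * (m₀ + 1)) n)‖)
      Filter.atTop (nhds 0)) := by
  classical
  have hlim : ∀ i < l, Tendsto (fun n => ‖α (e i n) - e (i + 1) n‖) atTop (nhds 0) :=
    fun i hi => squeeze_zero (fun n => norm_nonneg _) (fun n => (hclose n i hi).le) hδ
  have hidx : ∀ j < r, j * (m₀ + 1) ≤ (r - 1) * (m₀ + 1) := fun j hj =>
    Nat.mul_le_mul_right _ (by omega)
  refine ⟨?_, ?_⟩
  · skip
    have hiter : ∀ a k, a + k ≤ l →
        Tendsto (fun n => ‖(⇑α)^[k] (e a n) - e (a + k) n‖) atTop (nhds 0) := by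
      intro a k
      induction k with
      | zero => intro _; simp
      | succ k ih =>
        intro hk
        have h1 := (ih (by omega)).add (hlim (a + k) (by omega))
        rw [add_zero] at h1
        refine squeeze_zero (fun n => norm_nonneg _) (fun n => ?_) h1
        rw [Function.iterate_succ_apply']
        have h2 : ‖α ((⇑α)^[k] (e a n)) - α (e (a + k) n)‖ =
            ‖(⇑α)^[k] (e a n) - e (a + k) n‖ := by
          rw [← dist_eq_norm, ← dist_eq_norm]
          exact (StarAlgEquiv.isometry α).dist_eq _ _
        rw [← h2]
        exact norm_sub_le_norm_sub_add_norm_sub _ _ _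
    have hchain : ∀ a k, a + r * k ≤ l → Stmt1Aux.CR (e a) (e (a + r * k)) := by
      intro a k
      induction k with
      | zero =>
        intro h
        exact Stmt1Aux.CR.refl (hproj a (by omega)) (hcentral a (by omega))
      | succ k ih =>
        intro h
        have h0 : a + r * (k + 1) = a + r * k + r := by ring
        rw [h0] at h ⊢
        refine (ih (by omega)).trans (hproj _ (by omega)) (hproj _ (by omega)) ?_
        exact Stmt1Aux.step _ hai _ _ (hproj _ (by omega)) (hproj _ h)
          (hcentral _ (by omega)) (hcentral _ h) (hiter _ _ h)
          (fun n => hequiv n _ (by omega) _ h)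
    intro i hi
    obtain ⟨s, rfl⟩ : ∃ s, r = s + 1 := ⟨r - 1, by omega⟩
    obtain ⟨t, ht⟩ := hm₀r
    have hidx' : ∀ j ≤ s, i + 1 + j * (m₀ + 1) ≤ l := by
      intro j hj
      have := hidx j (by omega)
      omega
    let σ : ℕ → ℕ := fun j => if j = 0 then s else j - 1
    have hσ : ∀ j < s + 1, σ j ≤ s := by
      intro j hj; simp only [σ]; split_ifs <;> omega
    have hσi : ∀ j < s + 1, ∀ k < s + 1, j ≠ k → σ j ≠ σ k := by
      intro j hj k hk hjk; simp only [σ]; split_ifs <;> omega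
    have hne : ∀ (c j k : ℕ), j ≠ k → c + j * (m₀ + 1) ≠ c + k * (m₀ + 1) := by
      intro c j k hjk h
      exact hjk (Nat.eq_of_mul_eq_mul_right (Nat.succ_pos m₀) (Nat.add_left_cancel h))
    have hmain := Stmt1Aux.CR.sum (r := s + 1) (f := fun j => e (i + j * (m₀ + 1)))
      (g := fun j => e (i + 1 + σ j * (m₀ + 1)))
      (fun j hj => hproj _ (by have := hidx' j (by omega); omega))
      (fun j hj => hproj _ (hidx' _ (hσ j hj)))
      (fun n j hj k hk hjk => horth n _ (by have := hidx' j (by omega); omega)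
        _ (by have := hidx' k (by omega); omega) (hne _ _ _ hjk))
      (fun n j hj k hk hjk => horth n _ (hidx' _ (hσ j hj)) _ (hidx' _ (hσ k hk))
        (hne _ _ _ (hσi j hj k hk hjk)))
      (by
        intro j hj
        rcases j with _ | j
        · have h1 : i + 1 + σ 0 * (m₀ + 1) = i + 0 * (m₀ + 1) + (s + 1) * (1 + s * t) := by
            simp only [σ, if_true]
            rw [ht]; ring
          have h2 := hchain (i + 0 * (m₀ + 1)) (1 + s * t)
            (by rw [← h1]; exact hidx' _ (hσ 0 hj))
          rw [← h1] at h2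
          exact h2
        · have h1 : i + (j + 1) * (m₀ + 1) = i + 1 + σ (j + 1) * (m₀ + 1) + (s + 1) * t := by
            simp only [σ, Nat.succ_ne_zero, if_false, Nat.add_sub_cancel]
            rw [← ht]; ring
          have h2 := hchain (i + 1 + σ (j + 1) * (m₀ + 1)) t
            (by rw [← h1]; have := hidx' (j + 1) (by omega); omega)
          rw [← h1] at h2
          exact h2.symm)
    obtain ⟨w, hw, hw'⟩ := hmain
    refine ⟨w, hw, fun n => ⟨(hw' n).1, (hw' n).2.trans ?_⟩⟩
    beta_reduce
    rw [Finset.sum_range_succ', Finset.sum_range_succ (fun j => e (i + 1 + j * (m₀ + 1)) n)]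
    simp [σ]
  · intro i hi
    have : Tendsto (fun n => ∑ j ∈ Finset.range r,
        ‖α (e (i + j * (m₀ + 1)) n) - e (i + j * (m₀ + 1) + 1) n‖) atTop (nhds 0) := by
      rw [show (0 : ℝ) = ∑ j ∈ Finset.range r, 0 by simp]
      refine tendsto_finsetSum _ fun j hj => hlim _ ?_
      have := hidx j (Finset.mem_range.1 hj)
      omega
    refine squeeze_zero (fun n => norm_nonneg _) (fun n => ?_) this
    rw [map_sum, ← Finset.sum_sub_distrib]
    refine (norm_sum_le _ _).trans (le_of_eq (Finset.sum_congr rfl fun j _ => ?_))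
    rw [Nat.add_right_comm]
end

section
/- Let H = ℓ²(ℤ) with standard orthonormal basis (δ_i)_{i∈ℤ}, let S be the bilateral shift unitary on H determined by S δ_i = δ_{i+1}, let σ(x) = S x S* for bounded operators x on H, and for N ∈ ℕ let P_N be the orthogonal projection onto span{δ_0, …, δ_{N−1}}. Then for every η > 0 and every n ∈ ℕ there exist N ∈ ℕ and mutually orthogonal finite-rank orthogonal projections e_0, …, e_{n−1} on H such that e_0 + … + e_{n−1} ≤ P_N (equivalently P_N e_i = e_i = e_i P_N for all i), ‖σ(e_i) − e_{i+1}‖ < η for i = 0, …, n−1 where e_n := e_0, and n·rank(e_0)/N > 1 − η, where rank(e_0) is the dimension of the range of e_0. -/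
noncomputable section

/-- The Hilbert space `ℓ²(ℤ)`. -/
abbrev H : Type := lp (fun _ : ℤ => ℂ) 2

/-- The standard orthonormal basis vector `δ_i` of `ℓ²(ℤ)`. -/
def delta (i : ℤ) : H := lp.single 2 i 1

/-- An orthogonal projection among bounded operators: a self-adjoint idempotent. -/
def IsOrthoProjection (T : H →L[ℂ] H) : Prop :=
  IsSelfAdjoint T ∧ IsIdempotentElem T

open InnerProductSpace in
/-- The sum of the rank-one operators attached to a finite family. -/
def frameOp {E : Type*} [NormedAddCommGroup E] [InnerProductSpace ℂ E] {m : ℕ}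
    (a : Fin m → E) : E →L[ℂ] E := ∑ j, rankOne ℂ (a j) (a j)

lemma frameOp_apply {E : Type*} [NormedAddCommGroup E] [InnerProductSpace ℂ E] {m : ℕ}
    (a : Fin m → E) (x : E) : frameOp a x = ∑ j, (inner ℂ (a j) x : ℂ) • a j := by
  simp [frameOp]

lemma frameOp_sub_le {E : Type*} [NormedAddCommGroup E] [InnerProductSpace ℂ E] {m : ℕ}
    (a b : Fin m → E) (ha : Orthonormal ℂ a) (hb : Orthonormal ℂ b) (c : ℝ) (hc : 0 ≤ c)
    (h : ∑ j, ‖a j - b j‖ ^ 2 ≤ c ^ 2) : ‖frameOp a - frameOp b‖ ≤ 2 * c := by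
  refine ContinuousLinearMap.opNorm_le_bound _ (by positivity) fun x => ?_
  have e : (frameOp a - frameOp b) x
      = ∑ j, (inner ℂ (a j - b j) x : ℂ) • a j + ∑ j, (inner ℂ (b j) x : ℂ) • (a j - b j) := by
    rw [ContinuousLinearMap.sub_apply, frameOp_apply, frameOp_apply, ← Finset.sum_add_distrib,
      ← Finset.sum_sub_distrib]
    refine Finset.sum_congr rfl fun j _ => ?_
    rw [inner_sub_left, sub_smul, smul_sub]; abel
  have h1 : ‖∑ j, (inner ℂ (a j - b j) x : ℂ) • a j‖ ≤ c * ‖x‖ := by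
    refine le_of_sq_le_sq ?_ (by positivity)
    have : ‖∑ j, (inner ℂ (a j - b j) x : ℂ) • a j‖ ^ 2 = ∑ j, ‖(inner ℂ (a j - b j) x : ℂ)‖ ^ 2 := by
      have := ha.inner_sum (fun j => (inner ℂ (a j - b j) x : ℂ))
        (fun j => (inner ℂ (a j - b j) x : ℂ)) Finset.univ
      rw [inner_self_eq_norm_sq_to_K] at this
      simp only [RCLike.conj_mul] at this
      exact_mod_cast this
    rw [this, mul_pow]
    calc _ ≤ ∑ j, ‖a j - b j‖ ^ 2 * ‖x‖ ^ 2 := by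
          refine Finset.sum_le_sum fun j _ => ?_
          rw [← mul_pow]
          gcongr
          exact norm_inner_le_norm _ _
      _ ≤ _ := by rw [← Finset.sum_mul]; gcongr
  have h2 : ‖∑ j, (inner ℂ (b j) x : ℂ) • (a j - b j)‖ ≤ c * ‖x‖ := by
    refine (norm_sum_le _ _).trans ?_
    simp only [norm_smul]
    refine le_of_sq_le_sq ?_ (by positivity)
    refine (Finset.sum_mul_sq_le_sq_mul_sq _ _ _).trans ?_
    rw [mul_comm, mul_pow]
    gcongr
    exact hb.sum_inner_products_le x
  rw [e]
  refine (norm_add_le _ _).trans ?_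
  linarith

lemma frameOp_selfAdjoint {E : Type*} [NormedAddCommGroup E] [InnerProductSpace ℂ E]
    [CompleteSpace E] {m : ℕ}
    (a : Fin m → E) : IsSelfAdjoint (frameOp a) := by
  rw [IsSelfAdjoint, frameOp, star_sum]
  simp [ContinuousLinearMap.star_eq_adjoint]

lemma frameOp_self {E : Type*} [NormedAddCommGroup E] [InnerProductSpace ℂ E] {m : ℕ}
    (a : Fin m → E) (ha : Orthonormal ℂ a) (j : Fin m) : frameOp a (a j) = a j := by
  rw [frameOp_apply]
  simp [orthonormal_iff_ite.1 ha]

lemma frameOp_idem {E : Type*} [NormedAddCommGroup E] [InnerProductSpace ℂ E] {m : ℕ}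
    (a : Fin m → E) (ha : Orthonormal ℂ a) : IsIdempotentElem (frameOp a) := by
  ext x
  rw [ContinuousLinearMap.mul_apply]
  conv_lhs => rw [frameOp_apply a x]
  simp [frameOp_self a ha, frameOp_apply a x]

lemma frameOp_mul_zero {E : Type*} [NormedAddCommGroup E] [InnerProductSpace ℂ E] {m : ℕ}
    (a b : Fin m → E) (h : ∀ i j, (inner ℂ (a i) (b j) : ℂ) = 0) :
    frameOp a * frameOp b = 0 := by
  ext x
  rw [ContinuousLinearMap.mul_apply, frameOp_apply b x]
  simp [frameOp_apply, h]

lemma mul_frameOp {E : Type*} [NormedAddCommGroup E] [InnerProductSpace ℂ E] {m : ℕ}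
    (a : Fin m → E) (P : E →L[ℂ] E) (h : ∀ i, P (a i) = a i) :
    P * frameOp a = frameOp a := by
  ext x
  rw [ContinuousLinearMap.mul_apply, frameOp_apply]
  simp [h]

lemma conj_frameOp {E : Type*} [NormedAddCommGroup E] [InnerProductSpace ℂ E]
    [CompleteSpace E] {m : ℕ}
    (a : Fin m → E) (S : E →L[ℂ] E) :
    S * frameOp a * star S = frameOp (fun j => S (a j)) := by
  ext x
  rw [ContinuousLinearMap.mul_apply, ContinuousLinearMap.mul_apply, frameOp_apply, frameOp_apply]
  simp [ContinuousLinearMap.star_eq_adjoint, ContinuousLinearMap.adjoint_inner_right]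

lemma range_frameOp {E : Type*} [NormedAddCommGroup E] [InnerProductSpace ℂ E] {m : ℕ}
    (a : Fin m → E) (ha : Orthonormal ℂ a) :
    LinearMap.range (frameOp a : E →ₗ[ℂ] E) = Submodule.span ℂ (Set.range a) := by
  apply le_antisymm
  · rintro _ ⟨x, rfl⟩
    rw [ContinuousLinearMap.coe_coe, frameOp_apply]
    exact Submodule.sum_mem _ fun j _ => Submodule.smul_mem _ _ (Submodule.subset_span ⟨j, rfl⟩)
  · rw [Submodule.span_le]
    rintro _ ⟨j, rfl⟩
    exact ⟨a j, frameOp_self a ha j⟩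

lemma inner_delta (i j : ℤ) : (inner ℂ (delta i) (delta j) : ℂ) = if i = j then 1 else 0 := by
  rw [delta, lp.inner_single_left, delta]
  by_cases h : i = j
  · subst h; simp
  · simp [h, lp.single_apply]

/-- Berg's rotation angle. -/
def ang (K k : ℕ) : ℝ := Real.pi / 2 * min ((k : ℝ) / K) 1

/-- Berg's interpolating vectors. -/
def bergVec (K L k : ℕ) : H :=
  (Real.cos (ang K k) : ℂ) • delta ((L : ℤ) + k) + (Real.sin (ang K k) : ℂ) • delta k

lemma ang_ge (K k : ℕ) (hK : 0 < K) (h : K ≤ k) : ang K k = Real.pi / 2 := by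
  have : (1 : ℝ) ≤ (k : ℝ) / K := by
    rw [le_div_iff₀ (by positivity)]; simpa using h
  rw [ang, min_eq_right this, mul_one]

lemma bergVec_ge (K L k : ℕ) (hK : 0 < K) (h : K ≤ k) : bergVec K L k = delta k := by
  rw [bergVec, ang_ge K k hK h]; simp

lemma bergVec_zero (K L : ℕ) : bergVec K L 0 = delta L := by
  simp [bergVec, ang]

lemma bergVec_cycle (K L : ℕ) (hK : 0 < K) (h : K ≤ L) : bergVec K L L = bergVec K L 0 := by
  rw [bergVec_zero, bergVec_ge K L L hK h]

lemma inner_bergVec_ne (K L k l : ℕ) (hkl : k ≠ l) (h1 : k < l + L) (h2 : l < k + L) :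
    (inner ℂ (bergVec K L k) (bergVec K L l) : ℂ) = 0 := by
  have e1 : ¬ ((L : ℤ) + k = L + l) := by omega
  have e2 : ¬ ((L : ℤ) + k = l) := by omega
  have e3 : ¬ ((k : ℤ) = L + l) := by omega
  have e4 : ¬ ((k : ℤ) = l) := by omega
  simp only [bergVec, inner_add_left, inner_add_right, inner_smul_left, inner_smul_right,
    inner_delta, if_neg e1, if_neg e2, if_neg e3, if_neg e4]
  simp

lemma norm_sq_comb (x y : ℝ) (i j : ℤ) (hij : i ≠ j) :
    ‖(x : ℂ) • delta i + (y : ℂ) • delta j‖ ^ 2 = x ^ 2 + y ^ 2 := by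
  have h : (inner ℂ ((x : ℂ) • delta i + (y : ℂ) • delta j)
      ((x : ℂ) • delta i + (y : ℂ) • delta j) : ℂ) = ((x ^ 2 + y ^ 2 : ℝ) : ℂ) := by
    simp only [inner_add_left, inner_add_right, inner_smul_left, inner_smul_right,
      inner_delta, if_neg hij, if_neg hij.symm, if_true, Complex.conj_ofReal]
    push_cast; ring
  rw [← inner_self_eq_norm_sq (𝕜 := ℂ), h]
  exact Complex.ofReal_re _

lemma norm_bergVec (K L k : ℕ) (hL : 0 < L) : ‖bergVec K L k‖ = 1 := by
  have := norm_sq_comb (Real.cos (ang K k)) (Real.sin (ang K k)) ((L : ℤ) + k) k (by omega)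
  rw [Real.cos_sq_add_sin_sq] at this
  rw [bergVec]
  exact (pow_eq_one_iff_of_nonneg (norm_nonneg _) two_ne_zero).1 this

lemma ang_diff (K k : ℕ) (hK : 0 < K) : |ang K k - ang K (k + 1)| ≤ Real.pi / 2 / K := by
  have hK' : (0 : ℝ) < K := by positivity
  rw [ang, ang, ← mul_sub, abs_mul, abs_of_pos (by positivity), div_eq_mul_one_div (Real.pi / 2) (K : ℝ)]
  refine mul_le_mul_of_nonneg_left ?_ (by positivity)
  refine (abs_min_sub_min_le_max _ _ _ _).trans ?_
  rw [← sub_div]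
  push_cast
  simp [abs_div]

lemma shift_bergVec (S : H →L[ℂ] H) (hS : ∀ i : ℤ, S (delta i) = delta (i + 1)) (K L k : ℕ)
    (hK : 0 < K) (hL : 0 < L) :
    ‖S (bergVec K L k) - bergVec K L (k + 1)‖ ^ 2
      ≤ if k < K then 2 * (Real.pi / 2 / K) ^ 2 else 0 := by
  have e : S (bergVec K L k) - bergVec K L (k + 1)
      = ((Real.cos (ang K k) - Real.cos (ang K (k + 1)) : ℝ) : ℂ) • delta ((L : ℤ) + k + 1)
        + ((Real.sin (ang K k) - Real.sin (ang K (k + 1)) : ℝ) : ℂ) • delta ((k : ℤ) + 1) := by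
    rw [bergVec, bergVec, map_add, map_smul, map_smul, hS, hS]
    push_cast
    rw [sub_smul, sub_smul, ← add_assoc]; abel
  rw [e, norm_sq_comb _ _ _ _ (by omega)]
  split_ifs with h
  · have h1 := Real.lipschitzWith_cos.dist_le_mul (ang K k) (ang K (k + 1))
    have h2 := Real.lipschitzWith_sin.dist_le_mul (ang K k) (ang K (k + 1))
    rw [Real.dist_eq, Real.dist_eq, NNReal.coe_one, one_mul] at h1 h2
    have h3 := ang_diff K k hK
    have h4 := pow_le_pow_left₀ (abs_nonneg _) (h1.trans h3) 2
    have h5 := pow_le_pow_left₀ (abs_nonneg _) (h2.trans h3) 2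
    rw [sq_abs] at h4 h5
    linarith
  · rw [ang_ge K k hK (by omega), ang_ge K (k + 1) hK (by omega)]; simp

lemma orthonormal_berg (K L n m i : ℕ) (hn : 0 < n) (hm : 0 < m) (hL : L = n * m) :
    Orthonormal ℂ (fun j : Fin m => bergVec K L (n * j + i)) := by
  have key : ∀ a b : ℕ, a < b → b < m → n * a < n * b ∧ n * b < n * a + L := by
    intro a b hab hb
    refine ⟨Nat.mul_lt_mul_of_pos_left hab hn, ?_⟩
    have := Nat.mul_lt_mul_of_pos_left hb hn
    omega
  refine ⟨fun j => norm_bergVec _ _ _ (hL ▸ Nat.mul_pos hn hm), fun j l hjl => ?_⟩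
  have hne : (j : ℕ) ≠ l := fun h => hjl (Fin.ext h)
  rcases lt_or_gt_of_ne hne with h | h
  · have := key _ _ h l.2
    exact inner_bergVec_ne _ _ _ _ (by omega) (by omega) (by omega)
  · have := key _ _ h j.2
    exact inner_bergVec_ne _ _ _ _ (by omega) (by omega) (by omega)

lemma frame_wrap (K L n m : ℕ) (hK : 0 < K) (hKL : K ≤ L) (hL : L = n * m) :
    frameOp (fun j : Fin m => bergVec K L (n * j + n)) =
      frameOp (fun j : Fin m => bergVec K L (n * j + 0)) := by
  unfold frameOp
  let f : ℕ → (H →L[ℂ] H) := fun j =>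
    InnerProductSpace.rankOne ℂ (bergVec K L (n * j)) (bergVec K L (n * j))
  have h0 : f m = f 0 := by
    simp only [f, ← hL, mul_zero, bergVec_cycle K L hK hKL]
  have h1 := Finset.sum_range_succ f m
  rw [Finset.sum_range_succ', h0] at h1
  have h2 := add_right_cancel h1
  rw [← Fin.sum_univ_eq_sum_range f, ← Fin.sum_univ_eq_sum_range (fun k => f (k + 1))] at h2
  simpa [f, mul_add] using h2

/-- (Kishimoto's shift lemma, Lemma 3.3 of the paper.) Let `S` be the
bilateral shift on `ℓ²(ℤ)` (`S δ_i = δ_{i+1}`), let `σ x = S x S*`, and for `N ∈ ℕ` let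
`P N` be the orthogonal projection onto `span {δ_0, …, δ_{N-1}}`. For every `η > 0` and
every `n ∈ ℕ` (with `n ≥ 1`, so that `e 0` makes sense) there exist `N` and mutually
orthogonal finite-rank orthogonal projections `e 0, …, e (n-1)` with
`e 0 + ⋯ + e (n-1) ≤ P N` (equivalently `P N * e i = e i = e i * P N`),
`‖σ (e i) - e (i+1)‖ < η` cyclically (in `Fin n`, `i + 1` wraps around, so `e n = e 0`),
and `n * rank (e 0) / N > 1 - η`. -/
theorem stmt2
    (S : H →L[ℂ] H) (hSu : S ∈ unitary (H →L[ℂ] H))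
    (hS : ∀ i : ℤ, S (delta i) = delta (i + 1))
    (P : ℕ → (H →L[ℂ] H))
    (hPproj : ∀ N, IsOrthoProjection (P N))
    (hP : ∀ (N : ℕ) (i : ℤ), P N (delta i) = if 0 ≤ i ∧ i < (N : ℤ) then delta i else 0)
    (η : ℝ) (hη : 0 < η) (n : ℕ) (hn : 0 < n) :
    ∃ (N : ℕ) (e : Fin n → (H →L[ℂ] H)),
      (∀ i, IsOrthoProjection (e i)) ∧
      (∀ i, FiniteDimensional ℂ (LinearMap.range ((e i) : H →ₗ[ℂ] H))) ∧
      (∀ i j, i ≠ j → e i * e j = 0) ∧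
      (∀ i, P N * e i = e i ∧ e i * P N = e i) ∧
      (∀ i : Fin n, ‖S * e i * star S - e ⟨((i : ℕ) + 1) % n, Nat.mod_lt _ hn⟩‖ < η) ∧
      ((n : ℝ) * (Module.finrank ℂ
        (LinearMap.range ((e ⟨0, hn⟩) : H →ₗ[ℂ] H))) / (N : ℝ) > 1 - η) := by
  obtain ⟨K, hK⟩ := exists_nat_gt (2 * Real.pi ^ 2 / η ^ 2)
  have hKpos' : (0 : ℝ) < K := lt_of_le_of_lt (by positivity) hK
  have hKpos : 0 < K := by exact_mod_cast hKpos'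
  obtain ⟨m, hm⟩ := exists_nat_gt (max (K : ℝ) (K / η))
  have hmK : (K : ℝ) < m := lt_of_le_of_lt (le_max_left _ _) hm
  have hmη : (K : ℝ) / η < m := lt_of_le_of_lt (le_max_right _ _) hm
  have hmK' : K < m := by exact_mod_cast hmK
  have hmpos : 0 < m := by omega
  obtain ⟨L, hL⟩ : ∃ L, L = n * m := ⟨_, rfl⟩
  have hmL : m ≤ L := hL ▸ Nat.le_mul_of_pos_left m hn
  have hon := fun i => orthonormal_berg K L n m i hn hmpos hL
  have hlt : ∀ (i : Fin n) (j : Fin m), n * (j : ℕ) + i < L := by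
    intro i j
    have h1 : n * ((j : ℕ) + 1) ≤ n * m := Nat.mul_le_mul_left n j.2
    have h2 := i.2
    rw [mul_add] at h1
    omega
  have hPe : ∀ i : Fin n, P (L + K) * frameOp (fun j : Fin m => bergVec K L (n * j + i))
      = frameOp (fun j : Fin m => bergVec K L (n * j + i)) := by
    intro i
    refine mul_frameOp _ _ fun j => ?_
    have := hlt i j
    rcases lt_or_ge (n * (j : ℕ) + i) K with h | h
    · rw [bergVec, map_add, map_smul, map_smul, hP, hP, if_pos (by omega), if_pos (by omega)]
    · rw [bergVec_ge _ _ _ hKpos h, hP, if_pos (by omega)]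
  refine ⟨L + K, fun i => frameOp (fun j : Fin m => bergVec K L (n * j + i)),
    fun i => ⟨frameOp_selfAdjoint _, frameOp_idem _ (hon i)⟩, fun i => ?_, fun i j hij => ?_,
    fun i => ⟨hPe i, ?_⟩, fun i => ?_, ?_⟩
  · rw [range_frameOp _ (hon i)]
    exact FiniteDimensional.span_of_finite ℂ (Set.finite_range _)
  · refine frameOp_mul_zero _ _ fun a b => inner_bergVec_ne _ _ _ _ ?_ ?_ ?_
    · intro h
      apply hij
      have h' := congrArg (· % n) h
      simp only [Nat.mul_add_mod, Nat.mod_eq_of_lt i.2, Nat.mod_eq_of_lt j.2] at h'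
      exact Fin.ext h'
    · have := hlt i a
      omega
    · have := hlt j b
      omega
  · have h := congrArg star (hPe i)
    rwa [star_mul, (frameOp_selfAdjoint _).star_eq, (hPproj _).1.star_eq] at h
  · have hnext : frameOp (fun j : Fin m => bergVec K L (n * j + (((i : ℕ) + 1) % n)))
        = frameOp (fun j : Fin m => bergVec K L (n * j + (i + 1))) := by
      rcases Nat.lt_or_ge ((i : ℕ) + 1) n with h | h
      · rw [Nat.mod_eq_of_lt h]
      · have h' : (i : ℕ) + 1 = n := by have := i.2; omega
        rw [h', Nat.mod_self]
        exact (frame_wrap K L n m hKpos (by omega) hL).symm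
    show ‖_ - frameOp (fun j : Fin m => bergVec K L (n * j + (((i : ℕ) + 1) % n)))‖ < η
    rw [hnext, conj_frameOp]
    have hSon : Orthonormal ℂ (fun j : Fin m => S (bergVec K L (n * j + i))) := by
      have hin : ∀ x y : H, (inner ℂ (S x) (S y) : ℂ) = inner ℂ x y := by
        intro x y
        rw [← ContinuousLinearMap.adjoint_inner_right, ← ContinuousLinearMap.star_eq_adjoint,
          ← ContinuousLinearMap.mul_apply, (Unitary.mem_iff.1 hSu).1,
          ContinuousLinearMap.one_apply]
      rw [orthonormal_iff_ite]
      intro a b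
      rw [hin]
      exact orthonormal_iff_ite.1 (hon i) a b
    have hsum : ∑ j : Fin m, ‖S (bergVec K L (n * j + i)) - bergVec K L (n * j + (i + 1))‖ ^ 2
        ≤ (Real.sqrt (Real.pi ^ 2 / (2 * K))) ^ 2 := by
      rw [Real.sq_sqrt (by positivity)]
      calc _ ≤ ∑ j : Fin m, (if (j : ℕ) < K then 2 * (Real.pi / 2 / K) ^ 2 else 0) := by
            refine Finset.sum_le_sum fun j _ => ?_
            refine (shift_bergVec S hS K L (n * j + i) hKpos (by omega)).trans ?_
            have : (j : ℕ) ≤ n * j := Nat.le_mul_of_pos_left _ hn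
            split_ifs with h1 h2 h2
            · exact le_rfl
            · omega
            · positivity
            · exact le_rfl
        _ = ∑ j ∈ Finset.range m, (if j < K then 2 * (Real.pi / 2 / K) ^ 2 else 0) :=
            Fin.sum_univ_eq_sum_range
              (fun j => if j < K then 2 * (Real.pi / 2 / (K : ℝ)) ^ 2 else 0) m
        _ = K * (2 * (Real.pi / 2 / K) ^ 2) := by
            have : (Finset.range m).filter (· < K) = Finset.range K := by
              ext x; simp only [Finset.mem_filter, Finset.mem_range]; omega
            rw [← Finset.sum_filter, this]; simp
        _ ≤ _ := by
            apply le_of_eq; field_simp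
    refine (frameOp_sub_le _ _ hSon (hon (i + 1)) _ (Real.sqrt_nonneg _) hsum).trans_lt ?_
    have : Real.sqrt (Real.pi ^ 2 / (2 * K)) < η / 2 := by
      rw [Real.sqrt_lt' (by positivity)]
      rw [div_lt_iff₀ (by positivity)] at hK ⊢
      nlinarith
    linarith
  · rw [range_frameOp _ (hon _), finrank_span_eq_card (hon _).linearIndependent, Fintype.card_fin]
    have hLr : (L : ℝ) = n * m := by rw [hL]; push_cast; rfl
    have hmL' : (m : ℝ) ≤ L := by exact_mod_cast hmL
    have hKm := (div_lt_iff₀ hη).1 hmη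
    push_cast
    rw [← hLr, gt_iff_lt, lt_div_iff₀ (by positivity)]
    nlinarith [mul_le_mul_of_nonneg_right hmL' hη.le, mul_pos hKpos' hη]

end
end

section
/- Let A be a unital separable simple C*-algebra with the SP-property, stable rank one, and the Fundamental Comparison Property. Let α be an automorphism of A such that α^r is approximately inner for some integer r ≥ 1. If α has the tracial Rokhlin property, then α has the tracial cyclic Rokhlin property. -/
open Filter Topology

section Helpers

variable {A : Type*} [CStarAlgebra A]

lemma hp_star {p : A} (hp : IsProjection p) : star p = p := hp.1
lemma hp_mul {p : A} (hp : IsProjection p) : p * p = p := hp.2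

lemma norm_proj_le {p : A} (hp : IsProjection p) : ‖p‖ ≤ 1 := by
  have h : ‖p‖ = ‖p‖ ^ 2 := by
    conv_lhs => rw [← hp_mul hp]
    exact hp.1.norm_mul_self
  nlinarith [norm_nonneg p]

lemma proj_eq_zero {p : A} (hp : IsProjection p) (h1 : ‖p‖ < 1) : p = 0 := by
  have h : ‖p‖ = ‖p‖ ^ 2 := by
    conv_lhs => rw [← hp_mul hp]
    exact hp.1.norm_mul_self
  have : ‖p‖ = 0 := by
    by_contra h0
    have : 0 < ‖p‖ := lt_of_le_of_ne (norm_nonneg p) (Ne.symm h0)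
    nlinarith
  exact norm_eq_zero.1 this

lemma near_mul (a b c d : A) : ‖a * b - c * d‖ ≤ ‖a - c‖ * ‖b‖ + ‖c‖ * ‖b - d‖ := by
  have : a * b - c * d = (a - c) * b + c * (b - d) := by noncomm_ring
  rw [this]
  exact (norm_add_le _ _).trans (add_le_add (norm_mul_le _ _) (norm_mul_le _ _))

lemma proj_one_sub {p : A} (hp : IsProjection p) : IsProjection (1 - p) := by
  refine ⟨by simp [IsSelfAdjoint, hp_star hp], ?_⟩
  have := hp_mul hp
  simp only [IsIdempotentElem, mul_sub, sub_mul, one_mul, mul_one, this]; simp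

lemma proj_zero : IsProjection (0 : A) := ⟨by simp [IsSelfAdjoint], by simp [IsIdempotentElem]⟩

lemma proj_add {p q : A} (hp : IsProjection p) (hq : IsProjection q) (h : p * q = 0)
    (h' : q * p = 0) : IsProjection (p + q) := by
  refine ⟨by simp [IsSelfAdjoint, hp_star hp, hp_star hq], ?_⟩
  simp only [IsIdempotentElem, mul_add, add_mul, h, h', hp_mul hp, hp_mul hq]; simp

lemma proj_sum {ι : Type*} (s : Finset ι) (p : ι → A) (hp : ∀ i ∈ s, IsProjection (p i))
    (ho : ∀ i ∈ s, ∀ j ∈ s, i ≠ j → p i * p j = 0) : IsProjection (∑ i ∈ s, p i) := by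
  classical
  induction s using Finset.induction_on with
  | empty => simpa using proj_zero
  | insert a s ha ih =>
    rw [Finset.sum_insert ha]
    refine proj_add (hp a (by simp)) (ih (fun i hi => hp i (by simp [hi]))
      (fun i hi j hj => ho i (by simp [hi]) j (by simp [hj]))) ?_ ?_
    · rw [Finset.mul_sum]
      exact Finset.sum_eq_zero fun j hj => ho a (by simp) j (by simp [hj]) (by rintro rfl; exact ha hj)
    · rw [Finset.sum_mul]
      exact Finset.sum_eq_zero fun j hj => ho j (by simp [hj]) a (by simp) (by rintro rfl; exact ha hj)

/-- norm of an orthogonal sum -/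
lemma norm_orth_sum {ι : Type*} (s : Finset ι) (q T : ι → A) (hq : ∀ i ∈ s, IsProjection (q i))
    (ho : ∀ i ∈ s, ∀ j ∈ s, i ≠ j → q i * q j = 0)
    (hT : ∀ i ∈ s, IsSelfAdjoint (T i)) (hqT : ∀ i ∈ s, q i * T i * q i = T i)
    {M : ℝ} (hM0 : 0 ≤ M) (hM : ∀ i ∈ s, ‖T i‖ ≤ M) : ‖∑ i ∈ s, T i‖ ≤ M := by
  let _ := CStarAlgebra.spectralOrder A
  have _ := CStarAlgebra.spectralOrderedRing A
  have hQ := proj_sum s q hq ho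
  have hQ1 : ∑ i ∈ s, q i ≤ 1 := by
    rw [← sub_nonneg]
    have h := proj_one_sub hQ
    have : (1 - ∑ i ∈ s, q i) = star (1 - ∑ i ∈ s, q i) * (1 - ∑ i ∈ s, q i) := by
      rw [hp_star h, hp_mul h]
    rw [this]; exact star_mul_self_nonneg _
  have hMQ : M • (∑ i ∈ s, q i) ≤ algebraMap ℝ A M := by
    rw [Algebra.algebraMap_eq_smul_one]
    exact smul_le_smul_of_nonneg_left hQ1 hM0
  have hconj : ∀ i ∈ s, q i * algebraMap ℝ A M * q i = M • q i := by
    intro i hi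
    rw [Algebra.algebraMap_eq_smul_one]; simp [hp_mul (hq i hi)]
  have hmono : ∀ i ∈ s, algebraMap ℝ A ‖T i‖ ≤ algebraMap ℝ A M := by
    intro i hi
    simp only [Algebra.algebraMap_eq_smul_one]
    exact smul_le_smul_of_nonneg_right (hM i hi) zero_le_one
  have hup : ∑ i ∈ s, T i ≤ algebraMap ℝ A M := by
    refine le_trans ?_ hMQ
    rw [Finset.smul_sum]
    refine Finset.sum_le_sum fun i hi => ?_
    have h1 := ((hT i hi).le_algebraMap_norm_self).trans (hmono i hi)
    have h2 := star_left_conjugate_le_conjugate h1 (q i)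
    rwa [hp_star (hq i hi), hqT i hi, hconj i hi] at h2
  have hlo : -algebraMap ℝ A M ≤ ∑ i ∈ s, T i := by
    refine le_trans (neg_le_neg hMQ) ?_
    rw [Finset.smul_sum, ← Finset.sum_neg_distrib]
    refine Finset.sum_le_sum fun i hi => ?_
    have h1 := (neg_le_neg (hmono i hi)).trans ((hT i hi).neg_algebraMap_norm_le_self)
    have h2 := star_left_conjugate_le_conjugate h1 (q i)
    rw [hp_star (hq i hi), hqT i hi] at h2
    simpa [hconj i hi] using h2
  have hsa : IsSelfAdjoint (∑ i ∈ s, T i) := by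
    rw [IsSelfAdjoint, star_sum]; exact Finset.sum_congr rfl fun i hi => hT i hi
  rw [← cfc_id ℝ (∑ i ∈ s, T i)]
  refine norm_cfc_le hM0 fun x hx => ?_
  rw [le_algebraMap_iff_spectrum_le] at hup
  rw [← map_neg, algebraMap_le_iff_le_spectrum] at hlo
  simpa [abs_le] using ⟨hlo x hx, hup x hx⟩

/-- exact partial isometry near an approximate one -/
lemma exact_pi {p q y : A} (hp : IsProjection p) (hq : IsProjection q)
    (hqy : q * y = y) (hyp : y * p = y) (hy1 : ‖y‖ ≤ 1) {η : ℝ} (hη : η ≤ 1 / 4)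
    (h1 : ‖star y * y - p‖ ≤ η) (h2 : ‖y * star y - q‖ ≤ η) :
    ∃ w : A, star w * w = p ∧ w * star w = q ∧ ‖w - y‖ ≤ η := by
  rcases subsingleton_or_nontrivial A with hsub | hnt
  · exact ⟨0, Subsingleton.elim _ _, Subsingleton.elim _ _, by
      rw [Subsingleton.elim (0 - y) 0, norm_zero]; exact (norm_nonneg _).trans h1⟩
  have hη0 : 0 ≤ η := (norm_nonneg _).trans h1
  have hpy : p * star y = star y := by
    have := congrArg star hyp
    simpa [hp_star hp] using this
  set a : A := star y * y + (1 - p) with ha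
  have hasa : IsSelfAdjoint a := by
    simp [IsSelfAdjoint, ha, hp_star hp]
  have ha1 : ‖a - 1‖ ≤ η := by
    have : a - 1 = star y * y - p := by rw [ha]; abel
    rwa [this]
  have hap : Commute a p := by
    have e1 : star y * y * p = star y * y := by rw [mul_assoc, hyp]
    have e2 : p * (star y * y) = star y * y := by rw [← mul_assoc, hpy]
    show a * p = p * a
    rw [ha, add_mul, mul_add, e1, e2, mul_sub, sub_mul, one_mul, mul_one]
  have hspec : ∀ x ∈ spectrum ℝ a, |x - 1| ≤ η := by
    intro x hx
    have : x - 1 ∈ spectrum ℝ (a - algebraMap ℝ A 1) := by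
      rw [← spectrum.sub_singleton_eq]
      exact Set.sub_mem_sub hx rfl
    have h := spectrum.norm_le_norm_of_mem this
    rw [map_one] at h
    exact h.trans ha1
  have hpos : ∀ x ∈ spectrum ℝ a, 1 / 2 ≤ x := by
    intro x hx
    have := abs_le.1 (hspec x hx); linarith
  set f : ℝ → ℝ := fun x => (√x)⁻¹ with hf
  have hfc : ContinuousOn f (spectrum ℝ a) := by
    refine ContinuousOn.inv₀ Real.continuous_sqrt.continuousOn fun x hx => ?_
    exact (Real.sqrt_pos.2 (by linarith [hpos x hx])).ne'
  set t : A := cfc f a with ht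
  have htsa : star t = t := IsSelfAdjoint.cfc
  have htp : Commute t p := hap.cfc_real f
  have hta : Commute t a := (Commute.refl a).cfc_real f
  have htt : t * t * a = 1 := by
    have e : t * t * a = cfc (fun x => f x * f x * x) a := by
      rw [cfc_mul (fun x => f x * f x) (fun x => x) a (hfc.mul hfc) continuousOn_id,
        cfc_mul f f a hfc hfc, cfc_id' ℝ a]
    rw [e, ← cfc_one ℝ a]
    refine cfc_congr fun x hx => ?_
    have hx0 := hpos x hx
    have : √x * √x = x := Real.mul_self_sqrt (by linarith)
    have hs : 0 < √x := Real.sqrt_pos.2 (by linarith)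
    simp only [hf, Pi.one_apply]
    field_simp
    nlinarith
  have ht1 : ‖t - 1‖ ≤ η := by
    have e : t - 1 = cfc (fun x => f x - 1) a := by
      rw [cfc_sub f (fun _ => 1) a hfc continuousOn_const, cfc_const_one ℝ a]
    rw [e]
    refine norm_cfc_le hη0 fun x hx => ?_
    have hx0 := hpos x hx
    have hss : √x * √x = x := Real.mul_self_sqrt (by linarith)
    have hs : 0 < √x := Real.sqrt_pos.2 (by linarith)
    have hs1 : 1 / 2 ≤ √x := by nlinarith
    have hx1 := abs_le.1 (hspec x hx)
    have e2 : f x - 1 = (1 - √x) / √x := by simp only [hf]; field_simp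
    rw [Real.norm_eq_abs, e2, abs_le, le_div_iff₀ hs, div_le_iff₀ hs]
    constructor
    · nlinarith
    · nlinarith
  have hap1 : a * (1 - p) = 1 - p := by
    rw [ha, add_mul, hp_mul (proj_one_sub hp), mul_sub, mul_one, mul_assoc, hyp]; simp
  have hw1 : star (y * t) * (y * t) = p := by
    rw [star_mul, htsa]
    have e : star y * y = a - (1 - p) := by rw [ha]; abel
    have e2 : t * star y * (y * t) = t * (star y * y) * t := by noncomm_ring
    have e3 : t * t * (1 - p) = 1 - p := by
      conv_lhs => rw [← hap1, ← mul_assoc, htt, one_mul]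
    have c1 : Commute (1 - p) t := (Commute.one_left t).sub_left htp.symm
    rw [e2, e, mul_sub, sub_mul, mul_assoc t a t, ← hta.eq, ← mul_assoc, htt, mul_assoc t (1 - p) t,
      c1.eq, ← mul_assoc, e3]; abel
  set w := y * t with hw
  have hwp : w * p = w := by rw [hw, mul_assoc, htp.eq, ← mul_assoc, hyp]
  have hqw : q * w = w := by rw [hw, ← mul_assoc, hqy]
  have hwy : ‖w - y‖ ≤ η := by
    have : w - y = y * (t - 1) := by rw [hw]; noncomm_ring
    rw [this]
    refine (norm_mul_le _ _).trans ?_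
    nlinarith [norm_nonneg (t - 1), norm_nonneg y]
  refine ⟨w, hw1, ?_, hwy⟩
  have hwn : ‖w‖ ≤ 1 := by
    have : ‖w‖ * ‖w‖ ≤ 1 := by
      rw [← CStarRing.norm_star_mul_self, hw1]; exact norm_proj_le hp
    nlinarith [norm_nonneg w]
  have hpw : star w * q = star w := by
    have := congrArg star hqw
    simpa [hp_star hq] using this
  have hproj : IsProjection (q - w * star w) := by
    refine ⟨by simp [IsSelfAdjoint, hp_star hq], ?_⟩
    have e1 : w * star w * (w * star w) = w * star w := by
      rw [mul_assoc, ← mul_assoc (star w), hw1, ← mul_assoc, hwp]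
    have e2 : q * (w * star w) = w * star w := by rw [← mul_assoc, hqw]
    have e3 : w * star w * q = w * star w := by rw [mul_assoc, hpw]
    simp only [IsIdempotentElem, mul_sub, sub_mul, hp_mul hq, e1, e2, e3]; simp
  have hn : ‖q - w * star w‖ < 1 := by
    have e : q - w * star w = (q - y * star y) - (w * star w - y * star y) := by abel
    have b1 := near_mul w (star w) y (star y)
    have b2 : ‖star w - star y‖ = ‖w - y‖ := by rw [← star_sub, norm_star]
    rw [b2, norm_star] at b1
    rw [norm_sub_rev] at h2
    rw [e]
    have := norm_sub_le (q - y * star y) (w * star w - y * star y)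
    nlinarith [norm_nonneg (w - y), norm_nonneg y, norm_nonneg w]
  exact (sub_eq_zero.1 (proj_eq_zero hproj hn)).symm

lemma mvn_of_close {p q : A} (hp : IsProjection p) (hq : IsProjection q) (h : ‖p - q‖ ≤ 1 / 4) :
    ∃ w : A, star w * w = p ∧ w * star w = q := by
  have hn1 := norm_proj_le hp
  have hn2 := norm_proj_le hq
  have k1 : ‖star (q * p) * (q * p) - p‖ ≤ 1 / 4 := by
    have : star (q * p) * (q * p) - p = p * (q - p) * p := by
      rw [star_mul, hp_star hp, hp_star hq]
      calc p * q * (q * p) - p = p * (q * q) * p - p * p * p := by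
            rw [hp_mul hp, hp_mul hp]; noncomm_ring
        _ = _ := by rw [hp_mul hq]; noncomm_ring
    rw [this]
    rw [norm_sub_rev] at h
    refine (norm_mul_le _ _).trans ?_
    have := norm_mul_le p (q - p)
    nlinarith [norm_nonneg p, norm_nonneg (q - p), norm_nonneg (p * (q - p))]
  have k2 : ‖(q * p) * star (q * p) - q‖ ≤ 1 / 4 := by
    have : (q * p) * star (q * p) - q = q * (p - q) * q := by
      rw [star_mul, hp_star hp, hp_star hq]
      calc q * p * (p * q) - q = q * (p * p) * q - q * q * q := by
            rw [hp_mul hq, hp_mul hq]; noncomm_ring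
        _ = _ := by rw [hp_mul hp]; noncomm_ring
    rw [this]
    refine (norm_mul_le _ _).trans ?_
    have := norm_mul_le q (p - q)
    nlinarith [norm_nonneg q, norm_nonneg (p - q), norm_nonneg (q * (p - q))]
  obtain ⟨w, h1, h2, -⟩ := exact_pi (y := q * p) hp hq (by rw [← mul_assoc, hp_mul hq])
    (by rw [mul_assoc, hp_mul hp])
    ((norm_mul_le _ _).trans (by nlinarith [norm_nonneg p, norm_nonneg q])) (le_refl (1 / 4 : ℝ)) k1 k2
  exact ⟨w, h1, h2⟩

lemma tr_nonneg {τ : A →ₗ[ℂ] ℂ} (hτ : IsTracialState τ) (a : A) : 0 ≤ (τ (star a * a)).re := by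
  obtain ⟨r, hr, h⟩ := hτ.1 a
  rw [h]; simpa using hr

lemma tr_comm {τ : A →ₗ[ℂ] ℂ} (hτ : IsTracialState τ) (a b : A) :
    (τ (a * b)).re = (τ (b * a)).re := by rw [hτ.2.2]

lemma tr_proj_nonneg {τ : A →ₗ[ℂ] ℂ} (hτ : IsTracialState τ) {p : A} (hp : IsProjection p) :
    0 ≤ (τ p).re := by
  have := tr_nonneg hτ p
  rwa [hp_star hp, hp_mul hp] at this

lemma tr_proj_le {τ : A →ₗ[ℂ] ℂ} (hτ : IsTracialState τ) {p : A} (hp : IsProjection p) :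
    (τ p).re ≤ 1 := by
  have := tr_proj_nonneg hτ (proj_one_sub hp)
  rw [map_sub, hτ.2.1] at this
  simpa using this

lemma tr_bound {τ : A →ₗ[ℂ] ℂ} (hτ : IsTracialState τ) (a b : A) :
    (τ (star (b * a) * (b * a))).re ≤ ‖b‖ ^ 2 * (τ (star a * a)).re := by
  let _ := CStarAlgebra.spectralOrder A
  have _ := CStarAlgebra.spectralOrderedRing A
  have h := CStarAlgebra.star_mul_le_algebraMap_norm_sq (a := b)
  rw [← sub_nonneg, CStarAlgebra.nonneg_iff_eq_star_mul_self] at h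
  obtain ⟨c, hc⟩ := h
  have h2 := tr_nonneg hτ (c * a)
  have e : star (c * a) * (c * a) = ((‖b‖ ^ 2 : ℝ) : ℂ) • (star a * a) - star (b * a) * (b * a) := by
    have : star (c * a) * (c * a) = star a * (star c * c) * a := by
      rw [star_mul]; noncomm_ring
    rw [this, ← hc, Algebra.algebraMap_eq_smul_one, star_mul, mul_sub, sub_mul, Complex.coe_smul]
    simp [mul_assoc]
  rw [e, map_sub, map_smul, smul_eq_mul, Complex.sub_re, Complex.re_ofReal_mul] at h2
  linarith

lemma tr_bound' {τ : A →ₗ[ℂ] ℂ} (hτ : IsTracialState τ) (a b : A) :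
    (τ (star (a * b) * (a * b))).re ≤ ‖b‖ ^ 2 * (τ (star a * a)).re := by
  rw [tr_comm hτ]
  have h := tr_bound hτ (star a) (star b)
  rw [norm_star, star_star, ← star_mul, star_star] at h
  rwa [tr_comm hτ (star a) a]

lemma tr_add_sq {τ : A →ₗ[ℂ] ℂ} (hτ : IsTracialState τ) (a b : A) :
    (τ (star (a + b) * (a + b))).re ≤ 2 * (τ (star a * a)).re + 2 * (τ (star b * b)).re := by
  have h := tr_nonneg hτ (a - b)
  have e : star (a - b) * (a - b) = (star a * a + star a * a + (star b * b + star b * b))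
    - star (a + b) * (a + b) := by simp only [star_sub, star_add]; noncomm_ring
  rw [e] at h
  simp only [map_sub, map_add, Complex.sub_re, Complex.add_re] at h
  linarith

lemma tr_lower (hsimple : IsSimpleCStar A) {p : A} (hp : IsProjection p) (hp0 : p ≠ 0) :
    ∃ δ : ℝ, 0 < δ ∧ ∀ τ : A →ₗ[ℂ] ℂ, IsTracialState τ → δ ≤ (τ p).re := by
  let J : Set A := {a | ∀ ε : ℝ, 0 < ε → ∃ C : ℝ, 0 ≤ C ∧ ∀ τ : A →ₗ[ℂ] ℂ, IsTracialState τ →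
    (τ (star a * a)).re ≤ ε + C * (τ p).re}
  have hclosed : ∀ a : A, (∀ ε : ℝ, 0 < ε → ∃ b ∈ J, ‖a - b‖ < ε) → a ∈ J := by
    intro a h ε hε
    obtain ⟨b, hb, hab⟩ := h (min 1 (ε / 4)) (by positivity)
    obtain ⟨C, hC, hCb⟩ := hb (ε / 4) (by positivity)
    refine ⟨2 * C, by positivity, fun τ hτ => ?_⟩
    have h1 := tr_add_sq hτ (a - b) b
    rw [sub_add_cancel] at h1
    have h2 := tr_bound' hτ 1 (a - b)
    simp only [one_mul, star_one, hτ.2.1, Complex.one_re, mul_one] at h2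
    have h3 := hCb τ hτ
    have h4 : ‖a - b‖ ^ 2 ≤ ε / 4 := by
      have h5 := hab.le.trans (min_le_left _ _)
      have h6 := hab.le.trans (min_le_right _ _)
      nlinarith [norm_nonneg (a - b)]
    nlinarith
  have hscale : ∀ (x : A) (c : ℝ), 0 ≤ c → ∀ y ∈ J, (∀ τ : A →ₗ[ℂ] ℂ, IsTracialState τ →
      (τ (star x * x)).re ≤ c * (τ (star y * y)).re) → x ∈ J := by
    intro x c hc y hy h ε hε
    obtain ⟨C, hC, hCb⟩ := hy (ε / (c + 1)) (by positivity)
    refine ⟨c * C, by positivity, fun τ hτ => ?_⟩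
    have h1 := h τ hτ
    have h2 := mul_le_mul_of_nonneg_left (hCb τ hτ) hc
    have h3 : c * (ε / (c + 1)) ≤ ε := by
      rw [mul_div_assoc', div_le_iff₀ (by positivity)]; nlinarith
    nlinarith
  let I : TwoSidedIdeal A := TwoSidedIdeal.mk' J
    (by intro ε hε; exact ⟨0, le_refl _, fun τ hτ => by simpa using hε.le⟩)
    (by
      intro x y hx hy ε hε
      obtain ⟨C, hC, hCb⟩ := hx (ε / 4) (by positivity)
      obtain ⟨D, hD, hDb⟩ := hy (ε / 4) (by positivity)
      refine ⟨2 * C + 2 * D, by positivity, fun τ hτ => ?_⟩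
      have := tr_add_sq hτ x y
      have h1 := hCb τ hτ
      have h2 := hDb τ hτ
      nlinarith)
    (by
      intro x hx
      exact hscale _ 1 zero_le_one x hx fun τ hτ => by simp)
    (by
      intro x y hy
      exact hscale _ _ (sq_nonneg ‖x‖) y hy fun τ hτ => tr_bound hτ y x)
    (by
      intro x y hx
      exact hscale _ _ (sq_nonneg ‖y‖) x hx fun τ hτ => tr_bound' hτ x y)
  have hIJ : (I : Set A) = J := by
    ext x
    exact TwoSidedIdeal.mem_mk' _ _ _ _ _ _ _
  have hpJ : p ∈ J := by
    intro ε hε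
    refine ⟨1, zero_le_one, fun τ hτ => ?_⟩
    rw [hp_star hp, hp_mul hp]; linarith
  have hcl : IsClosed (I : Set A) := by
    rw [hIJ]
    refine isClosed_of_closure_subset fun a ha => hclosed a fun ε hε => ?_
    obtain ⟨b, hb, h⟩ := Metric.mem_closure_iff.1 ha ε hε
    exact ⟨b, hb, by rwa [dist_eq_norm] at h⟩
  rcases hsimple I hcl with h | h
  · rw [hIJ] at h
    rw [h] at hpJ
    exact absurd hpJ hp0
  · rw [hIJ] at h
    have h1 : (1 : A) ∈ J := by rw [h]; trivial
    obtain ⟨C, hC, hCb⟩ := h1 (1 / 2) (by norm_num)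
    refine ⟨1 / (2 * (C + 1)), by positivity, fun τ hτ => ?_⟩
    have h2 := hCb τ hτ
    have h3 := tr_proj_nonneg hτ hp
    simp only [star_one, mul_one, hτ.2.1, Complex.one_re] at h2
    rw [div_le_iff₀ (by positivity)]
    nlinarith

lemma tr_close {τ : A →ₗ[ℂ] ℂ} (hτ : IsTracialState τ) {p q : A} (hp : IsProjection p)
    (hq : IsProjection q) (h : ‖p - q‖ ≤ 1 / 4) : (τ p).re = (τ q).re := by
  obtain ⟨w, h1, h2⟩ := mvn_of_close hp hq h
  rw [← h1, ← h2, tr_comm hτ]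

lemma her_mem {p x c : A} (hp : p ∈ closure (Set.range fun c => x * c * x)) :
    p * c * p ∈ closure (Set.range fun c => x * c * x) := by
  have hcont : Continuous fun y : A => y * c * y := by fun_prop
  refine map_mem_closure (f := fun y : A => y * c * y) hcont hp ?_
  rintro _ ⟨d, rfl⟩
  exact ⟨d * x * c * x * d, by noncomm_ring⟩

lemma her_proj {q z : A} (hq : IsProjection q) (hz : z ∈ closure (Set.range fun c => q * c * q)) :
    q * z = z ∧ z * q = z := by
  have hcl : IsClosed {z : A | q * z = z ∧ z * q = z} :=
    (isClosed_eq (by fun_prop) (by fun_prop)).inter (isClosed_eq (by fun_prop) (by fun_prop))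
  refine closure_minimal ?_ hcl hz
  rintro _ ⟨c, rfl⟩
  exact ⟨by simp only [← mul_assoc, hp_mul hq], by simp only [mul_assoc, hp_mul hq]⟩

lemma cuntz_trans {a p x : A} (hp : IsProjection p) (hpx : p ∈ closure (Set.range fun c => x * c * x))
    (h : CuntzLE a p) : CuntzLE a x := by
  obtain ⟨y, h1, h2⟩ := h
  refine ⟨y, h1, ?_⟩
  obtain ⟨e1, e2⟩ := her_proj hp h2
  have := her_mem (c := y * star y) hpx
  rwa [e1, e2] at this

lemma tr_cuntz {τ : A →ₗ[ℂ] ℂ} (hτ : IsTracialState τ) {f q : A} (hf : IsProjection f)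
    (hq : IsProjection q) (h : CuntzLE f q) : (τ f).re ≤ (τ q).re := by
  obtain ⟨y, h1, h2⟩ := h
  obtain ⟨e1, e2⟩ := her_proj hq h2
  have hyf : y * f = y := by
    have : star (y - y * f) * (y - y * f) = 0 := by
      have : star (y - y * f) * (y - y * f) = f - f * f - f * f + f * f * f := by
        rw [star_sub, star_mul, hp_star hf]
        calc _ = star y * y - star y * y * f - f * (star y * y) + f * (star y * y) * f := by
              noncomm_ring
          _ = _ := by rw [← h1]
      rw [this]; simp [hp_mul hf]
    exact (sub_eq_zero.1 (CStarRing.star_mul_self_eq_zero_iff _ |>.1 this)).symm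
  have e3 : y * star y * (y * star y) = y * star y := by
    rw [mul_assoc, ← mul_assoc (star y), ← h1, ← mul_assoc, hyf]
  have hproj : IsProjection (q - y * star y) := by
    refine ⟨by simp [IsSelfAdjoint, hp_star hq], ?_⟩
    simp only [IsIdempotentElem, mul_sub, sub_mul, hp_mul hq, e1, e2, e3]; simp
  have h4 := tr_proj_nonneg hτ hproj
  rw [map_sub, Complex.sub_re, tr_comm hτ, ← h1] at h4
  linarith

lemma approxInner_iter {f : A → A} (hf : ApproxInner f) (l : ℕ) : ApproxInner f^[l] := by
  classical
  induction l with
  | zero => intro F ε hε; exact ⟨1, one_mem _, fun a _ => by simpa using hε⟩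
  | succ l ih =>
    intro F ε hε
    obtain ⟨v, hv, hva⟩ := ih (F.image f) (ε / 2) (by positivity)
    obtain ⟨u, hu, hua⟩ := hf F (ε / 2) (by positivity)
    refine ⟨u * v, mul_mem hu hv, fun a ha => ?_⟩
    have h1 := hva (f a) (Finset.mem_image_of_mem _ ha)
    have h2 := hua a ha
    rw [Function.iterate_succ_apply]
    have e : f^[l] (f a) - star (u * v) * a * (u * v)
      = (f^[l] (f a) - star v * f a * v) + star v * (f a - star u * a * u) * v := by
      rw [star_mul]; noncomm_ring
    have h3 : ‖star v * (f a - star u * a * u) * v‖ = ‖f a - star u * a * u‖ := by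
      rw [CStarRing.norm_mul_mem_unitary _ hv,
        CStarRing.norm_mem_unitary_mul _ (Unitary.star_mem hv)]
    rw [e]
    have := norm_add_le (f^[l] (f a) - star v * f a * v) (star v * (f a - star u * a * u) * v)
    linarith

lemma proj_conj {v p : A} (hv : v ∈ unitary A) (hp : IsProjection p) :
    IsProjection (star v * p * v) := by
  refine ⟨by simp [IsSelfAdjoint, hp_star hp, mul_assoc], ?_⟩
  have : v * star v = 1 := Unitary.mul_star_self_of_mem hv
  calc star v * p * v * (star v * p * v) = star v * p * (v * star v) * p * v := by noncomm_ring
    _ = star v * (p * p) * v := by rw [this]; noncomm_ring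
    _ = _ := by rw [hp_mul hp]

lemma iter_norm_sub (α : A ≃⋆ₐ[ℂ] A) (i : ℕ) (a b : A) :
    ‖α^[i] a - α^[i] b‖ = ‖a - b‖ := by
  induction i with
  | zero => simp
  | succ i ih =>
    rw [Function.iterate_succ_apply', Function.iterate_succ_apply', ← map_sub,
      StarAlgEquiv.norm_map, ih]

lemma norm_α_sub (α : A ≃⋆ₐ[ℂ] A) (a b : A) : ‖α a - α b‖ = ‖a - b‖ := by
  simpa using iter_norm_sub α 1 a b

lemma tower_iter (α : A ≃⋆ₐ[ℂ] A) (e : ℕ → A) (M : ℕ) {η : ℝ}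
    (h : ∀ j, j + 1 < M → ‖α (e j) - e (j + 1)‖ ≤ η) (j i : ℕ) (hij : j + i < M) :
    ‖α^[i] (e j) - e (j + i)‖ ≤ i * η := by
  induction i with
  | zero => simp
  | succ i ih =>
    have h1 := ih (by omega)
    have h2 := h (j + i) (by omega)
    rw [Function.iterate_succ_apply']
    have h3 := norm_α_sub α (α^[i] (e j)) (e (j + i))
    have := norm_sub_le_norm_sub_add_norm_sub (α (α^[i] (e j))) (α (e (j + i))) (e (j + (i + 1)))
    rw [← add_assoc] at *
    push_cast
    linarith

lemma tower_trace (α : A ≃⋆ₐ[ℂ] A) (L : ℕ) (hL : ApproxInner α^[L]) (e : ℕ → A) (M : ℕ)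
    {η : ℝ} (he : ∀ j, IsProjection (e j))
    (h : ∀ j, j + 1 < M → ‖α (e j) - e (j + 1)‖ ≤ η) (hη : L * η ≤ 1 / 8)
    {τ : A →ₗ[ℂ] ℂ} (hτ : IsTracialState τ) (j i : ℕ) (hij : j + i * L < M) :
    (τ (e (j + i * L))).re = (τ (e j)).re := by
  induction i with
  | zero => simp
  | succ i ih =>
    have hle : j + i * L + L = j + (i + 1) * L := by ring
    have h1 := ih (by omega)
    have h2 := tower_iter α e M h (j + i * L) L (by omega)
    obtain ⟨v, hv, hva⟩ := hL {e (j + i * L)} (1 / 8) (by norm_num)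
    have h3 := hva _ (Finset.mem_singleton_self _)
    have h4 : ‖e (j + i * L + L) - star v * e (j + i * L) * v‖ ≤ 1 / 4 := by
      have := norm_sub_le_norm_sub_add_norm_sub (e (j + i * L + L)) (α^[L] (e (j + i * L)))
        (star v * e (j + i * L) * v)
      rw [norm_sub_rev (e (j + i * L + L)) (α^[L] (e (j + i * L)))] at this
      linarith
    rw [← hle, tr_close hτ (he _) (proj_conj hv (he _)) h4, ← h1, mul_assoc, tr_comm hτ, mul_assoc,
      Unitary.mul_star_self_of_mem hv, mul_one]

lemma sum_blocks {B : Type*} [AddCommMonoid B] (f : ℕ → B) (L k : ℕ) :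
    ∑ j ∈ Finset.range (k * L), f j
      = ∑ i ∈ Finset.range k, ∑ j ∈ Finset.range L, f (j + i * L) := by
  induction k with
  | zero => simp
  | succ k ih =>
    rw [Nat.succ_mul, Finset.sum_range_add, ih, Finset.sum_range_succ]
    simp [add_comm]

lemma tr_sum_le {τ : A →ₗ[ℂ] ℂ} (hτ : IsTracialState τ) (e : ℕ → A) (M : ℕ)
    (he : ∀ j, IsProjection (e j)) (ho : ∀ i j, i ≠ j → e i * e j = 0) :
    ∑ j ∈ Finset.range M, (τ (e j)).re ≤ 1 := by
  have := tr_proj_le hτ (proj_sum (Finset.range M) e (fun i _ => he i) (fun i _ j _ => ho i j))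
  simpa using this

lemma block_trace (α : A ≃⋆ₐ[ℂ] A) (L k : ℕ) (hL : ApproxInner α^[L]) (e : ℕ → A)
    {η : ℝ} (he : ∀ j, IsProjection (e j)) (ho : ∀ i j, i ≠ j → e i * e j = 0)
    (h : ∀ j, j + 1 < k * L → ‖α (e j) - e (j + 1)‖ ≤ η) (hη : L * η ≤ 1 / 8)
    {τ : A →ₗ[ℂ] ℂ} (hτ : IsTracialState τ) :
    (∀ i < k, ∑ j ∈ Finset.range L, (τ (e (j + i * L))).re = ∑ j ∈ Finset.range L, (τ (e j)).re) ∧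
    k * ∑ j ∈ Finset.range L, (τ (e j)).re ≤ 1 := by
  have h1 : ∀ i < k, ∑ j ∈ Finset.range L, (τ (e (j + i * L))).re
      = ∑ j ∈ Finset.range L, (τ (e j)).re := by
    intro i hi
    refine Finset.sum_congr rfl fun j hj => ?_
    refine tower_trace α L hL e (k * L) he h hη hτ j i ?_
    have := Finset.mem_range.1 hj
    have : (i + 1) * L ≤ k * L := Nat.mul_le_mul_right _ hi
    nlinarith
  refine ⟨h1, ?_⟩
  have h2 := tr_sum_le hτ e (k * L) he ho
  rw [sum_blocks, Finset.sum_congr rfl fun i hi => h1 i (Finset.mem_range.1 hi)] at h2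
  simpa using h2

/-- ℕ-indexed version of the tracial Rokhlin property. -/
lemma rokhlin_nat {α : A ≃⋆ₐ[ℂ] A} (hTR : TracialRokhlin α) (F : Finset A) {η : ℝ} (hη : 0 < η)
    (M : ℕ) (hM : 0 < M) {x : A} (hx : IsPos x) (hx0 : x ≠ 0) :
    ∃ e : ℕ → A, (∀ j, IsProjection (e j)) ∧ (∀ i j, i ≠ j → e i * e j = 0) ∧
      (∀ j, j + 1 < M → ‖α (e j) - e (j + 1)‖ ≤ η) ∧
      (∀ j, ∀ a ∈ F, ‖e j * a - a * e j‖ ≤ η) ∧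
      CuntzLE (1 - ∑ j ∈ Finset.range M, e j) x := by
  obtain ⟨n, rfl⟩ : ∃ n, M = n + 1 := ⟨M - 1, by omega⟩
  obtain ⟨e, h1, h2, h3, h4, h5⟩ := hTR F η hη n x hx hx0
  refine ⟨fun j => if h : j < n + 1 then e ⟨j, h⟩ else 0, ?_, ?_, ?_, ?_, ?_⟩
  · intro j; dsimp only; split_ifs
    · exact h1 _
    · exact proj_zero
  · intro i j hij; dsimp only; split_ifs
    · exact h2 _ _ (by simpa using hij)
    all_goals simp
  · intro j hj
    have hj' : j < n + 1 := by omega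
    have := h3 ⟨j, hj'⟩ (by simpa using hj)
    have e1 : (⟨j, hj'⟩ + 1 : Fin (n + 1)) = ⟨j + 1, hj⟩ := by
      ext; rw [Fin.val_add_one_of_lt]; simp [Fin.lt_def]; omega
    rw [e1] at this
    simp only [hj, hj', dif_pos]
    exact this.le
  · intro j a ha; dsimp only; split_ifs
    · exact (h4 _ a ha).le
    · simpa using hη.le
  · rw [Finset.sum_range]
    have : ∀ j : Fin (n + 1), (if h : (j : ℕ) < n + 1 then e ⟨j, h⟩ else 0) = e j :=
      fun j => by rw [dif_pos j.2]
    rw [Finset.sum_congr rfl fun j _ => this j]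
    exact h5

lemma pos_proj {p : A} (hp : IsProjection p) : IsPos p := ⟨p, by rw [hp_star hp, hp_mul hp]⟩

/-- Either `1 ≲ p` or there are nonzero projections of arbitrarily small trace. -/
lemma small_proj {α : A ≃⋆ₐ[ℂ] A} {r : ℕ} (hr : 1 ≤ r) (hai : ApproxInner ((⇑α)^[r]))
    (hTR : TracialRokhlin α) {p : A} (hp : IsProjection p) (hp0 : p ≠ 0) {δ : ℝ} (hδ : 0 < δ) :
    CuntzLE 1 p ∨ ∃ q : A, IsProjection q ∧ q ≠ 0 ∧
      ∀ τ : A →ₗ[ℂ] ℂ, IsTracialState τ → (τ q).re < δ := by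
  obtain ⟨k, hk⟩ := exists_nat_gt (1 / δ)
  have hk0 : (0 : ℝ) < k := lt_trans (by positivity) hk
  have hk0' : 0 < k := by exact_mod_cast hk0
  obtain ⟨e, h1, h2, h3, -, h5⟩ := rokhlin_nat hTR ∅ (η := 1 / (8 * r))
    (by have : (0 : ℝ) < r := by exact_mod_cast hr
        positivity) (k * r) (Nat.mul_pos hk0' hr) (pos_proj hp) hp0
  have hr' : (1 : ℝ) ≤ r := by exact_mod_cast hr
  by_cases h0 : e 0 = 0
  · left
    have hall : ∀ j, j < k * r → e j = 0 := by
      intro j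
      induction j with
      | zero => intro _; exact h0
      | succ j ih =>
        intro hj
        have h := h3 j hj
        rw [ih (by omega), map_zero, zero_sub, norm_neg] at h
        refine proj_eq_zero (h1 _) (h.trans_lt ?_)
        rw [div_lt_one (by positivity)]; linarith
    rw [Finset.sum_eq_zero fun j hj => hall j (Finset.mem_range.1 hj), sub_zero] at h5
    exact h5
  · right
    refine ⟨e 0, h1 0, h0, fun τ hτ => ?_⟩
    have hb := (block_trace α r k hai e h1 h2 h3 (by field_simp; norm_num) hτ).2
    have hle : (τ (e 0)).re ≤ ∑ j ∈ Finset.range r, (τ (e j)).re :=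
      Finset.single_le_sum (f := fun j => (τ (e j)).re) (fun j _ => tr_proj_nonneg hτ (h1 j))
        (Finset.mem_range.2 (by omega))
    have h6 : (k : ℝ) * (τ (e 0)).re ≤ 1 := (mul_le_mul_of_nonneg_left hle hk0.le).trans hb
    rw [div_lt_iff₀ hδ] at hk
    by_contra hcon
    push Not at hcon
    nlinarith

lemma coefs (θ : ℝ) (hθ : 0 < θ) : ∃ L0 : ℕ, ∀ L : ℕ, L0 ≤ L → 1 ≤ L → ∃ c s : ℕ → ℝ,
    (∀ j, c j ^ 2 + s j ^ 2 = 1) ∧ c 0 = 0 ∧ s 0 = 1 ∧ (∀ j, L ≤ j → c j = 1 ∧ s j = 0) ∧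
    (∀ j, |c j - c (j + 1)| ≤ θ) ∧ (∀ j, |s j - s (j + 1)| ≤ θ) := by
  obtain ⟨L0, hL0⟩ := exists_nat_gt (Real.pi / 2 / θ)
  refine ⟨L0, fun L hL h1 => ?_⟩
  have hLpos : (0 : ℝ) < L := by exact_mod_cast h1
  have hLθ : Real.pi / 2 / L ≤ θ := by
    have : Real.pi / 2 / θ ≤ L := hL0.le.trans (by exact_mod_cast hL)
    rw [div_le_iff₀ hθ] at this
    rw [div_le_iff₀ hLpos]; linarith
  set φ : ℕ → ℝ := fun j => min ((j : ℝ) / L) 1 * (Real.pi / 2) with hφ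
  have hstep : ∀ j, |φ j - φ (j + 1)| ≤ θ := by
    intro j
    have e : φ j - φ (j + 1) = (min ((j : ℝ) / L) 1 - min (((j + 1 : ℕ) : ℝ) / L) 1) * (Real.pi / 2) := by
      simp only [hφ]; ring
    have h2 : |min ((j : ℝ) / L) 1 - min (((j + 1 : ℕ) : ℝ) / L) 1| ≤ 1 / L := by
      have h3 := abs_min_sub_min_le_max ((j : ℝ) / L) 1 (((j + 1 : ℕ) : ℝ) / L) 1
      refine h3.trans (max_le ?_ ?_)
      · have : (j : ℝ) / L - ((j + 1 : ℕ) : ℝ) / L = -(1 / L) := by push_cast; ring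
        rw [this, abs_neg, abs_of_pos (by positivity)]
      · simp
    rw [e, abs_mul, abs_of_pos (by positivity : 0 < Real.pi / 2)]
    calc _ ≤ 1 / L * (Real.pi / 2) := by gcongr
      _ = Real.pi / 2 / L := by ring
      _ ≤ θ := hLθ
  refine ⟨fun j => Real.sin (φ j), fun j => Real.cos (φ j), ?_, ?_, ?_, ?_, ?_, ?_⟩
  · intro j; exact Real.sin_sq_add_cos_sq _
  · simp [hφ]
  · simp [hφ]
  · intro j hj
    have : φ j = Real.pi / 2 := by
      have : (1 : ℝ) ≤ (j : ℝ) / L := by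
        rw [le_div_iff₀ hLpos, one_mul]; exact_mod_cast hj
      simp only [hφ, min_eq_right this, one_mul]
    simp [this]
  · intro j; exact (Real.abs_sin_sub_sin_le _ _).trans (hstep j)
  · intro j; exact (Real.abs_cos_sub_cos_le _ _).trans (hstep j)

lemma rot_facts {e f w : A} (he : IsProjection e) (hf : IsProjection f) (hef : e * f = 0)
    (h1 : star w * w = e) (h2 : w * star w = f) (c s : ℝ) (hcs : c ^ 2 + s ^ 2 = 1) :
    star ((c : ℂ) • e + (s : ℂ) • w) * ((c : ℂ) • e + (s : ℂ) • w) = e ∧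
    (e + f) * ((c : ℂ) • e + (s : ℂ) • w) = (c : ℂ) • e + (s : ℂ) • w ∧
    ((c : ℂ) • e + (s : ℂ) • w) * e = (c : ℂ) • e + (s : ℂ) • w := by
  have hwe : w * e = w := by
    have : star (w - w * e) * (w - w * e) = 0 := by
      have : star (w - w * e) * (w - w * e) = e - e * e - e * e + e * e * e := by
        rw [star_sub, star_mul, hp_star he]
        calc _ = star w * w - star w * w * e - e * (star w * w) + e * (star w * w) * e := by
              noncomm_ring
          _ = _ := by rw [h1]
      rw [this]; simp [hp_mul he]
    exact (sub_eq_zero.1 (CStarRing.star_mul_self_eq_zero_iff _ |>.1 this)).symm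
  have hfw : f * w = w := by rw [← h2, mul_assoc, h1, hwe]
  have hew : e * w = 0 := by rw [← hfw, ← mul_assoc, hef, zero_mul]
  have hfe : f * e = 0 := by
    have := congrArg star hef
    simpa [hp_star he, hp_star hf] using this
  have hwe' : star w * e = 0 := by
    have := congrArg star hew
    simpa [hp_star he] using this
  refine ⟨?_, ?_, ?_⟩
  · simp only [star_add, star_smul, hp_star he, add_mul, mul_add, smul_mul_smul_comm, hp_mul he,
      hew, hwe', h1, smul_zero, add_zero, zero_add]
    rw [← add_smul]
    have : star (c : ℂ) * (c : ℂ) + star (s : ℂ) * (s : ℂ) = 1 := by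
      simp only [Complex.star_def, Complex.conj_ofReal]
      exact_mod_cast (by nlinarith : c * c + s * s = 1)
    rw [this, one_smul]
  · simp only [add_mul, mul_add, mul_smul_comm, hp_mul he, hew, hfe, hfw, add_zero,
      zero_add]
  · simp only [add_mul, smul_mul_assoc, hp_mul he, hwe]

lemma norm_pi_le {V e : A} (he : IsProjection e) (h : star V * V = e) : ‖V‖ ≤ 1 := by
  have : ‖V‖ * ‖V‖ ≤ 1 := by
    rw [← CStarRing.norm_star_mul_self, h]; exact norm_proj_le he
  nlinarith [norm_nonneg V]

lemma near_VV {V W : A} (hV : ‖V‖ ≤ 1) (hW : ‖W‖ ≤ 1) {ρ : ℝ} (h : ‖V - W‖ ≤ ρ) :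
    ‖V * star V - W * star W‖ ≤ 2 * ρ := by
  have b1 := near_mul V (star V) W (star W)
  rw [← star_sub, norm_star, norm_star] at b1
  nlinarith [norm_nonneg (V - W), norm_nonneg V, norm_nonneg W]

lemma comm_VV {V a : A} (hV : ‖V‖ ≤ 1) {ρ : ℝ} (h : ‖V * a - a * V‖ ≤ ρ)
    (h' : ‖V * star a - star a * V‖ ≤ ρ) :
    ‖V * star V * a - a * (V * star V)‖ ≤ 2 * ρ := by
  have e : V * star V * a - a * (V * star V)
      = (V * a - a * V) * star V - V * star (V * star a - star a * V) := by
    simp only [star_sub, star_mul, star_star]; noncomm_ring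
  rw [e]
  have h1 := norm_sub_le ((V * a - a * V) * star V) (V * star (V * star a - star a * V))
  have h2 := norm_mul_le (V * a - a * V) (star V)
  have h3 := norm_mul_le V (star (V * star a - star a * V))
  rw [norm_star] at h2 h3
  nlinarith [norm_nonneg (V * a - a * V), norm_nonneg (V * star a - star a * V), norm_nonneg V]

lemma abs_le_one_of_sq {c s : ℝ} (h : c ^ 2 + s ^ 2 = 1) : |c| ≤ 1 ∧ |s| ≤ 1 := by
  constructor
  · rw [← sq_le_one_iff_abs_le_one]; nlinarith [sq_nonneg s]
  · rw [← sq_le_one_iff_abs_le_one]; nlinarith [sq_nonneg c]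

lemma norm_comb (c s : ℝ) (x y : A) {a b : ℝ} (hx : |c| * ‖x‖ ≤ a) (hy : |s| * ‖y‖ ≤ b) :
    ‖(c : ℂ) • x + (s : ℂ) • y‖ ≤ a + b := by
  refine (norm_add_le _ _).trans (add_le_add ?_ ?_)
  · rw [norm_smul]; simpa using hx
  · rw [norm_smul]; simpa using hy

lemma rokhlin_rotation (α : A ≃⋆ₐ[ℂ] A) (e w : ℕ → A) (L N K n : ℕ) (hL : 1 ≤ L) (hN : 2 * L ≤ N)
    (hK : N = K * (n + 1)) (he : ∀ j, IsProjection (e j)) (ho : ∀ i j, i ≠ j → e i * e j = 0)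
    (hw1 : ∀ j < 2 * L, star (w j) * w j = e j) (hw2 : ∀ j < 2 * L, w j * star (w j) = e (j + N))
    (c s : ℕ → ℝ) (hcs : ∀ j, c j ^ 2 + s j ^ 2 = 1) (hc0 : c 0 = 0) (hs0 : s 0 = 1)
    (hcL : ∀ j, L ≤ j → c j = 1 ∧ s j = 0) {θ : ℝ}
    (hcθ : ∀ j, |c j - c (j + 1)| ≤ θ) (hsθ : ∀ j, |s j - s (j + 1)| ≤ θ)
    {ρ : ℝ} (hαe : ∀ j < N, ‖α (e j) - e (j + 1)‖ ≤ ρ)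
    (hαw : ∀ j < L, ‖α (w j) - w (j + 1)‖ ≤ ρ)
    (F : Set A) (hFs : ∀ a ∈ F, star a ∈ F)
    (heF : ∀ j, ∀ a ∈ F, ‖e j * a - a * e j‖ ≤ ρ)
    (hwF : ∀ j < L, ∀ a ∈ F, ‖w j * a - a * w j‖ ≤ ρ) :
    ∃ E : Fin (n + 1) → A, (∀ j, IsProjection (E j)) ∧ (∀ i j, i ≠ j → E i * E j = 0) ∧
      (∀ j, ‖α (E j) - E (j + 1)‖ ≤ 4 * θ + K * (4 * ρ)) ∧
      (∀ j, ∀ a ∈ F, ‖E j * a - a * E j‖ ≤ K * (4 * ρ)) ∧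
      ∀ τ : A →ₗ[ℂ] ℂ, IsTracialState τ →
        (τ (∑ j, E j)).re = ∑ j ∈ Finset.range N, (τ (e j)).re := by
  have hρ : 0 ≤ ρ := (norm_nonneg _).trans (hαe 0 (by omega))
  have hθ : 0 ≤ θ := (abs_nonneg _).trans (hcθ 0)
  set X : ℕ → ℝ → ℝ → A := fun i c s => (c : ℂ) • e i + (s : ℂ) • w i with hX
  set q : ℕ → A := fun i => if i < 2 * L then e i + e (i + N) else e i with hq
  have hqp : ∀ i, IsProjection (q i) := by
    intro i
    simp only [hq]; split_ifs
    · exact proj_add (he _) (he _) (ho _ _ (by omega)) (ho _ _ (by omega))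
    · exact he i
  have hXf : ∀ i c s, c ^ 2 + s ^ 2 = 1 → (i < 2 * L ∨ (c = 1 ∧ s = 0)) →
      star (X i c s) * X i c s = e i ∧ q i * X i c s = X i c s ∧ X i c s * e i = X i c s := by
    intro i c s h1 h2
    by_cases hi : i < 2 * L
    · simp only [hq, if_pos hi]
      exact rot_facts (he i) (he _) (ho _ _ (by omega)) (hw1 i hi) (hw2 i hi) c s h1
    · obtain ⟨rfl, rfl⟩ := h2.resolve_left hi
      simp [hq, if_neg hi, hX, hp_star (he i), hp_mul (he i)]
  set V : ℕ → A := fun j => X j (c j) (s j) with hV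
  set V' : ℕ → A := fun j => X (j + 1) (c j) (s j) with hV'
  have hVf : ∀ j, star (V j) * V j = e j ∧ q j * V j = V j ∧ V j * e j = V j := by
    intro j
    refine hXf j _ _ (hcs j) ?_
    by_cases h : j < 2 * L
    · exact Or.inl h
    · exact Or.inr (hcL j (by omega))
  have hVf' : ∀ j, star (V' j) * V' j = e (j + 1) ∧ q (j + 1) * V' j = V' j ∧
      V' j * e (j + 1) = V' j := by
    intro j
    refine hXf (j + 1) _ _ (hcs j) ?_
    by_cases h : j < L
    · exact Or.inl (by omega)
    · exact Or.inr (hcL j (by omega))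
  have hVn : ∀ j, ‖V j‖ ≤ 1 := fun j => norm_pi_le (he j) (hVf j).1
  have hVn' : ∀ j, ‖V' j‖ ≤ 1 := fun j => norm_pi_le (he (j + 1)) (hVf' j).1
  set P : ℕ → A := fun j => V j * star (V j) with hP
  set Q : ℕ → A := fun j => V' j * star (V' j) with hQ
  have hPp : ∀ j, IsProjection (P j) := by
    intro j
    refine ⟨by simp [IsSelfAdjoint, hP], ?_⟩
    show V j * star (V j) * (V j * star (V j)) = V j * star (V j)
    rw [mul_assoc, ← mul_assoc (star (V j)), (hVf j).1, ← mul_assoc, (hVf j).2.2]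
  have hqP : ∀ j, q j * P j = P j := by
    intro j; simp only [hP, ← mul_assoc, (hVf j).2.1]
  have hPq : ∀ j, P j * q j = P j := by
    intro j
    have := congrArg star (hqP j)
    simpa [hp_star (hPp j), hp_star (hqp j)] using this
  have hqQ : ∀ j, q (j + 1) * Q j = Q j := by
    intro j; simp only [hQ, ← mul_assoc, (hVf' j).2.1]
  have hQsa : ∀ j, star (Q j) = Q j := by intro j; simp [hQ]
  have hQq : ∀ j, Q j * q (j + 1) = Q j := by
    intro j
    have := congrArg star (hqQ j)
    simpa [hQsa j, hp_star (hqp (j + 1))] using this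
  have hqo : ∀ i j, i ≠ j → (i < N ∧ j < N ∨ (1 ≤ i ∧ i ≤ N ∧ 1 ≤ j ∧ j ≤ N)) → q i * q j = 0 := by
    intro i j hij h
    simp only [hq]
    split_ifs
    · simp only [mul_add, add_mul, ho i j hij, ho (i + N) (j + N) (by omega),
        ho i (j + N) (by omega), ho (i + N) j (by omega), add_zero]
    · simp only [add_mul, ho i j hij, ho (i + N) j (by omega), add_zero]
    · simp only [mul_add, ho i j hij, ho i (j + N) (by omega), add_zero]
    · exact ho i j hij
  have hPo : ∀ i j, i ≠ j → i < N → j < N → P i * P j = 0 := by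
    intro i j hij hi hj
    rw [← hPq i, ← hqP j, mul_assoc, ← mul_assoc (q i), hqo i j hij (Or.inl ⟨hi, hj⟩)]; simp
  have hPN : P N = P 0 := by
    have e1 : V N = e N := by
      obtain ⟨h1, h2⟩ := hcL N (by omega)
      simp [hV, hX, h1, h2]
    have e2 : V 0 = w 0 := by simp [hV, hX, hc0, hs0]
    simp only [hP, e1, e2, hw2 0 (by omega), hp_star (he N), hp_mul (he N), zero_add]
  have hQP : ∀ j < N, ‖Q j - P (j + 1)‖ ≤ 4 * θ := by
    intro j hj
    have h1 : ‖V' j - V (j + 1)‖ ≤ θ + θ := by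
      by_cases hjL : j < L
      · have e1 : V' j - V (j + 1) = ((c j - c (j + 1) : ℝ) : ℂ) • e (j + 1)
            + ((s j - s (j + 1) : ℝ) : ℂ) • w (j + 1) := by
          simp only [hV, hV', hX, Complex.ofReal_sub, sub_smul]; abel
        rw [e1]
        have n1 := norm_proj_le (he (j + 1))
        have n2 := norm_pi_le (he (j + 1)) (hw1 (j + 1) (by omega))
        refine norm_comb _ _ _ _ ?_ ?_
        · nlinarith [hcθ j, abs_nonneg (c j - c (j + 1)), norm_nonneg (e (j + 1))]
        · nlinarith [hsθ j, abs_nonneg (s j - s (j + 1)), norm_nonneg (w (j + 1))]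
      · obtain ⟨h1, h2⟩ := hcL j (by omega)
        obtain ⟨h3, h4⟩ := hcL (j + 1) (by omega)
        have : V' j - V (j + 1) = 0 := by simp [hV, hV', hX, h1, h2, h3, h4]
        rw [this, norm_zero]; linarith
    have := near_VV (hVn' j) (hVn (j + 1)) h1
    simp only [hP, hQ]
    linarith
  have hαPQ : ∀ j < N, ‖α (P j) - Q j‖ ≤ 4 * ρ := by
    intro j hj
    obtain ⟨hc1, hs1⟩ := abs_le_one_of_sq (hcs j)
    have e1 : α (V j) - V' j = (c j : ℂ) • (α (e j) - e (j + 1))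
        + (s j : ℂ) • (α (w j) - w (j + 1)) := by
      simp only [hV, hV', hX, map_add, map_smul, smul_sub]; abel
    have h1 : ‖α (V j) - V' j‖ ≤ ρ + ρ := by
      rw [e1]
      refine norm_comb _ _ _ _ ?_ ?_
      · nlinarith [hαe j hj, abs_nonneg (c j), norm_nonneg (α (e j) - e (j + 1))]
      · by_cases hjL : j < L
        · nlinarith [hαw j hjL, abs_nonneg (s j), norm_nonneg (α (w j) - w (j + 1))]
        · simpa [(hcL j (by omega)).2] using hρ
    have := near_VV (V := α (V j)) (by rw [StarAlgEquiv.norm_map]; exact hVn j) (hVn' j) h1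
    simp only [hP, hQ, map_mul, map_star]
    linarith
  have hPF : ∀ j, ∀ a ∈ F, ‖P j * a - a * P j‖ ≤ 4 * ρ := by
    intro j
    have hVF : ∀ a ∈ F, ‖V j * a - a * V j‖ ≤ ρ + ρ := by
      intro a ha
      obtain ⟨hc1, hs1⟩ := abs_le_one_of_sq (hcs j)
      have e1 : V j * a - a * V j = (c j : ℂ) • (e j * a - a * e j)
          + (s j : ℂ) • (w j * a - a * w j) := by
        simp only [hV, hX, add_mul, mul_add, smul_mul_assoc, mul_smul_comm, smul_sub]; abel
      rw [e1]
      refine norm_comb _ _ _ _ ?_ ?_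
      · nlinarith [heF j a ha, abs_nonneg (c j), norm_nonneg (e j * a - a * e j)]
      · by_cases hjL : j < L
        · nlinarith [hwF j hjL a ha, abs_nonneg (s j), norm_nonneg (w j * a - a * w j)]
        · simpa [(hcL j (by omega)).2] using hρ
    intro a ha
    have := comm_VV (hVn j) (hVF a ha) (hVF _ (hFs a ha))
    simp only [hP]
    linarith
  -- grouping
  have hidx : ∀ i ≤ n, ∀ k < K, i + k * (n + 1) < N := by
    intro i hi k hk
    have : (k + 1) * (n + 1) ≤ K * (n + 1) := Nat.mul_le_mul_right _ hk
    rw [hK]; nlinarith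
  have hinj : ∀ i ≤ n, ∀ i' ≤ n, ∀ k k', i + k * (n + 1) = i' + k' * (n + 1) → i = i' ∧ k = k' := by
    intro i hi i' hi' k k' h
    have h1 : i = i' := by
      have := congrArg (· % (n + 1)) h
      simpa [Nat.mod_eq_of_lt (Nat.lt_succ_of_le hi), Nat.mod_eq_of_lt (Nat.lt_succ_of_le hi')]
        using this
    refine ⟨h1, ?_⟩
    subst h1
    exact Nat.eq_of_mul_eq_mul_right (Nat.succ_pos n) (Nat.add_left_cancel h)
  have hle : ∀ i : Fin (n + 1), (i : ℕ) ≤ n := fun i => Nat.le_of_lt_succ i.2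
  refine ⟨fun i => ∑ k ∈ Finset.range K, P (i + k * (n + 1)), ?_, ?_, ?_, ?_, ?_⟩
  · intro i
    refine proj_sum _ _ (fun k _ => hPp _) fun k hk k' hk' hkk => ?_
    refine hPo _ _ (fun h => hkk (hinj _ (hle i) _ (hle i) _ _ h).2) ?_ ?_
    · exact hidx _ (hle i) _ (Finset.mem_range.1 hk)
    · exact hidx _ (hle i) _ (Finset.mem_range.1 hk')
  · intro i j hij
    rw [Finset.sum_mul_sum]
    refine Finset.sum_eq_zero fun k hk => Finset.sum_eq_zero fun k' hk' => ?_
    refine hPo _ _ (fun h => hij (Fin.ext (hinj _ (hle i) _ (hle j) _ _ h).1)) ?_ ?_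
    · exact hidx _ (hle i) _ (Finset.mem_range.1 hk)
    · exact hidx _ (hle j) _ (Finset.mem_range.1 hk')
  · intro i
    have hE1 : ∑ k ∈ Finset.range K, P ((i + 1 : Fin (n + 1)) + k * (n + 1))
        = ∑ k ∈ Finset.range K, P (i + k * (n + 1) + 1) := by
      by_cases hi : i = Fin.last n
      · subst hi
        have e0 : ((Fin.last n + 1 : Fin (n + 1)) : ℕ) = 0 := by simp
        rw [e0]
        have h1 := Finset.sum_range_succ (fun k => P (0 + k * (n + 1))) K
        have h2 := Finset.sum_range_succ' (fun k => P (0 + k * (n + 1))) K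
        rw [h1] at h2
        have e1 : P (0 + K * (n + 1)) = P (0 + 0 * (n + 1)) := by
          rw [zero_add, ← hK, hPN]; simp
        rw [e1] at h2
        have h3 := add_right_cancel h2
        rw [h3]
        refine Finset.sum_congr rfl fun k _ => ?_
        congr 1
        simp only [Fin.val_last]; ring
      · have e0 : ((i + 1 : Fin (n + 1)) : ℕ) = i + 1 :=
          Fin.val_add_one_of_lt (Fin.lt_last_iff_ne_last.2 hi)
        rw [e0]
        refine Finset.sum_congr rfl fun k _ => ?_
        congr 1; ring
    show ‖α (∑ k ∈ Finset.range K, P (i + k * (n + 1)))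
      - ∑ k ∈ Finset.range K, P ((i + 1 : Fin (n + 1)) + k * (n + 1))‖ ≤ _
    rw [hE1, map_sum]
    have e2 : ∑ k ∈ Finset.range K, α (P (i + k * (n + 1)))
        - ∑ k ∈ Finset.range K, P (i + k * (n + 1) + 1)
        = ∑ k ∈ Finset.range K, (Q (i + k * (n + 1)) - P (i + k * (n + 1) + 1))
        + ∑ k ∈ Finset.range K, (α (P (i + k * (n + 1))) - Q (i + k * (n + 1))) := by
      rw [Finset.sum_sub_distrib, Finset.sum_sub_distrib]; abel
    rw [e2]
    refine (norm_add_le _ _).trans (add_le_add ?_ ?_)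
    · refine norm_orth_sum _ (fun k => q (i + k * (n + 1) + 1)) _ (fun k _ => hqp _) ?_ ?_ ?_
        (by positivity) (fun k hk => hQP _ (hidx _ (hle i) _ (Finset.mem_range.1 hk)))
      · intro k hk k' hk' hkk
        have b1 := hidx _ (hle i) _ (Finset.mem_range.1 hk)
        have b2 := hidx _ (hle i) _ (Finset.mem_range.1 hk')
        refine hqo _ _ (fun h => hkk (hinj _ (hle i) _ (hle i) _ _ (Nat.succ_injective h)).2) ?_
        right; omega
      · intro k _
        simp [IsSelfAdjoint, hQsa, hp_star (hPp _)]
      · intro k _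
        rw [mul_sub, sub_mul, hqQ, hQq, hqP, hPq]
    · refine (norm_sum_le _ _).trans ?_
      refine (Finset.sum_le_sum fun k hk =>
        hαPQ _ (hidx _ (hle i) _ (Finset.mem_range.1 hk))).trans ?_
      simp
  · intro i a ha
    rw [Finset.sum_mul, Finset.mul_sum, ← Finset.sum_sub_distrib]
    refine (norm_sum_le _ _).trans ?_
    refine (Finset.sum_le_sum fun k hk => hPF _ a ha).trans ?_
    simp
  · intro τ hτ
    have hPe : ∀ j, (τ (P j)).re = (τ (e j)).re := by
      intro j
      simp only [hP]
      rw [tr_comm hτ, (hVf j).1]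
    rw [Finset.sum_comm, hK, sum_blocks]
    simp only [map_sum, Complex.re_sum, hPe]
    refine Finset.sum_congr rfl fun k _ => ?_
    rw [Finset.sum_range (fun j => (τ (e (j + k * (n + 1)))).re)]

lemma norm_conj {v : A} (hv : v ∈ unitary A) (x : A) : ‖star v * x * v‖ = ‖x‖ := by
  rw [CStarRing.norm_mul_mem_unitary _ hv, CStarRing.norm_mem_unitary_mul _ (Unitary.star_mem hv)]

lemma norm_conj' {v : A} (hv : v ∈ unitary A) (x : A) : ‖v * x * star v‖ = ‖x‖ := by
  rw [CStarRing.norm_mul_mem_unitary _ (Unitary.star_mem hv), CStarRing.norm_mem_unitary_mul _ hv]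

lemma iter_star (α : A ≃⋆ₐ[ℂ] A) (j : ℕ) (a : A) : α^[j] (star a) = star (α^[j] a) := by
  induction j with
  | zero => rfl
  | succ j ih => rw [Function.iterate_succ_apply', Function.iterate_succ_apply', ih, map_star]

lemma iter_mul (α : A ≃⋆ₐ[ℂ] A) (j : ℕ) (a b : A) : α^[j] (a * b) = α^[j] a * α^[j] b :=
  iterate_map_mul α j a b

lemma iter_unitary (α : A ≃⋆ₐ[ℂ] A) (j : ℕ) {u : A} (hu : u ∈ unitary A) :
    α^[j] u ∈ unitary A := by
  rw [Unitary.mem_iff] at hu ⊢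
  rw [← iter_star, ← iter_mul, ← iter_mul, hu.1, hu.2, iterate_map_one]
  exact ⟨rfl, rfl⟩

lemma inter_unitary (α : A ≃⋆ₐ[ℂ] A) (N L : ℕ) (hN : ApproxInner α^[N]) (F : Finset A) {η : ℝ}
    (hη : 0 < η) : ∃ v₁ ∈ unitary A, ∀ e₀ : A, ‖e₀ * v₁ - v₁ * e₀‖ ≤ η →
      ∃ u ∈ unitary A, ‖u * e₀ * star u - α^[N] e₀‖ ≤ 2 * η ∧
        ∀ j < 2 * L, ∀ a ∈ F, ‖α^[j] u * a - a * α^[j] u‖ ≤ 2 * η := by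
  classical
  set F2 : Finset A := (Finset.range (2 * L) ×ˢ F).image
    fun x => α.symm^[N] (α.symm^[x.1] x.2) with hF2
  have hinv : ∀ (i : ℕ) (a : A), α^[i] (α.symm^[i] a) = a := fun i a =>
    (Function.LeftInverse.iterate (f := α.symm) (g := α) (fun x => α.apply_symm_apply x) i) a
  obtain ⟨v₁, hv₁, hv₁a⟩ := hN F2 η hη
  refine ⟨v₁, hv₁, fun e₀ he₀ => ?_⟩
  obtain ⟨v₂, hv₂, hv₂a⟩ := hN (insert e₀ F2) η hη
  have m1 : v₁ * star v₁ = 1 := Unitary.mul_star_self_of_mem hv₁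
  have hu : star v₂ * v₁ ∈ unitary A := mul_mem (Unitary.star_mem hv₂) hv₁
  refine ⟨star v₂ * v₁, hu, ?_, ?_⟩
  · have h1 : v₁ * e₀ * star v₁ - e₀ = -((e₀ * v₁ - v₁ * e₀) * star v₁) := by
      rw [sub_mul, mul_assoc e₀, m1, mul_one]; abel
    have h2 : ‖v₁ * e₀ * star v₁ - e₀‖ ≤ η := by
      rw [h1, norm_neg, CStarRing.norm_mul_mem_unitary _ (Unitary.star_mem hv₁)]; exact he₀
    have h3 := hv₂a e₀ (Finset.mem_insert_self _ _)
    have e1 : star v₂ * v₁ * e₀ * star (star v₂ * v₁) - α^[N] e₀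
        = star v₂ * (v₁ * e₀ * star v₁ - e₀) * v₂ - (α^[N] e₀ - star v₂ * e₀ * v₂) := by
      rw [star_mul, star_star]; noncomm_ring
    rw [e1]
    have := norm_sub_le (star v₂ * (v₁ * e₀ * star v₁ - e₀) * v₂) (α^[N] e₀ - star v₂ * e₀ * v₂)
    rw [norm_conj hv₂] at this
    linarith
  · intro j hj a ha
    set a' := α.symm^[j] a with ha'
    set b := α.symm^[N] a' with hb
    have hbF : b ∈ F2 := Finset.mem_image.2 ⟨(j, a), by simp [hj, ha], rfl⟩
    have hαb : α^[N] b = a' := hinv N a'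
    have g1 := hv₁a b hbF
    have g2 := hv₂a b (Finset.mem_insert_of_mem hbF)
    rw [hαb] at g1 g2
    have e0 : α^[j] (star v₂ * v₁) * a - a * α^[j] (star v₂ * v₁)
        = α^[j] (star v₂ * v₁ * a') - α^[j] (a' * (star v₂ * v₁)) := by
      rw [iter_mul α j _ a', iter_mul α j a', ha', hinv j a]
    rw [e0, iter_norm_sub]
    have e1 : star v₂ * v₁ * a' - a' * (star v₂ * v₁)
        = (star v₂ * (v₁ * (a' - star v₁ * b * v₁) * star v₁) * v₂ - (a' - star v₂ * b * v₂))
          * (star v₂ * v₁) := by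
      have m2 : v₂ * star v₂ = 1 := Unitary.mul_star_self_of_mem hv₂
      have m3 : star v₁ * v₁ = 1 := Unitary.star_mul_self_of_mem hv₁
      have s1 : v₁ * (a' - star v₁ * b * v₁) * star v₁ = v₁ * a' * star v₁ - b := by
        calc _ = v₁ * a' * star v₁ - (v₁ * star v₁) * b * (v₁ * star v₁) := by noncomm_ring
          _ = _ := by rw [m1]; simp
      rw [s1]
      calc star v₂ * v₁ * a' - a' * (star v₂ * v₁)
          = star v₂ * v₁ * a' * (star v₁ * 1 * v₁) - a' * (star v₂ * v₁) := by
            rw [mul_one, m3, mul_one]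
        _ = _ := by rw [← m2]; noncomm_ring
    rw [e1, CStarRing.norm_mul_mem_unitary _ hu]
    have := norm_sub_le (star v₂ * (v₁ * (a' - star v₁ * b * v₁) * star v₁) * v₂)
      (a' - star v₂ * b * v₂)
    rw [norm_conj hv₂, norm_conj' hv₁] at this
    linarith

lemma norm_unitary_le {v : A} (hv : v ∈ unitary A) : ‖v‖ ≤ 1 :=
  norm_pi_le (e := 1) (by simp [IsProjection, IsSelfAdjoint, IsIdempotentElem])
    (Unitary.star_mul_self_of_mem hv)

lemma w_exists {e f U : A} (he : IsProjection e) (hf : IsProjection f) (hU : U ∈ unitary A) {κ : ℝ}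
    (hκ : 3 * κ ≤ 1 / 4) (h : ‖f - U * e * star U‖ ≤ κ) :
    ∃ w : A, star w * w = e ∧ w * star w = f ∧ ‖w - U * e‖ ≤ 4 * κ := by
  have m1 : star U * U = 1 := Unitary.star_mul_self_of_mem hU
  have ne := norm_proj_le he
  have nf := norm_proj_le hf
  have nU := norm_unitary_le hU
  have nUe : ‖U * e‖ ≤ 1 := by rw [CStarRing.norm_mem_unitary_mul _ hU]; exact ne
  have hy : ‖f * U * e - U * e‖ ≤ κ := by
    have e1 : f * U * e - U * e = (f - U * e * star U) * U * e := by
      calc f * U * e - U * e = f * U * e - U * (e * e) := by rw [hp_mul he]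
        _ = f * U * e - U * e * 1 * e := by noncomm_ring
        _ = f * U * e - U * e * (star U * U) * e := by rw [m1]
        _ = _ := by noncomm_ring
    rw [e1]
    refine (norm_mul_le _ _).trans ?_
    rw [CStarRing.norm_mul_mem_unitary _ hU]
    nlinarith [norm_nonneg e, norm_nonneg (f - U * e * star U)]
  have hyn : ‖f * U * e‖ ≤ 1 := by
    rw [mul_assoc]
    refine (norm_mul_le _ _).trans ?_
    nlinarith [norm_nonneg f, norm_nonneg (U * e)]
  have k1 : ‖star (f * U * e) * (f * U * e) - e‖ ≤ 3 * κ := by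
    have e2 : star (U * e) * (U * e) = e := by
      calc star (U * e) * (U * e) = e * (star U * U) * e := by
            rw [star_mul, hp_star he]; noncomm_ring
        _ = e := by rw [m1, mul_one, hp_mul he]
    have b := near_mul (star (f * U * e)) (f * U * e) (star (U * e)) (U * e)
    rw [← star_sub, norm_star, norm_star, e2] at b
    nlinarith [norm_nonneg (f * U * e - U * e), norm_nonneg (U * e), norm_nonneg (f * U * e)]
  have k2 : ‖f * U * e * star (f * U * e) - f‖ ≤ 3 * κ := by
    have b := near_VV hyn nUe hy
    have e2 : U * e * star (U * e) = U * e * star U := by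
      rw [star_mul, hp_star he, ← mul_assoc, mul_assoc U e e, hp_mul he]
    rw [e2] at b
    have := norm_sub_le_norm_sub_add_norm_sub (f * U * e * star (f * U * e)) (U * e * star U) f
    rw [norm_sub_rev (U * e * star U) f] at this
    linarith
  obtain ⟨w, h1, h2, h3⟩ := exact_pi he hf (y := f * U * e)
    (by rw [← mul_assoc, ← mul_assoc, hp_mul hf]) (by rw [mul_assoc, hp_mul he]) hyn hκ k1 k2
  refine ⟨w, h1, h2, ?_⟩
  have := norm_sub_le_norm_sub_add_norm_sub w (f * U * e) (U * e)
  linarith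

lemma comm_near {w x a : A} {κ B σ : ℝ} (h : ‖w - x‖ ≤ κ) (ha : ‖a‖ ≤ B)
    (hx : ‖x * a - a * x‖ ≤ σ) : ‖w * a - a * w‖ ≤ σ + 2 * κ * B := by
  have e : w * a - a * w = (x * a - a * x) + ((w - x) * a - a * (w - x)) := by noncomm_ring
  rw [e]
  have h1 := norm_add_le (x * a - a * x) ((w - x) * a - a * (w - x))
  have h2 := norm_sub_le ((w - x) * a) (a * (w - x))
  have h3 := norm_mul_le (w - x) a
  have h4 := norm_mul_le a (w - x)
  have h5 : ‖w - x‖ * ‖a‖ ≤ κ * B :=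
    mul_le_mul h ha (norm_nonneg _) ((norm_nonneg _).trans h)
  nlinarith

/-- The tower together with approximately central, approximately equivariant partial isometries. -/
lemma tower_with_isometries {α : A ≃⋆ₐ[ℂ] A} (hTR : TracialRokhlin α) (N L : ℕ) (hL : 1 ≤ L)
    (hN : ApproxInner α^[N]) (F : Finset A) {ρ : ℝ} (hρ : 0 < ρ)
    {x : A} (hx : IsPos x) (hx0 : x ≠ 0) :
    ∃ (e w : ℕ → A) (η : ℝ), (∀ j, IsProjection (e j)) ∧ (∀ i j, i ≠ j → e i * e j = 0) ∧
      (∀ j < 2 * L, star (w j) * w j = e j) ∧ (∀ j < 2 * L, w j * star (w j) = e (j + N)) ∧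
      η ≤ ρ ∧ L * η ≤ 1 / 8 ∧
      (∀ j, j + 1 < N + 2 * L → ‖α (e j) - e (j + 1)‖ ≤ η) ∧
      (∀ j < L, ‖α (w j) - w (j + 1)‖ ≤ ρ) ∧
      (∀ j, ∀ a ∈ F, ‖e j * a - a * e j‖ ≤ ρ) ∧
      (∀ j < L, ∀ a ∈ F, ‖w j * a - a * w j‖ ≤ ρ) ∧
      CuntzLE (1 - ∑ j ∈ Finset.range (N + 2 * L), e j) x := by
  classical
  set B : ℝ := 1 + ∑ a ∈ F, ‖a‖ with hB
  have hB1 : 1 ≤ B := by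
    have := Finset.sum_nonneg (s := F) fun a _ => norm_nonneg a
    linarith
  have haB : ∀ a ∈ F, ‖a‖ ≤ B := by
    intro a ha
    have := Finset.single_le_sum (f := fun a : A => ‖a‖) (fun a _ => norm_nonneg a) ha
    linarith
  set κ : ℝ := min (1 / 12) (ρ / (11 * B)) with hκ
  have hκ0 : 0 < κ := by positivity
  have hκ1 : κ ≤ 1 / 12 := min_le_left _ _
  have hκ2 : 11 * κ * B ≤ ρ := by
    have : κ ≤ ρ / (11 * B) := min_le_right _ _
    rw [le_div_iff₀ (by positivity)] at this
    linarith
  have hκρ : 11 * κ ≤ ρ := by nlinarith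
  set η : ℝ := κ / (N + 4 * L + 2) with hη
  have hη0 : 0 < η := by positivity
  have hηκ : (N + 4 * L + 2) * η = κ := by rw [hη]; field_simp
  have hNL : (0 : ℝ) ≤ N := Nat.cast_nonneg N
  have hL0 : (0 : ℝ) ≤ L := Nat.cast_nonneg L
  have hηle : η ≤ κ := by nlinarith
  have hLη : L * η ≤ κ := by nlinarith
  obtain ⟨v, hv, hve⟩ := inter_unitary α N L hN F hη0
  obtain ⟨e, h1, h2, h3, h4, h5⟩ := rokhlin_nat hTR (insert v F) hη0 (N + 2 * L) (by omega) hx hx0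
  obtain ⟨u, hu, hue, huF⟩ := hve (e 0) (h4 0 v (Finset.mem_insert_self _ _))
  have hUe : ∀ j < 2 * L, ‖e (j + N) - α^[j] u * e j * star (α^[j] u)‖ ≤ κ := by
    intro j hj
    have hU := iter_unitary α j hu
    have t1 := tower_iter α e _ h3 0 j (by omega)
    have t2 := tower_iter α e _ h3 0 (j + N) (by omega)
    rw [zero_add] at t1 t2
    rw [Function.iterate_add_apply] at t2
    have t3 : ‖α^[j] (u * e 0 * star u) - α^[j] (α^[N] (e 0))‖ ≤ 2 * η := by
      rw [iter_norm_sub]; exact hue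
    rw [iter_mul, iter_mul, iter_star] at t3
    have t4 : ‖α^[j] u * α^[j] (e 0) * star (α^[j] u) - α^[j] u * e j * star (α^[j] u)‖ ≤ j * η := by
      rw [← sub_mul, ← mul_sub, norm_conj' hU]; exact t1
    have e1 : e (j + N) - α^[j] u * e j * star (α^[j] u)
        = -(α^[j] (α^[N] (e 0)) - e (j + N))
          - (α^[j] u * α^[j] (e 0) * star (α^[j] u) - α^[j] (α^[N] (e 0)))
          + (α^[j] u * α^[j] (e 0) * star (α^[j] u) - α^[j] u * e j * star (α^[j] u)) := by abel
    rw [e1]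
    refine (norm_add_le _ _).trans ?_
    have n1 := norm_sub_le (-(α^[j] (α^[N] (e 0)) - e (j + N)))
      (α^[j] u * α^[j] (e 0) * star (α^[j] u) - α^[j] (α^[N] (e 0)))
    rw [norm_neg] at n1
    push_cast at t2
    have hj' : (j : ℝ) ≤ 2 * L := by exact_mod_cast hj.le
    nlinarith
  have hw : ∀ j, ∃ w : A, j < 2 * L →
      star w * w = e j ∧ w * star w = e (j + N) ∧ ‖w - α^[j] u * e j‖ ≤ 4 * κ := by
    intro j
    by_cases hj : j < 2 * L
    · obtain ⟨w, hw⟩ := w_exists (h1 j) (h1 (j + N)) (iter_unitary α j hu) (by linarith) (hUe j hj)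
      exact ⟨w, fun _ => hw⟩
    · exact ⟨0, fun h => absurd h hj⟩
  choose w hw using hw
  refine ⟨e, w, η, h1, h2, fun j hj => (hw j hj).1, fun j hj => (hw j hj).2.1, by linarith,
    by linarith, h3, ?_, ?_, ?_, h5⟩
  · intro j hj
    have a1 := (hw j (by omega)).2.2
    have a2 := (hw (j + 1) (by omega)).2.2
    have a3 := h3 j (by omega)
    have b1 : ‖α (w j) - α^[j + 1] u * α (e j)‖ ≤ 4 * κ := by
      rw [Function.iterate_succ_apply', ← map_mul, norm_α_sub]; exact a1
    have b2 : ‖α^[j + 1] u * α (e j) - α^[j + 1] u * e (j + 1)‖ ≤ η := by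
      rw [← mul_sub, CStarRing.norm_mem_unitary_mul _ (iter_unitary α (j + 1) hu)]; exact a3
    have c1 := norm_sub_le_norm_sub_add_norm_sub (α (w j)) (α^[j + 1] u * α (e j)) (w (j + 1))
    have c2 := norm_sub_le_norm_sub_add_norm_sub (α^[j + 1] u * α (e j)) (α^[j + 1] u * e (j + 1))
      (w (j + 1))
    rw [norm_sub_rev _ (w (j + 1))] at c2
    rw [norm_sub_rev (α^[j + 1] u * e (j + 1)) (w (j + 1))] at c2
    rw [norm_sub_rev (w (j + 1)) (α^[j + 1] u * α (e j))] at c2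
    linarith
  · intro j a ha
    have := h4 j a (Finset.mem_insert_of_mem ha)
    linarith
  · intro j hj a ha
    have a1 := (hw j (by omega)).2.2
    have a2 := h4 j a (Finset.mem_insert_of_mem ha)
    have a3 := huF j (by omega) a ha
    have hU := norm_unitary_le (iter_unitary α j hu)
    have hUc : ‖α^[j] u * e j * a - a * (α^[j] u * e j)‖ ≤ 3 * η := by
      have e1 : α^[j] u * e j * a - a * (α^[j] u * e j)
          = α^[j] u * (e j * a - a * e j) + (α^[j] u * a - a * α^[j] u) * e j := by noncomm_ring
      rw [e1]
      refine (norm_add_le _ _).trans ?_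
      rw [CStarRing.norm_mem_unitary_mul _ (iter_unitary α j hu)]
      have n1 := norm_mul_le (α^[j] u * a - a * α^[j] u) (e j)
      have n2 := norm_proj_le (h1 j)
      nlinarith [norm_nonneg (α^[j] u * a - a * α^[j] u), norm_nonneg (e j)]
    have := comm_near a1 (haB a ha) hUc
    nlinarith

end Helpers

/-- If `A` is a unital separable simple C*-algebra with the SP-property,
stable rank one, and the Fundamental Comparison Property, and `α` is an automorphism such
that `α ^ r` is approximately inner for some `r ≥ 1`, then the tracial Rokhlin property for
`α` implies the tracial cyclic Rokhlin property. -/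
theorem stmt3 {A : Type*} [CStarAlgebra A] [TopologicalSpace.SeparableSpace A]
    (hsimple : IsSimpleCStar A) (hSP : SPProperty A)
    (hsr1 : StableRankOne A) (hFCP : FundamentalComparison A)
    (α : A ≃⋆ₐ[ℂ] A) (r : ℕ) (hr : 1 ≤ r) (hai : ApproxInner ((⇑α)^[r]))
    (hTR : TracialRokhlin α) :
    TracialCyclicRokhlin α := by
  classical
  intro F ε hε n x hx hx0
  obtain ⟨p, hp, hp0, hpx⟩ := hSP x hx hx0
  obtain ⟨δ, hδ, hδp⟩ := tr_lower hsimple hp hp0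
  rcases small_proj hr hai hTR hp hp0 (half_pos hδ) with h1p | ⟨q, hq, hq0, hqτ⟩
  · refine ⟨fun _ => 0, fun _ => proj_zero, fun _ _ _ => by simp, fun _ => by simpa using hε,
      fun _ a _ => by simpa using hε, ?_⟩
    simpa using cuntz_trans hp hpx h1p
  obtain ⟨L0, hL0⟩ := coefs (ε / 16) (by positivity)
  obtain ⟨L, hLdef⟩ : ∃ L, L = r * (L0 + 1) := ⟨_, rfl⟩
  have hL1 : 1 ≤ L := by rw [hLdef]; exact Nat.mul_pos hr (Nat.succ_pos _)
  have hLL0 : L0 ≤ L := by rw [hLdef]; nlinarith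
  obtain ⟨c, s, hcs, hc0, hs0, hcL, hcθ, hsθ⟩ := hL0 L hLL0 hL1
  obtain ⟨m0, hm0⟩ := exists_nat_gt (4 / δ)
  obtain ⟨m, hm⟩ : ∃ m, m = m0 + 2 := ⟨_, rfl⟩
  obtain ⟨k, hk⟩ : ∃ k, k = m * (n + 1) := ⟨_, rfl⟩
  have hkm : m ≤ k := by rw [hk]; nlinarith
  have hkδ : 4 < δ * (k + 2) := by
    rw [div_lt_iff₀ hδ] at hm0
    have : (m0 : ℝ) ≤ k := by exact_mod_cast (by omega : m0 ≤ k)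
    nlinarith
  obtain ⟨N, hN⟩ : ∃ N, N = k * L := ⟨_, rfl⟩
  have hNK : N = (m * L) * (n + 1) := by rw [hN, hk]; ring
  have h2LN : 2 * L ≤ N := by rw [hN]; exact Nat.mul_le_mul_right _ (by omega)
  have hiL : ApproxInner (⇑α)^[L] := by
    rw [hLdef, Function.iterate_mul]; exact approxInner_iter hai _
  have hiN : ApproxInner (⇑α)^[N] := by
    rw [hN, mul_comm, Function.iterate_mul]; exact approxInner_iter hiL _
  obtain ⟨K, hK⟩ : ∃ K, K = m * L := ⟨_, rfl⟩
  have hρ : 0 < ε / (8 * (K + 1)) := by positivity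
  have hKρ : (K : ℝ) * (4 * (ε / (8 * (K + 1)))) < ε / 2 + ε / 4 := by
    have : (K : ℝ) * (4 * (ε / (8 * (K + 1)))) = (K / (K + 1)) * (ε / 2) := by field_simp; ring
    rw [this]
    have h2 : (K : ℝ) / (K + 1) ≤ 1 := by
      rw [div_le_one (by positivity)]; linarith
    nlinarith
  obtain ⟨e, w, η, he, ho, hw1, hw2, hηρ, hηL, hαe, hαw, heF, hwF, hcu⟩ :=
    tower_with_isometries hTR N L hL1 hiN (F ∪ F.image star) hρ (pos_proj hq) hq0
  obtain ⟨E, hE1, hE2, hE3, hE4, hE5⟩ := rokhlin_rotation α e w L N K n hL1 h2LN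
    (by rw [hNK, hK]) he ho hw1 hw2 c s hcs hc0 hs0 hcL hcθ hsθ
    (fun j hj => (hαe j (by omega)).trans hηρ) hαw (↑(F ∪ F.image star) : Set A)
    (by
      intro a ha
      simp only [Finset.coe_union, Finset.coe_image, Set.mem_union, Finset.mem_coe,
        Set.mem_image] at ha ⊢
      rcases ha with ha | ⟨b, hb, rfl⟩
      · exact Or.inr ⟨a, ha, rfl⟩
      · left; rwa [star_star])
    (fun j a ha => heF j a (by exact_mod_cast ha)) (fun j hj a ha => hwF j hj a (by exact_mod_cast ha))
  refine ⟨E, hE1, hE2, fun j => (hE3 j).trans_lt (by linarith), fun j a ha => ?_, ?_⟩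
  · have := hE4 j a (by simp [ha])
    linarith
  have hEp : IsProjection (1 - ∑ j, E j) :=
    proj_one_sub (proj_sum _ _ (fun i _ => hE1 i) (fun i _ j _ => hE2 i j))
  refine cuntz_trans hp hpx ?_
  have hkey : ∀ τ : A →ₗ[ℂ] ℂ, IsTracialState τ → (τ (1 - ∑ j, E j)).re < (τ p).re := by
    intro τ hτ
    refine lt_of_lt_of_le ?_ (hδp τ hτ)
    have hM : N + 2 * L = (k + 2) * L := by rw [hN]; ring
    rw [hM] at hcu hαe
    obtain ⟨hb1, hb2⟩ := block_trace α L (k + 2) hiL e he ho hαe hηL hτ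
    have t1 := (tr_cuntz hτ (proj_one_sub (proj_sum _ _ (fun i _ => he i) (fun i _ j _ => ho i j)))
      hq hcu).trans_lt (hqτ τ hτ)
    have t2 : (τ (1 - ∑ j, E j)).re = 1 - ∑ j ∈ Finset.range N, (τ (e j)).re := by
      rw [map_sub, Complex.sub_re, hE5 τ hτ, hτ.2.1, Complex.one_re]
    rw [map_sub, Complex.sub_re, hτ.2.1, Complex.one_re, map_sum, Complex.re_sum, sum_blocks,
      Finset.sum_range_succ, Finset.sum_range_succ, hb1 k (by omega), hb1 (k + 1) (by omega)] at t1
    rw [t2, hN, sum_blocks]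
    push_cast at hb2
    have t3 : 2 * ∑ j ∈ Finset.range L, (τ (e j)).re < δ / 2 := by
      by_contra hcon
      push Not at hcon
      have : (0 : ℝ) ≤ k := Nat.cast_nonneg k
      nlinarith
    linarith
  obtain ⟨q', -, h1, h2, z, hz1, hz2⟩ := hFCP _ p hEp hp hkey
  refine ⟨z, hz1.symm, subset_closure ⟨q', ?_⟩⟩
  simp only [h2, h1, hz2]
end

section
/- Let A be a simple unital C*-algebra with stable rank one and the Fundamental Comparison Property. Then TR(A) = 0 if and only if for every finite set F ⊆ A and every ε > 0 there is a finite-dimensional C*-subalgebra B ⊆ A with unit p such that: (1) ‖xp − px‖ < ε for all x ∈ F; (2) pxp lies within ε of B for all x ∈ F; (3′) τ(1 − p) < ε for every tracial state τ on A. -/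
open Filter Topology

/-- In a simple algebra `aAb ≠ 0` for nonzero `a, b`. -/
theorem simple_prime {A : Type*} [CStarAlgebra A] (hs : IsSimpleCStar A) {a b : A}
    (ha : a ≠ 0) (hb : b ≠ 0) : ∃ y, a * y * b ≠ 0 := by
  by_contra hcon
  push Not at hcon
  let I : TwoSidedIdeal A := TwoSidedIdeal.mk' {z | ∀ y, a * y * z = 0}
    (by simp) (by intro x y hx hy w; simp [mul_add, hx w, hy w])
    (by intro x hx w; simp [hx w])
    (by intro x y hy w; have := hy (w * x); simpa [mul_assoc] using this)
    (by intro x y hx w; rw [← mul_assoc, hx w, zero_mul])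
  have hI : (I : Set A) = {z | ∀ y, a * y * z = 0} := by
    simp [I]
  have hcl : IsClosed (I : Set A) := by
    rw [hI, Set.ofPred_forall]
    exact isClosed_iInter fun y => isClosed_eq (by fun_prop) (by fun_prop)
  rcases hs I hcl with h | h
  · have : b ∈ (I : Set A) := by rw [hI]; exact hcon
    rw [h] at this
    exact hb this
  · have : (1 : A) ∈ (I : Set A) := by rw [h]; trivial
    rw [hI] at this
    have := this 1
    simp at this
    exact ha this

/-- In a simple unital algebra every nonzero element generates `1` algebraically. -/
theorem simple_gen {A : Type*} [CStarAlgebra A] (hs : IsSimpleCStar A) {c : A}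
    (hc : c ≠ 0) : ∃ l : List (A × A), (1 : A) = (l.map fun p => p.1 * c * p.2).sum := by
  let S : AddSubgroup A :=
    { carrier := {s | ∃ l : List (A × A), s = (l.map fun p => p.1 * c * p.2).sum}
      zero_mem' := ⟨[], by simp⟩
      add_mem' := by
        rintro _ _ ⟨l, rfl⟩ ⟨m, rfl⟩
        exact ⟨l ++ m, by simp⟩
      neg_mem' := by
        rintro _ ⟨l, rfl⟩
        refine ⟨l.map fun p => (-p.1, p.2), ?_⟩
        induction l with
        | nil => simp
        | cons h t ih =>
          simp only [List.map_cons, List.sum_cons, neg_add]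
          rw [ih]; simp }
  have hl : ∀ x y, y ∈ S → x * y ∈ S := by
    rintro x _ ⟨l, rfl⟩
    refine ⟨l.map fun p => (x * p.1, p.2), ?_⟩
    rw [← List.sum_map_mul_left]
    simp [Function.comp_def, mul_assoc]
  have hr : ∀ x y, x ∈ S → x * y ∈ S := by
    rintro _ y ⟨l, rfl⟩
    refine ⟨l.map fun p => (p.1, p.2 * y), ?_⟩
    rw [← List.sum_map_mul_right]
    simp [Function.comp_def, mul_assoc]
  let I : TwoSidedIdeal A := TwoSidedIdeal.mk' (S.topologicalClosure : Set A)
    (zero_mem _) (fun hx hy => add_mem hx hy) (fun hx => neg_mem hx)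
    (by
      intro x y hy
      exact map_mem_closure (by fun_prop) hy fun z hz => hl x z hz)
    (by
      intro x y hx
      exact map_mem_closure (f := fun z => z * y) (by fun_prop) hx fun z hz => hr z y hz)
  have hI : (I : Set A) = closure (S : Set A) := by
    simp [I]
  have hcS : c ∈ S := ⟨[(1, 1)], by simp⟩
  rcases hs I (by rw [hI]; exact isClosed_closure) with h | h
  · exfalso
    have : c ∈ (I : Set A) := by rw [hI]; exact subset_closure hcS
    rw [h] at this
    exact hc this
  · have h1 : (1 : A) ∈ closure (S : Set A) := by rw [← hI, h]; trivial
    obtain ⟨s, hsS, hd⟩ := Metric.mem_closure_iff.1 h1 1 one_pos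
    rw [dist_eq_norm] at hd
    have hu : IsUnit s := by
      have := isUnit_one_sub_of_norm_lt_one hd
      simpa using this
    obtain ⟨t, ht⟩ := hu.exists_right_inv
    have := hr s t hsS
    rw [ht] at this
    exact this

/-- A simple unital C*-algebra with a minimal projection is finite-dimensional. -/
theorem simple_fd {A : Type*} [CStarAlgebra A] (hs : IsSimpleCStar A) {e : A}
    (he : e ≠ 0) (hmin : ∀ z, ∃ t : ℂ, e * z * e = t • e) : FiniteDimensional ℂ A := by
  classical
  obtain ⟨l, hl⟩ := simple_gen hs he
  let T : Finset A := (l.toFinset ×ˢ l.toFinset).image fun pq => pq.1.1 * e * pq.2.2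
  have key : ∀ a : A, a ∈ Submodule.span ℂ (T : Set A) := by
    intro a
    have h1 : a = (l.map fun p => (l.map fun q => (p.1 * e * p.2) * a * (q.1 * e * q.2)).sum).sum := by
      conv_lhs => rw [← one_mul a, ← mul_one (1 * a), hl]
      simp only [List.sum_map_mul_left, List.sum_map_mul_right]
    rw [h1]
    refine list_sum_mem ?_
    intro x hx
    obtain ⟨p, hp, rfl⟩ := List.mem_map.1 hx
    refine list_sum_mem ?_
    intro x hx
    obtain ⟨q, hq, rfl⟩ := List.mem_map.1 hx
    obtain ⟨t, ht⟩ := hmin (p.2 * a * q.1)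
    have : p.1 * e * p.2 * a * (q.1 * e * q.2) = t • (p.1 * e * q.2) := by
      calc _ = p.1 * (e * (p.2 * a * q.1) * e) * q.2 := by noncomm_ring
        _ = _ := by rw [ht]; simp
    rw [this]
    refine Submodule.smul_mem _ _ (Submodule.subset_span ?_)
    simp only [T, Finset.coe_image, Set.mem_image, Finset.mem_coe, Finset.mem_product, List.mem_toFinset]
    exact ⟨(p, q), ⟨hp, hq⟩, rfl⟩
  have : Submodule.span ℂ (T : Set A) = ⊤ := by
    rw [eq_top_iff]; intro a _; exact key a
  exact ⟨⟨T, this⟩⟩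

/-- Trace of a positive element is nonneg. -/
theorem trace_nonneg {A : Type*} [CStarAlgebra A] [PartialOrder A] [StarOrderedRing A]
    {τ : A →ₗ[ℂ] ℂ} (hτ : IsTracialState τ) {a : A} (ha : 0 ≤ a) : 0 ≤ (τ a).re := by
  obtain ⟨b, rfl⟩ := CStarAlgebra.nonneg_iff_eq_star_mul_self.1 ha
  obtain ⟨r, hr, h⟩ := hτ.1 b
  rw [h]; simpa using hr

theorem trace_mono {A : Type*} [CStarAlgebra A] [PartialOrder A] [StarOrderedRing A]
    {τ : A →ₗ[ℂ] ℂ} (hτ : IsTracialState τ) {a b : A} (h : a ≤ b) : (τ a).re ≤ (τ b).re := by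
  have := trace_nonneg hτ (sub_nonneg.2 h)
  rw [map_sub, Complex.sub_re] at this
  linarith

theorem trace_alg {A : Type*} [CStarAlgebra A]
    {τ : A →ₗ[ℂ] ℂ} (hτ : IsTracialState τ) (r : ℝ) : (τ (algebraMap ℝ A r)).re = r := by
  rw [Algebra.algebraMap_eq_smul_one, ← Complex.coe_smul, map_smul, hτ.2.1]
  simp

theorem trace_star_re {A : Type*} [CStarAlgebra A]
    {τ : A →ₗ[ℂ] ℂ} (hτ : IsTracialState τ) (a : A) : (τ (star a)).re = (τ a).re := by
  obtain ⟨r, _, h⟩ := hτ.1 (1 + Complex.I • a)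
  obtain ⟨r', _, h'⟩ := hτ.1 a
  have h2 : star (1 + Complex.I • a) * (1 + Complex.I • a) =
      1 + Complex.I • a - Complex.I • star a + star a * a := by
    simp [add_mul, mul_add, smul_smul]
    abel
  rw [h2] at h
  have := congrArg Complex.im h
  simp [h', hτ.2.1] at this
  linarith

/-- Uniform faithfulness of traces on a simple algebra. -/
theorem trace_faithful {A : Type*} [CStarAlgebra A] [PartialOrder A] [StarOrderedRing A]
    (hs : IsSimpleCStar A) {c : A} (hc : c ≠ 0) :
    ∃ C : ℝ, 0 < C ∧ ∀ τ : A →ₗ[ℂ] ℂ, IsTracialState τ → 1 ≤ C * (τ (c * star c)).re := by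
  obtain ⟨l, hl⟩ := simple_gen hs hc
  let w : A := (l.map fun p => p.2 * p.1).sum
  refine ⟨‖w‖ ^ 2 + 1, by positivity, fun τ hτ => ?_⟩
  have h1 : τ (c * w) = 1 := by
    rw [← hτ.2.1, hl]
    simp only [w, ← List.sum_map_mul_left, map_list_sum, List.map_map, Function.comp_def]
    congr 1
    apply List.map_congr_left
    intro p _
    rw [← mul_assoc, hτ.2.2, ← mul_assoc]
  have h2 : (τ (star w * star c)).re = 1 := by
    rw [← star_mul, trace_star_re hτ, h1]; rfl
  set t : ℝ := ‖w‖ ^ 2 + 1 with ht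
  have htp : 0 < t := by positivity
  have h3 := trace_nonneg hτ (star_mul_self_nonneg ((t : ℂ) • star c - w))
  have h4 : (τ (star w * w)).re ≤ ‖w‖ ^ 2 := by
    have := trace_mono hτ (CStarAlgebra.star_mul_le_algebraMap_norm_sq (a := w))
    rwa [trace_alg hτ] at this
  have h5 : star ((t : ℂ) • star c - w) * ((t : ℂ) • star c - w) =
      ((t : ℂ) * t) • (c * star c) - (t : ℂ) • (c * w) - (t : ℂ) • (star w * star c) + star w * w := by
    simp only [star_sub, star_smul, star_star, sub_mul, mul_sub, smul_mul_assoc, mul_smul_comm,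
      smul_smul, RCLike.star_def, Complex.conj_ofReal, smul_sub]
    abel
  rw [h5] at h3
  simp [h1, h2] at h3
  nlinarith

/-- Key transport lemma: if `e x*x e` is invertible in `eAe`, then `e` is equivalent to a
projection in `xAx*`. -/
theorem transport {A : Type*} [CStarAlgebra A] [PartialOrder A] [StarOrderedRing A]
    {e x : A} (he : IsProjection e) (hu : IsUnit (e * (star x * x) * e + (1 - e))) :
    ∃ m : A, star (x * m) * (x * m) = e := by
  obtain ⟨hsa, hid⟩ := he
  have hid' : e * e = e := hid
  have hsa' : star e = e := hsa
  set h := e * (star x * x) * e + (1 - e) with hh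
  have h1 : 0 ≤ e * (star x * x) * e := by
    have := star_left_conjugate_nonneg (star_mul_self_nonneg x) e
    rwa [hsa'] at this
  have h2 : 0 ≤ 1 - e := by
    have := star_mul_self_nonneg (1 - e)
    simpa [sub_mul, mul_sub, hsa', hid'] using this
  have h0 : 0 ≤ h := add_nonneg h1 h2
  have hpos : IsStrictlyPositive h := hu.isStrictlyPositive h0
  set g := h ^ (-(1/2) : ℝ) with hg
  have hgh : g * h * g = 1 := CFC.conjugate_rpow_neg_one_half h hpos
  have hgs : star g = g := (IsSelfAdjoint.of_nonneg CFC.rpow_nonneg).star_eq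
  have hc : Commute h e := by
    show h * e = e * h
    rw [hh]
    simp only [add_mul, mul_add, sub_mul, mul_sub, mul_assoc, hid', one_mul, mul_one]
    rw [← mul_assoc e e, hid']
  have hgc : g * e = e * g := by
    rw [hg, CFC.rpow_eq_cfc_real h0]
    exact (Commute.cfc hc (by rw [(IsSelfAdjoint.of_nonneg h0).star_eq]; exact hc) _).eq
  have h3 : e * (star x * x) * e = e * h * e := by
    rw [hh]
    simp only [add_mul, mul_add, sub_mul, mul_sub, mul_assoc, hid', one_mul, mul_one]
    rw [← mul_assoc e e, hid']
    simp
  refine ⟨e * g, ?_⟩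
  calc star (x * (e * g)) * (x * (e * g)) = g * (e * (star x * x) * e) * g := by
        simp only [star_mul, hgs, hsa']; noncomm_ring
    _ = (g * e) * h * (e * g) := by rw [h3]; noncomm_ring
    _ = e * (g * h * g) * e := by rw [← hgc]; nth_rw 1 [hgc]; noncomm_ring
    _ = e := by rw [hgh, mul_one]; exact hid

/-- If `q` is in the closure of `xx*A` then `q` is equivalent to a projection in `x*Ax`. -/
theorem transport_closure {A : Type*} [CStarAlgebra A] [PartialOrder A] [StarOrderedRing A]
    {q x : A} (hq : IsProjection q) (hcl : q ∈ closure (Set.range fun z => x * star x * z)) :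
    ∃ m : A, star (star x * m) * (star x * m) = q := by
  apply transport hq
  obtain ⟨hsa, hid⟩ := hq
  have hid' : q * q = q := hid
  have hsa' : star q = q := hsa
  obtain ⟨_, ⟨z, rfl⟩, hd⟩ := Metric.mem_closure_iff.1 hcl 1 one_pos
  rw [dist_eq_norm] at hd
  have hqn : ‖q‖ ≤ 1 := IsStarProjection.norm_le q ⟨hid, hsa⟩
  set k := q * (x * star x * z) * q + (1 - q) with hk
  have hku : IsUnit k := by
    have : k = 1 - q * (q - x * star x * z) * q := by
      rw [hk]; simp only [mul_sub, sub_mul, hid']; abel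
    rw [this]
    apply isUnit_one_sub_of_norm_lt_one
    calc _ ≤ ‖q‖ * ‖q - x * star x * z‖ * ‖q‖ := by
          refine (norm_mul_le _ _).trans ?_
          gcongr
          exact norm_mul_le _ _
      _ ≤ 1 * ‖q - x * star x * z‖ * 1 := by gcongr
      _ < 1 := by simpa using hd
  set v := star x * z * q with hv
  have hkk : k * star k = q * (x * (v * star v) * star x) * q + (1 - q) := by
    rw [hk, hv]
    simp only [star_add, star_mul, star_sub, star_one, star_star, hsa']
    have e1 : q * (1 - q) = 0 := by simp [mul_sub, hid']
    have e2 : (1 - q) * q = 0 := by simp [sub_mul, hid']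
    have e3 : (1 - q) * (1 - q) = 1 - q := by simp [sub_mul, mul_sub, hid']
    have : ∀ a b : A, (q * a * q + (1 - q)) * (q * b * q + (1 - q))
        = q * a * (q * q) * b * q + q * a * (q * (1 - q)) + ((1 - q) * q) * b * q
          + (1 - q) * (1 - q) := by
      intro a b; noncomm_ring
    have := this (x * star x * z) (star z * (x * star x))
    rw [e1, e2, e3, hid'] at this
    calc _ = _ := by simpa only [mul_assoc] using this
      _ = _ := by
        have e4 : ∀ a, q * (q * a) = q * a := fun a => by rw [← mul_assoc, hid']
        simp only [mul_zero, zero_mul, add_zero, mul_assoc, e4]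
  set M : ℝ := ‖v * star v‖ + 1 with hM
  have hM1 : 1 ≤ M := by simp [hM]
  have hqp : 0 ≤ 1 - q := by
    have := star_mul_self_nonneg (1 - q)
    simpa [sub_mul, mul_sub, hsa', hid'] using this
  have hle : k * star k ≤ M • (q * (star (star x) * star x) * q + (1 - q)) := by
    rw [hkk, smul_add, star_star]
    apply add_le_add
    · have h1 : v * star v ≤ algebraMap ℝ A M := by
        refine (IsSelfAdjoint.le_algebraMap_norm_self (IsSelfAdjoint.mul_star_self v)).trans ?_
        exact algebraMap_mono A (by simp [hM])
      have h2 := star_left_conjugate_le_conjugate h1 (star x * q)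
      have e1 : star (star x * q) * (v * star v) * (star x * q) =
        q * (x * (v * star v) * star x) * q := by
          simp only [star_mul, star_star, hsa', mul_assoc]
      have e2 : star (star x * q) * (algebraMap ℝ A M) * (star x * q) =
        M • (q * (x * star x) * q) := by
          simp only [star_mul, star_star, hsa', mul_assoc, Algebra.algebraMap_eq_smul_one,
            smul_mul_assoc, mul_smul_comm, one_mul]
      rwa [e1, e2] at h2
    · have := smul_le_smul_of_nonneg_right hM1 hqp
      simpa using this
  have hsp : IsStrictlyPositive (k * star k) :=
    (hku.mul hku.star).isStrictlyPositive (mul_star_self_nonneg k)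
  have := CStarAlgebra.isUnit_of_le _ hle hsp
  have hM0 : M ≠ 0 := by linarith
  have h3 := this.smul (Units.mk0 M hM0)⁻¹
  convert h3 using 1
  rw [Units.smul_def, smul_smul]
  simp [hM0]

/-- A self-adjoint element either splits or is a multiple of a projection. -/
theorem split_aux {A : Type*} [CStarAlgebra A] {b : A} (hb : IsSelfAdjoint b) (hb0 : b ≠ 0) :
    (∃ z w : A, IsSelfAdjoint (b * z) ∧ IsSelfAdjoint (b * w) ∧ b * z ≠ 0 ∧ b * w ≠ 0 ∧
      (b * z) * (b * w) = 0) ∨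
    ∃ r : ℝ, r ≠ 0 ∧ IsProjection (r • b) := by
  by_cases hsp : ∃ s ∈ spectrum ℝ b, ∃ t ∈ spectrum ℝ b, s ≠ 0 ∧ t ≠ 0 ∧ s ≠ t
  · left
    obtain ⟨s, hs, t, ht, hs0, ht0, hst⟩ := hsp
    let d : ℝ := |s - t| / 2
    have hd : 0 < d := by have := abs_pos.2 (sub_ne_zero.2 hst); positivity
    let k : ℝ → ℝ → ℝ := fun u x => max 0 (d - |x - u|)
    have hk : ∀ u, Continuous (k u) := by intro u; fun_prop
    have hm : ∀ u, b * cfc (k u) b = cfc (fun x => x * k u x) b := by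
      intro u
      rw [cfc_mul (fun x => x) (k u) b (by fun_prop) (hk u).continuousOn, cfc_id' ℝ b]
    have hne : ∀ u ∈ spectrum ℝ b, u ≠ 0 → b * cfc (k u) b ≠ 0 := by
      intro u hu hu0 h0
      rw [hm] at h0
      have h1 : cfc (fun x => x * k u x) b = cfc (fun _ : ℝ => (0 : ℝ)) b := by
        rw [h0, cfc_const_zero]
      have := eqOn_of_cfc_eq_cfc h1 (by have := hk u; fun_prop) (by fun_prop) hb hu
      simp [k, hu0] at this
      linarith
    refine ⟨cfc (k s) b, cfc (k t) b, ?_, ?_, hne s hs hs0, hne t ht ht0, ?_⟩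
    · rw [hm]; exact IsSelfAdjoint.cfc
    · rw [hm]; exact IsSelfAdjoint.cfc
    · rw [hm, hm, ← cfc_mul _ _ b (by have := hk s; fun_prop) (by have := hk t; fun_prop)]
      rw [← cfc_const_zero ℝ b]
      congr 1
      funext x
      have : k s x = 0 ∨ k t x = 0 := by
        by_contra hcon
        push Not at hcon
        have h1 : |x - s| < d := by
          by_contra h; exact hcon.1 (by simp [k]; linarith)
        have h2 : |x - t| < d := by
          by_contra h; exact hcon.2 (by simp [k]; linarith)
        have h3 : |s - t| ≤ |x - s| + |x - t| := by
          have := abs_sub_le s x t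
          rwa [abs_sub_comm s x] at this
        have : |s - t| = 2 * d := by simp [d]; ring
        linarith
      rcases this with h | h <;> simp [h]
  · right
    push Not at hsp
    have hex : ∃ s ∈ spectrum ℝ b, s ≠ 0 := by
      by_contra hcon
      push Not at hcon
      apply hb0
      rw [← cfc_id' ℝ b, ← cfc_const_zero ℝ b]
      exact cfc_congr fun x hx => hcon x hx
    obtain ⟨s, hs, hs0⟩ := hex
    refine ⟨s⁻¹, inv_ne_zero hs0, ?_, ?_⟩
    · exact (IsSelfAdjoint.all _).smul hb
    · have : b * b = s • b := by
        conv_lhs => rw [← cfc_id' ℝ b]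
        conv_rhs => rw [← cfc_id' ℝ b]
        rw [← cfc_mul _ _ b, ← cfc_smul s _ b]
        apply cfc_congr
        intro x hx
        by_cases hx0 : x = 0
        · simp [hx0]
        · have := hsp s hs x hx hs0 hx0
          simp [this]
      show s⁻¹ • b * s⁻¹ • b = s⁻¹ • b
      rw [smul_mul_smul_comm, this, smul_smul]
      congr 1
      field_simp

theorem split {A : Type*} [CStarAlgebra A] (hs : IsSimpleCStar A)
    (hfd : ¬ FiniteDimensional ℂ A) {b : A} (hb : IsSelfAdjoint b) (hb0 : b ≠ 0) :
    ∃ z w : A, IsSelfAdjoint (b * z) ∧ IsSelfAdjoint (b * w) ∧ b * z ≠ 0 ∧ b * w ≠ 0 ∧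
      (b * z) * (b * w) = 0 := by
  rcases split_aux hb hb0 with h | ⟨r, hr, hsa, hid⟩
  · exact h
  set e := r • b with he
  have hid' : e * e = e := hid
  have hsa' : star e = e := hsa
  have he0 : e ≠ 0 := smul_ne_zero hr hb0
  have heb : ∀ z, e * z = b * (r • z) := by intro z; simp [he]
  clear_value e
  have hex : ∃ h : A, IsSelfAdjoint h ∧ e * h * e = h ∧ ∀ t : ℂ, h ≠ t • e := by
    by_contra hcon
    push Not at hcon
    apply hfd
    apply simple_fd hs he0
    intro z
    have hsae : ∀ y : A, IsSelfAdjoint y → IsSelfAdjoint (e * y * e) := by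
      intro y hy
      show star _ = _
      simp [hsa', hy.star_eq, mul_assoc]
    have hee : ∀ y : A, e * (e * y * e) * e = e * y * e := by
      intro y
      calc _ = (e * e) * y * (e * e) := by noncomm_ring
        _ = _ := by rw [hid']
    obtain ⟨s, hs⟩ := hcon _ (hsae _ (realPart z).2) (hee _)
    obtain ⟨t, ht⟩ := hcon _ (hsae _ (imaginaryPart z).2) (hee _)
    refine ⟨s + Complex.I * t, ?_⟩
    conv_lhs => rw [← realPart_add_I_smul_imaginaryPart z]
    rw [mul_add, add_mul, hs, mul_smul_comm, smul_mul_assoc, ht, smul_smul, add_smul]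
  obtain ⟨h, hhsa, hhe, hht⟩ := hex
  have hh0 : h ≠ 0 := by intro h0; exact hht 0 (by simp [h0])
  have heh : e * h = h := by rw [← hhe]; simp only [← mul_assoc, hid']
  have hhe' : h * e = h := by rw [← hhe]; simp only [mul_assoc, hid']
  have hhb : ∀ z, h * z = b * (r • (h * z)) := by
    intro z; rw [← heb, ← mul_assoc, heh]
  rcases split_aux hhsa hh0 with ⟨z, w, h1, h2, h3, h4, h5⟩ | ⟨s, hs0, hsa2, hid2⟩
  · refine ⟨r • (h * z), r • (h * w), ?_⟩
    rw [← hhb, ← hhb]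
    exact ⟨h1, h2, h3, h4, h5⟩
  · have hid2' : (s • h) * (s • h) = s • h := hid2
    refine ⟨r • (s • h), r • (1 - s • h), ?_⟩
    rw [← heb, ← heb]
    have e1 : e * s • h = s • h := by rw [mul_smul_comm, heh]
    have e2 : s • h * e = s • h := by rw [smul_mul_assoc, hhe']
    rw [mul_sub, e1, mul_one]
    refine ⟨hsa2, hsa.sub hsa2, smul_ne_zero hs0 hh0, ?_, ?_⟩
    · intro h0
      apply hht ((s⁻¹ : ℝ) : ℂ)
      rw [sub_eq_zero] at h0
      rw [h0, Complex.coe_smul, smul_smul, inv_mul_cancel₀ hs0, one_smul]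
    · rw [mul_sub, e2, hid2', sub_self]

/-- `q` lies in the closed right ideal generated by `b`. -/
def InRight {A : Type*} [CStarAlgebra A] (b q : A) : Prop :=
  q ∈ closure (Set.range fun z => b * z)

theorem InRight.mono {A : Type*} [CStarAlgebra A] {b c q : A} (h : InRight (b * c) q) :
    InRight b q := by
  refine closure_mono ?_ h
  rintro _ ⟨z, rfl⟩
  exact ⟨c * z, by simp [mul_assoc]⟩

theorem InRight.add {A : Type*} [CStarAlgebra A] {b p q : A} (h : InRight b p)
    (h' : InRight b q) : InRight b (p + q) := by
  refine map_mem_closure₂ (f := fun x y : A => x + y) (by fun_prop) h h' ?_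
  rintro _ ⟨z, rfl⟩ _ ⟨w, rfl⟩
  exact ⟨z + w, by simp [mul_add]⟩

theorem InRight.mul_eq_zero {A : Type*} [CStarAlgebra A] {b p q : A} (h : InRight b q)
    (h' : p * b = 0) : p * q = 0 := by
  have : q ∈ {x | p * x = 0} := by
    refine closure_minimal ?_ (isClosed_eq (by fun_prop) (by fun_prop)) h
    rintro _ ⟨z, rfl⟩
    simp [← mul_assoc, h']
  exact this

/-- Range projection of a partial isometry. -/
theorem proj_of_pi {A : Type*} [CStarAlgebra A] {x e : A} (he : IsProjection e)
    (h : star x * x = e) : IsProjection (x * star x) := by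
  have hid : e * e = e := he.2
  have hsa : star e = e := he.1
  have : star (x - x * e) * (x - x * e) = 0 := by
    simp only [star_sub, star_mul, sub_mul, mul_sub, hsa]
    have e1 : star x * (x * e) = e := by rw [← mul_assoc, h, hid]
    have e2 : e * star x * x = e := by rw [mul_assoc, h, hid]
    have e3 : e * star x * (x * e) = e := by rw [mul_assoc, e1, hid]
    rw [h, e1, e2, e3]; simp
  have hx : x = x * e := by
    rw [CStarRing.star_mul_self_eq_zero_iff, sub_eq_zero] at this
    exact this
  refine ⟨IsSelfAdjoint.mul_star_self x, ?_⟩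
  show x * star x * (x * star x) = x * star x
  calc _ = x * (star x * x) * star x := by noncomm_ring
    _ = _ := by rw [h, ← hx]

theorem halve {A : Type*} [CStarAlgebra A] [PartialOrder A] [StarOrderedRing A]
    (hs : IsSimpleCStar A) (hfd : ¬ FiniteDimensional ℂ A) (n : ℕ) :
    ∃ c : A, IsSelfAdjoint c ∧ c ≠ 0 ∧ ∀ q, IsProjection q → InRight c q →
      ∀ τ : A →ₗ[ℂ] ℂ, IsTracialState τ → (τ q).re ≤ (1 / 2) ^ n := by
  induction n with
  | zero =>
    refine ⟨1, IsSelfAdjoint.one A, ?_, ?_⟩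
    · intro h
      apply hfd
      have : Subsingleton A := subsingleton_of_zero_eq_one h.symm
      infer_instance
    · intro q hq _ τ hτ
      have h1 : 0 ≤ 1 - q := by
        have := star_mul_self_nonneg (1 - q)
        have hid' : q * q = q := hq.2
        have hsa' : star q = q := hq.1
        simpa [sub_mul, mul_sub, hsa', hid'] using this
      have := trace_nonneg hτ h1
      rw [map_sub, hτ.2.1] at this
      simp at this ⊢
      exact this
  | succ n ih =>
    obtain ⟨b, hb, hb0, hbt⟩ := ih
    obtain ⟨z, w, h1, h2, h3, h4, h5⟩ := split hs hfd hb hb0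
    set f := b * z with hf
    set g := b * w with hg
    obtain ⟨y, hy⟩ := simple_prime hs h3 h4
    set x := f * y * g with hx
    refine ⟨x * star x, IsSelfAdjoint.mul_star_self x, ?_, ?_⟩
    · rwa [Ne, CStarRing.mul_star_self_eq_zero_iff]
    intro q hq hqr τ hτ
    obtain ⟨m, hm⟩ := transport_closure hq hqr
    set u := star x * m with hu
    have hq' := proj_of_pi hq hm
    have hu' : u = g * (star y * f * m) := by
      rw [hu, hx]; simp [h1.star_eq, h2.star_eq, mul_assoc]
    have hgf : g * f = 0 := by
      have := congrArg star h5
      simpa [h1.star_eq, h2.star_eq] using this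
    have hqf : InRight f q := by
      have : x * star x = f * (y * g * star x) := by rw [hx]; simp [mul_assoc]
      rw [this] at hqr
      exact hqr.mono
    have hz : (u * star u) * q = 0 := by
      apply hqf.mul_eq_zero
      rw [hu']
      simp only [star_mul, h2.star_eq, mul_assoc, hgf, mul_zero]
    have hz' : q * (u * star u) = 0 := by
      have := congrArg star hz
      rwa [star_mul, hq.1.star_eq, hq'.1.star_eq, star_zero] at this
    have hqb : InRight b q := hqf.mono
    have hub : InRight b (u * star u) := by
      apply subset_closure
      exact ⟨w * (star y * f * m) * star u, by rw [hu', hg]; simp only [mul_assoc]⟩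
    have := hbt (q + u * star u) ⟨hq.1.add hq'.1, ?_⟩ (hqb.add hub) τ hτ
    · rw [map_add, hτ.2.2 u, hm, Complex.add_re] at this
      rw [pow_succ]; linarith
    · show (q + u * star u) * (q + u * star u) = _
      have i1 : q * q = q := hq.2
      have i2 : (u * star u) * (u * star u) = u * star u := hq'.2
      rw [add_mul, mul_add, mul_add, hz, hz', i1, i2]; simp

theorem finite_spectrum {A : Type*} [CStarAlgebra A] (B : NonUnitalStarSubalgebra ℂ A)
    [FiniteDimensional ℂ B] {b : A} (hb : b ∈ B) : (spectrum ℝ b).Finite := by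
  nontriviality A
  have hpoly : ∃ P : Polynomial ℂ, P ≠ 0 ∧ Polynomial.aeval b P = 0 := by
    let V : Submodule ℂ A := B.toNonUnitalSubalgebra.toSubmodule
    have hV : FiniteDimensional ℂ V := ‹FiniteDimensional ℂ B›
    let v : ℕ → V := fun n => ⟨b ^ (n + 1), by
      induction n with
      | zero => rw [zero_add, pow_one]; exact hb
      | succ n ih => rw [pow_succ]; exact mul_mem (S := NonUnitalStarSubalgebra ℂ A) (s := B) ih hb⟩
    have hnl : ¬ LinearIndependent ℂ v := by
      intro h
      have := h.finite
      exact not_finite ℕ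
    rw [linearIndependent_iff'] at hnl
    push Not at hnl
    obtain ⟨s, g, hg, i, hi, hgi⟩ := hnl
    refine ⟨∑ j ∈ s, Polynomial.monomial (j + 1) (g j), ?_, ?_⟩
    · intro h
      have := congrArg (fun P => Polynomial.coeff P (i + 1)) h
      simp [Polynomial.finsetSum_coeff, Polynomial.coeff_monomial, hi] at this
      exact hgi this
    · have := congrArg (Subtype.val) hg
      simp only [map_sum, Polynomial.aeval_monomial, ← Algebra.smul_def]
      simpa [v] using this
  obtain ⟨P, hP, hPb⟩ := hpoly
  have h1 : (spectrum ℂ b).Finite := by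
    refine (P.roots.toFinset.finite_toSet).subset ?_
    intro k hk
    have h2 := spectrum.map_polynomial_aeval b P
    rw [hPb, spectrum.zero_eq] at h2
    have h3 : Polynomial.eval k P ∈ ({0} : Set ℂ) := by rw [h2]; exact ⟨k, hk, rfl⟩
    simpa [hP] using h3
  rw [← spectrum.preimage_algebraMap ℂ]
  exact h1.preimage ((algebraMap ℝ ℂ).injective.injOn)

theorem exists_proj {A : Type*} [CStarAlgebra A] [PartialOrder A] [StarOrderedRing A]
    (hs : IsSimpleCStar A) {τ : A →ₗ[ℂ] ℂ} (hτ : IsTracialState τ)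
    (hcond : ∀ (F : Finset A) (ε : ℝ), 0 < ε →
        ∃ (B : NonUnitalStarSubalgebra ℂ A) (p : A),
          FiniteDimensional ℂ B ∧ IsProjection p ∧ p ∈ B ∧
          (∀ b ∈ B, p * b = b ∧ b * p = b) ∧
          (∀ x ∈ F, ‖x * p - p * x‖ < ε) ∧
          (∀ x ∈ F, ∃ b ∈ B, ‖p * x * p - b‖ < ε) ∧
          (∀ τ : A →ₗ[ℂ] ℂ, IsTracialState τ → (τ (1 - p)).re < ε))
    {a : A} (ha : IsSelfAdjoint a) (ha0 : a ≠ 0) :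
    ∃ q z : A, IsProjection q ∧ q ≠ 0 ∧ q = a * z * a := by
  obtain ⟨C, hC, hCt⟩ := trace_faithful hs ha0
  set d := star a * a with hd
  have hd0 : 0 ≤ d := star_mul_self_nonneg a
  have hdsa : star d = d := (IsSelfAdjoint.of_nonneg hd0).star_eq
  set δ := (τ d).re with hδ
  have hδ0 : 0 < δ := by
    have := hCt τ hτ
    rw [hτ.2.2] at this
    by_contra hcon
    push Not at hcon
    nlinarith
  set η := δ / (4 * (‖d‖ + 1)) with hη
  have hη0 : 0 < η := by positivity
  have hη1 : ‖d‖ * η + η = δ / 4 := by rw [hη]; field_simp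
  have hη2 : η ≤ δ / 4 := by nlinarith [norm_nonneg d]
  obtain ⟨B, p, hB, hp, hpB, hunit, -, hcomp, htr⟩ := hcond {d} η hη0
  obtain ⟨b₀, hb₀, hb₀n⟩ := hcomp d (by simp)
  have hpsa : star p = p := hp.1
  have hpid : p * p = p := hp.2
  set b : A := (1 / 2 : ℝ) • (b₀ + star b₀) with hbdef
  have hbsa : IsSelfAdjoint b := (IsSelfAdjoint.all _).smul (IsSelfAdjoint.add_star_self b₀)
  have hbB : b ∈ B := by
    rw [hbdef, ← Complex.coe_smul]
    exact SMulMemClass.smul_mem _ (add_mem hb₀ (star_mem hb₀))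
  set y := p * d * p - b with hy
  have hysa : IsSelfAdjoint y := by
    refine IsSelfAdjoint.sub ?_ hbsa
    show star _ = _
    simp [hpsa, hdsa, mul_assoc]
  have hyn : ‖y‖ ≤ η := by
    have h1 : y = (1 / 2 : ℝ) • ((p * d * p - b₀) + star (p * d * p - b₀)) := by
      have h2 : star (p * d * p) = p * d * p := by simp [hpsa, hdsa, mul_assoc]
      have h3 : p * d * p = (1 / 2 : ℝ) • (p * d * p + p * d * p) := by
        rw [← two_smul ℝ, smul_smul]; norm_num
      rw [star_sub, h2, hy, hbdef]
      nth_rw 1 [h3]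
      rw [← smul_sub]; congr 1; abel
    rw [h1, norm_smul]
    have h4 := norm_add_le (p * d * p - b₀) (star (p * d * p - b₀))
    rw [norm_star] at h4
    have h5 : ‖(1 / 2 : ℝ)‖ = 1 / 2 := by norm_num
    rw [h5]; linarith
  have hyle : y ≤ algebraMap ℝ A η :=
    (IsSelfAdjoint.le_algebraMap_norm_self hysa).trans (algebraMap_mono A hyn)
  have hyge : -algebraMap ℝ A η ≤ y := by
    refine le_trans ?_ (IsSelfAdjoint.neg_algebraMap_norm_le_self hysa)
    exact neg_le_neg (algebraMap_mono A hyn)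
  -- trace estimate
  have htb : δ / 2 < (τ b).re := by
    have h1 := trace_mono hτ hyle
    rw [trace_alg hτ, hy, map_sub, Complex.sub_re] at h1
    have h2 : τ (p * d * p) = τ (d * p) := by
      rw [mul_assoc, hτ.2.2, mul_assoc, hpid]
    have h3 : τ (d * (1 - p)) = τ (star (1 - p) * d * (1 - p)) := by
      have hq : (1 - p) * (1 - p) = 1 - p := by simp [mul_sub, sub_mul, hpid]
      rw [hτ.2.2 (star (1 - p) * d), star_sub, star_one, hpsa, ← mul_assoc, hq, hτ.2.2 d]
    have h4 := trace_mono hτ (star_left_conjugate_le_conjugate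
      (IsSelfAdjoint.le_algebraMap_norm_self (IsSelfAdjoint.of_nonneg hd0)) (1 - p))
    rw [← h3] at h4
    have h5 : star (1 - p) * (algebraMap ℝ A ‖d‖) * (1 - p) = ((‖d‖ : ℝ) : ℂ) • (1 - p) := by
      have hq : (1 - p) * (1 - p) = 1 - p := by simp [mul_sub, sub_mul, hpid]
      rw [Algebra.algebraMap_eq_smul_one, star_sub, star_one, hpsa, Complex.coe_smul,
        mul_smul_comm, smul_mul_assoc, mul_one, hq]
    rw [h5, map_smul, smul_eq_mul, Complex.re_ofReal_mul, mul_sub, mul_one, map_sub,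
      Complex.sub_re] at h4
    have h6 := htr τ hτ
    have h7 : ‖d‖ * (τ (1 - p)).re ≤ ‖d‖ * η := by gcongr
    rw [h2] at h1
    linarith
  have hfin := finite_spectrum B hbB
  set r := δ / 2 with hr
  have hr0 : 0 < r := by positivity
  have hcont : ∀ f : ℝ → ℝ, ContinuousOn f (spectrum ℝ b) := fun f => hfin.continuousOn f
  let χ : ℝ → ℝ := fun x => if r < x then 1 else 0
  set e := cfc χ b with he
  have hesa : star e = e := (IsSelfAdjoint.cfc (f := χ) (a := b)).star_eq
  have heid : e * e = e := by
    rw [he, ← cfc_mul χ χ b (hcont _) (hcont _)]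
    congr 1; funext x; simp only [χ]; split_ifs <;> simp
  have hpe : p * e = e := by
    have h1 : e = b * cfc (fun x => x⁻¹ * χ x) b := by
      conv_rhs => rw [← cfc_id' ℝ b]
      rw [cfc_id' ℝ b]
      conv_rhs => enter [1]; rw [← cfc_id' ℝ b]
      rw [← cfc_mul _ _ b (hcont _) (hcont _), he]
      congr 1; funext x
      simp only [χ]; split_ifs with hx
      · have : x ≠ 0 := by linarith
        field_simp
      · simp
    rw [h1, ← mul_assoc, (hunit b hbB).1]
  have hep : e * p = e := by
    have := congrArg star hpe
    rwa [star_mul, hpsa, hesa] at this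
  have he0 : e ≠ 0 := by
    intro h0
    have h1 : cfc χ b = cfc (fun _ : ℝ => (0 : ℝ)) b := by rw [cfc_const_zero, ← he, h0]
    have h2 := eqOn_of_cfc_eq_cfc h1 (hcont _) (hcont _) hbsa
    have h3 : b ≤ algebraMap ℝ A r := by
      rw [le_algebraMap_iff_spectrum_le hbsa]
      intro x hx
      have := h2 hx
      simp only [χ] at this
      by_contra hcon
      push Not at hcon
      simp [hcon] at this
    have := trace_mono hτ h3
    rw [trace_alg hτ] at this
    linarith
  have hebe : r • e ≤ e * b * e := by
    have h1 : e * b * e = cfc (fun x => χ x * x * χ x) b := by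
      rw [cfc_mul _ _ b (hcont _) (hcont _), cfc_mul _ _ b (hcont _) (hcont _), cfc_id' ℝ b]
    rw [h1, he, ← cfc_smul r χ b (hcont _)]
    apply cfc_mono (fun x _ => ?_) (hcont _) (hcont _)
    simp only [χ]; split_ifs with hx
    · simp; exact hx.le
    · simp
  have heye : -(η • e) ≤ e * y * e := by
    have := star_left_conjugate_le_conjugate hyge e
    rw [hesa] at this
    simpa [Algebra.algebraMap_eq_smul_one, heid] using this
  have hede : (r - η) • e ≤ e * d * e := by
    have h1 : e * d * e = e * b * e + e * y * e := by
      rw [hy, mul_sub, sub_mul]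
      have : e * (p * d * p) * e = (e * p) * d * (p * e) := by noncomm_ring
      rw [this, hep, hpe]; abel
    rw [h1, sub_smul, sub_eq_add_neg]
    exact add_le_add hebe heye
  have he_nn : 0 ≤ e := by
    have := star_mul_self_nonneg e
    rwa [hesa, heid] at this
  have he1_nn : 0 ≤ 1 - e := by
    have := star_mul_self_nonneg (1 - e)
    simpa [sub_mul, mul_sub, hesa, heid] using this
  set κ := min (r - η) 1 with hκ
  have hκ0 : 0 < κ := lt_min (by linarith) one_pos
  have hunit' : IsUnit (e * d * e + (1 - e)) := by
    have h1 : κ • (1 : A) ≤ e * d * e + (1 - e) := by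
      have h2 : κ • (1 : A) = κ • e + κ • (1 - e) := by rw [← smul_add]; simp
      rw [h2]
      apply add_le_add
      · exact (smul_le_smul_of_nonneg_right (min_le_left _ _) he_nn).trans hede
      · simpa using smul_le_smul_of_nonneg_right (min_le_right (r - η) 1) he1_nn
    refine CStarAlgebra.isUnit_of_le _ h1 ?_
    exact IsStrictlyPositive.smul hκ0 isStrictlyPositive_one
  have heP : IsProjection e := ⟨hesa, heid⟩
  obtain ⟨m, hm⟩ := transport heP hunit'
  refine ⟨(a * m) * star (a * m), m * star m, proj_of_pi heP hm, ?_, ?_⟩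
  · intro h0
    rw [CStarRing.mul_star_self_eq_zero_iff] at h0
    apply he0
    rw [← hm, h0]; simp
  · rw [star_mul, ha.star_eq]; noncomm_ring
/-- Let `A` be a simple unital C*-algebra with stable rank one and the
Fundamental Comparison Property. Then `TR(A) = 0` iff for every finite `F ⊆ A` and `ε > 0`
there is a finite-dimensional C*-subalgebra `B ⊆ A` with unit `p` such that `p` almost
commutes with `F`, compresses `F` into `B` up to `ε`, and `τ(1 - p) < ε` for every tracial
state `τ`. -/
theorem stmt7 {A : Type*} [CStarAlgebra A]
    (hsimple : IsSimpleCStar A)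
    (hsr1 : StableRankOne A) (hFCP : FundamentalComparison A) :
    TracialRankZero A ↔
      (∀ (F : Finset A) (ε : ℝ), 0 < ε →
        ∃ (B : NonUnitalStarSubalgebra ℂ A) (p : A),
          FiniteDimensional ℂ B ∧ IsProjection p ∧ p ∈ B ∧
          (∀ b ∈ B, p * b = b ∧ b * p = b) ∧
          (∀ x ∈ F, ‖x * p - p * x‖ < ε) ∧
          (∀ x ∈ F, ∃ b ∈ B, ‖p * x * p - b‖ < ε) ∧
          (∀ τ : A →ₗ[ℂ] ℂ, IsTracialState τ → (τ (1 - p)).re < ε)) := by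

  letI : PartialOrder A := CStarAlgebra.spectralOrder A
  haveI : StarOrderedRing A := CStarAlgebra.spectralOrderedRing A
  constructor
  · intro hTR F ε hε
    by_cases hfd : FiniteDimensional ℂ A
    · refine ⟨⊤, 1, ?_, ⟨IsSelfAdjoint.one A, IsIdempotentElem.one⟩, trivial, ?_, ?_, ?_, ?_⟩
      · exact inferInstanceAs (FiniteDimensional ℂ (⊤ : Submodule ℂ A))
      · simp
      · simp [hε]
      · intro x _
        exact ⟨x, trivial, by simp [hε]⟩
      · intro τ _
        simp [hε]
    · obtain ⟨n, hn⟩ := exists_pow_lt_of_lt_one hε (show (1 / 2 : ℝ) < 1 by norm_num)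
      obtain ⟨c, hc, hc0, hct⟩ := halve hsimple hfd n
      obtain ⟨B, p, h1, h2, h3, h4, h5, h6, x, hx, hxc⟩ := hTR F ε hε (star c * c) ⟨c, rfl⟩
        (by rwa [Ne, CStarRing.star_mul_self_eq_zero_iff])
      refine ⟨B, p, h1, h2, h3, h4, h5, h6, fun τ hτ => ?_⟩
      have hP : IsProjection (1 - p) := by
        refine ⟨(IsSelfAdjoint.one A).sub h2.1, IsIdempotentElem.one_sub h2.2⟩
      have hq := proj_of_pi hP hx.symm
      have hin : InRight c (x * star x) := by
        refine closure_mono ?_ hxc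
        rintro _ ⟨z, rfl⟩
        exact ⟨c * z * (star c * c), by simp only [hc.star_eq, mul_assoc]⟩
      have := hct _ hq hin τ hτ
      rw [hτ.2.2, ← hx] at this
      linarith
  · intro hcond F ε hε a ⟨a', ha'⟩ ha0
    have hasa : IsSelfAdjoint a := by rw [ha']; exact IsSelfAdjoint.star_mul_self a'
    have hex : ∃ τ : A →ₗ[ℂ] ℂ, IsTracialState τ := by
      by_contra hcon
      push Not at hcon
      obtain ⟨q', -, -, h0, w, hw1, hw2⟩ := hFCP 1 0
        ⟨IsSelfAdjoint.one A, IsIdempotentElem.one⟩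
        ⟨IsSelfAdjoint.zero A, IsIdempotentElem.zero⟩ (fun τ hτ => absurd hτ (hcon τ))
      rw [zero_mul] at h0
      rw [← h0, CStarRing.mul_star_self_eq_zero_iff] at hw2
      apply ha0
      rw [← one_mul a, ← hw1, hw2]; simp
    obtain ⟨τ₀, hτ₀⟩ := hex
    obtain ⟨q, z, hq, hq0, hqz⟩ := exists_proj hsimple hτ₀ hcond hasa ha0
    obtain ⟨C, hC, hCt⟩ := trace_faithful hsimple hq0
    obtain ⟨B, p, h1, h2, h3, h4, h5, h6, h7⟩ := hcond F (min ε C⁻¹) (lt_min hε (inv_pos.2 hC))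
    refine ⟨B, p, h1, h2, h3, h4, fun x hx => (h5 x hx).trans_le (min_le_left _ _), ?_, ?_⟩
    · intro x hx
      obtain ⟨b, hb, hbn⟩ := h6 x hx
      exact ⟨b, hb, hbn.trans_le (min_le_left _ _)⟩
    · obtain ⟨q', -, hq'1, hq'2, w, hw1, hw2⟩ := hFCP (1 - p) q
        ⟨(IsSelfAdjoint.one A).sub h2.1, IsIdempotentElem.one_sub h2.2⟩ hq (by
          intro τ hτ
          refine ((h7 τ hτ).trans_le (min_le_right _ _)).trans_le ?_
          have := hCt τ hτ
          rw [hq.1.star_eq, show q * q = q from hq.2] at this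
          rw [inv_le_iff_one_le_mul₀ hC, mul_comm]
          exact this)
      refine ⟨w, hw1.symm, subset_closure ⟨z * a * q' * a * z, ?_⟩⟩
      rw [hw2]
      calc a * (z * a * q' * a * z) * a = (a * z * a) * q' * (a * z * a) := by noncomm_ring
        _ = q' := by rw [← hqz, hq'2, hq'1]
end
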